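/- arXiv:math/0306275 — 3 statements merged into one kernel-verified Lean document; each statement's English description precedes it below -/
import Mathlib

section
/- The ideal I is a radical ideal of R. -/
noncomputable section

/-- Pairs of `n × n` complex matrices are points of `ℂ^{2n²}`. -/
abbrev MatC (n : ℕ) := Matrix (Fin n) (Fin n) ℂ

/-- The polynomial ring `R = ℂ[x_{ij}, y_{ij}]` in `2n²` variables. -/
abbrev PolyRing (n : ℕ) := MvPolynomial ((Fin n × Fin n) ⊕ (Fin n × Fin n)) ℂ

/-- The generic matrix `X = (x_{ij})`. -/
def Xgen (n : ℕ) : Matrix (Fin n) (Fin n) (PolyRing n) :=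
  Matrix.of fun i j => MvPolynomial.X (Sum.inl (i, j))

/-- The generic matrix `Y = (y_{ij})`. -/
def Ygen (n : ℕ) : Matrix (Fin n) (Fin n) (PolyRing n) :=
  Matrix.of fun i j => MvPolynomial.X (Sum.inr (i, j))

/-- The ideal `I` generated by the off-diagonal entries of `XY - YX`. -/
def diagCommIdeal (n : ℕ) : Ideal (PolyRing n) :=
  Ideal.span { f | ∃ i j : Fin n, i ≠ j ∧ f = (Xgen n * Ygen n - Ygen n * Xgen n) i j }

section CohenMacaulay

universe u

open IsLocalRing RingTheory.Sequence CategoryTheory Abelian Pointwise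

variable {A : Type u} [CommRing A]

/-- Vanishing of `Ext^i(A/m, M)` for `i < d`, i.e. the depth of `M` is at least `d`. -/
def HasDepth (A : Type u) [CommRing A] [IsLocalRing A] (M : Type u) [AddCommGroup M] [Module A M]
    (d : ℕ) : Prop :=
  ∀ i < d, Subsingleton
    (Ext (ModuleCat.of A (A ⧸ maximalIdeal A)) (ModuleCat.of A M) i)

lemma HasDepth.quotSMulTop [IsLocalRing A] {M : Type u} [AddCommGroup M] [Module A M] {d : ℕ}
    (h : HasDepth A M (d + 1)) {y : A} (hy : IsSMulRegular M y) :
    HasDepth A (QuotSMulTop y M) d := by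
  intro i hi
  have zero1 := AddCommGrpCat.isZero_of_iff_subsingleton.mpr (h i (by omega))
  have zero2 := AddCommGrpCat.isZero_of_iff_subsingleton.mpr (h (i + 1) (by omega))
  have hy' : IsSMulRegular (ModuleCat.of A M) y := hy
  exact AddCommGrpCat.subsingleton_of_isZero <| ShortComplex.Exact.isZero_of_both_zeros
    ((Ext.covariant_sequence_exact₃' (ModuleCat.of A (A ⧸ maximalIdeal A))
      hy'.smulShortComplex_shortExact) i (i + 1) rfl)
    (zero1.eq_zero_of_src _) (zero2.eq_zero_of_tgt _)

lemma HasDepth.exists_regular [IsLocalRing A] [IsNoetherianRing A] {M : Type u} [AddCommGroup M]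
    [Module A M] [Module.Finite A M] [Nontrivial M] {d : ℕ} (h : HasDepth A M (d + 1)) :
    ∃ y ∈ maximalIdeal A, IsSMulRegular M y := by
  have hlt : maximalIdeal A • (⊤ : Submodule A M) < ⊤ := by
    refine lt_top_iff_ne_top.mpr fun e => ?_
    have := Submodule.eq_bot_of_le_smul_of_le_jacobson_bot (maximalIdeal A) (⊤ : Submodule A M)
      Module.Finite.fg_top e.ge (IsLocalRing.maximalIdeal_le_jacobson _)
    exact bot_ne_top this.symm
  obtain ⟨rs, hlen, hmem, hreg⟩ := ModuleCat.exists_isRegular_of_exists_subsingleton_ext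
    (maximalIdeal A) 1 (ModuleCat.of A M) hlt (ModuleCat.of A (A ⧸ maximalIdeal A))
    (by rw [Module.support_eq_zeroLocus, Ideal.annihilator_quotient])
    (fun i hi => h i (by omega))
  obtain ⟨y, rfl⟩ := List.length_eq_one_iff.mp hlen
  exact ⟨y, hmem y (by simp), ((isRegular_cons_iff _ _ _).mp hreg).1⟩

lemma ringKrullDim_quotient_succ_le {p q : Ideal A} [p.IsPrime] (hpq : p ≤ q) {y : A} (hy : y ∈ q)
    (hyp : y ∉ p) : ringKrullDim (A ⧸ q) + 1 ≤ ringKrullDim (A ⧸ p) := by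
  have h1 := ringKrullDim_quotient_succ_le_of_nonZeroDivisor (R := A ⧸ p)
    (r := Ideal.Quotient.mk p y) (mem_nonZeroDivisors_of_ne_zero
      (by rwa [Ne, Ideal.Quotient.eq_zero_iff_mem]))
  refine le_trans (add_le_add_left ?_ 1) h1
  let f : (A ⧸ p) ⧸ Ideal.span {Ideal.Quotient.mk p y} →+* A ⧸ q :=
    Ideal.Quotient.lift _ (Ideal.Quotient.factor hpq) (by
      intro a ha
      have : Ideal.span {Ideal.Quotient.mk p y} ≤ RingHom.ker (Ideal.Quotient.factor hpq) := by
        rw [Ideal.span_singleton_le_iff_mem, RingHom.mem_ker, Ideal.Quotient.factor_mk,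
          Ideal.Quotient.eq_zero_iff_mem]
        exact hy
      exact this ha)
  refine ringKrullDim_le_of_surjective f ?_
  refine Ideal.Quotient.lift_surjective_of_surjective _ _ (Ideal.Quotient.factor_surjective hpq)

/-- Ischebeck's bound: every associated prime has dimension at least the depth. -/
lemma HasDepth.le_ringKrullDim_quotient [IsLocalRing A] [IsNoetherianRing A] {d : ℕ} :
    ∀ {M : Type u} [AddCommGroup M] [Module A M] [Module.Finite A M], HasDepth A M d →
    ∀ {p : Ideal A}, p ∈ associatedPrimes A M → (d : WithBot ℕ∞) ≤ ringKrullDim (A ⧸ p) := by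
  induction d with
  | zero =>
    intro M _ _ _ _ p hp
    have := hp.isPrime
    simpa using ringKrullDim_nonneg_of_nontrivial
  | succ d ih =>
    intro M _ _ _ hM p hp
    have hpp : p.IsPrime := hp.isPrime
    obtain ⟨_, x, hx⟩ := isAssociatedPrime_iff.mp hp
    have hnt : Nontrivial M := by
      by_contra hn
      have := not_nontrivial_iff_subsingleton.mp hn
      exact not_isAssociatedPrime_of_subsingleton hp
    obtain ⟨y, hym, hy⟩ := hM.exists_regular
    have hyp : y ∉ p := by
      intro hyp
      have h := biUnion_associatedPrimes_eq_compl_regular A M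
      have : y ∈ ({r : A | IsSMulRegular M r}ᶜ : Set A) := by
        rw [← h]; exact Set.mem_biUnion hp hyp
      exact this hy
    let N : Submodule A M := Submodule.torsionBySet A M p
    have hN : ¬ N ≤ y • (⊤ : Submodule A M) := by
      intro hle
      have h2 : N ≤ maximalIdeal A • N := by
        intro z hz
        obtain ⟨w, -, rfl⟩ := hle hz
        refine Submodule.smul_mem_smul hym ?_
        rw [Submodule.mem_torsionBySet_iff] at hz ⊢
        intro a
        refine hy ?_
        have := hz a
        simp only [smul_zero]
        rw [smul_comm]
        exact this
      have h3 := Submodule.eq_bot_of_le_smul_of_le_jacobson_bot (maximalIdeal A) N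
        (IsNoetherian.noetherian N) h2 (IsLocalRing.maximalIdeal_le_jacobson _)
      have h4 : x ∈ N := by
        rw [Submodule.mem_torsionBySet_iff]
        rintro ⟨a, ha⟩
        have ha' : a ∈ p := ha
        rw [hx, Submodule.mem_colon_singleton] at ha'
        simpa using ha'
      rw [h3, Submodule.mem_bot] at h4
      subst h4
      apply hpp.ne_top
      rw [hx]
      ext; simp [Submodule.mem_colon_singleton]
    obtain ⟨z, hzN, hz⟩ := SetLike.not_le_iff_exists.mp hN
    have hz0 : (Submodule.Quotient.mk z : QuotSMulTop y M) ≠ 0 := by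
      rwa [Ne, Submodule.Quotient.mk_eq_zero]
    obtain ⟨q, hq, hle⟩ := exists_le_isAssociatedPrime_of_isNoetherianRing A _ hz0
    have hpq : p ≤ q := by
      intro a ha
      apply hle
      rw [Submodule.mem_colon_singleton, ← Submodule.Quotient.mk_smul]
      have : a • z = 0 := (Submodule.mem_torsionBySet_iff _ _).mp hzN ⟨a, ha⟩
      simp [this]
    have hyq : y ∈ q := by
      apply hle
      rw [Submodule.mem_colon_singleton, ← Submodule.Quotient.mk_smul, Submodule.mem_bot,
        Submodule.Quotient.mk_eq_zero]
      exact Submodule.smul_mem_pointwise_smul _ _ _ trivial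
    have h5 := ih (hM.quotSMulTop hy) hq
    have h6 := ringKrullDim_quotient_succ_le hpq hyq hyp
    refine le_trans ?_ h6
    push_cast
    exact add_le_add_left h5 1

lemma exists_prime_ringKrullDim_quotient_eq {I : Ideal A} (d : ℕ)
    (hd : (d : WithBot ℕ∞) ≤ ringKrullDim (A ⧸ I)) :
    ∃ q : Ideal A, q.IsPrime ∧ I ≤ q ∧ (d : WithBot ℕ∞) ≤ ringKrullDim (A ⧸ q) := by
  rw [ringKrullDim_quotient] at hd
  obtain ⟨l, hl⟩ := Order.le_krullDim_iff.mp hd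
  refine ⟨l.head.1.asIdeal, l.head.1.isPrime, l.head.2, ?_⟩
  rw [ringKrullDim_quotient]
  refine Order.le_krullDim_iff.mpr ⟨⟨l.length, fun i => ⟨(l i).1, ?_⟩, fun i => l.step i⟩, hl⟩
  exact (LTSeries.head_le l i : l.head ≤ l i)

lemma exists_prime_le_ringKrullDim_quotient [IsLocalRing A] [IsNoetherianRing A] (zs : List A) :
    ∀ (p : Ideal A) [p.IsPrime] (_ : ∀ z ∈ zs, z ∈ maximalIdeal A) (d : ℕ)
      (_ : ((d + zs.length : ℕ) : WithBot ℕ∞) ≤ ringKrullDim (A ⧸ p)),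
    ∃ q : Ideal A, q.IsPrime ∧ p ≤ q ∧ (∀ z ∈ zs, z ∈ q) ∧
      (d : WithBot ℕ∞) ≤ ringKrullDim (A ⧸ q) := by
  induction zs with
  | nil => intro p hp _ d hd; exact ⟨p, hp, le_rfl, by simp, by simpa using hd⟩
  | cons z zs ih =>
    intro p hp hzs d hd
    have hz : z ∈ maximalIdeal A := hzs z (by simp)
    have hpm := le_maximalIdeal hp.ne_top
    have hne : p ⊔ Ideal.span {z} ≠ ⊤ := by
      refine ne_top_of_le_ne_top (maximalIdeal.isMaximal A).ne_top (sup_le hpm ?_)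
      simpa [Ideal.span_singleton_le_iff_mem] using hz
    have h1 : ringKrullDim (A ⧸ p) ≤ ringKrullDim (A ⧸ (p ⊔ Ideal.span {z})) + 1 := by
      have := ringKrullDim_le_ringKrullDim_quotient_add_card (R := A ⧸ p)
        {Ideal.Quotient.mk p z} (by
          rw [Finset.coe_singleton, Set.singleton_subset_iff, SetLike.mem_coe]
          have : Nontrivial (A ⧸ p) := Ideal.Quotient.nontrivial_iff.mpr hp.ne_top
          have : IsLocalRing (A ⧸ p) :=
            IsLocalRing.of_surjective' _ Ideal.Quotient.mk_surjective
          rw [IsLocalRing.ringJacobson_eq_maximalIdeal]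
          rw [mem_maximalIdeal, mem_nonunits_iff] at hz ⊢
          intro hu
          have : IsLocalHom (Ideal.Quotient.mk p) :=
            .of_surjective _ Ideal.Quotient.mk_surjective
          exact hz (isUnit_of_map_unit (Ideal.Quotient.mk p) z hu))
      refine this.trans ?_
      rw [Finset.card_singleton, Nat.cast_one]
      refine add_le_add_left ?_ 1
      refine (ringKrullDim_eq_of_ringEquiv ?_).le
      refine (Ideal.quotEquivOfEq ?_).trans (DoubleQuot.quotQuotEquivQuotSup p (Ideal.span {z}))
      rw [Ideal.map_span]; simp
    have h2 : ((d + zs.length : ℕ) : WithBot ℕ∞) ≤ ringKrullDim (A ⧸ (p ⊔ Ideal.span {z})) := by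
      have := hd.trans h1
      rw [List.length_cons, ← add_assoc, Nat.cast_succ] at this
      exact ENat.WithBot.add_le_add_one_right_iff.mp this
    obtain ⟨q, hq, hle, hdq⟩ := exists_prime_ringKrullDim_quotient_eq _ h2
    obtain ⟨q', hq', hle', hmem, hd'⟩ := ih q (fun w hw => hzs w (by simp [hw])) d hdq
    refine ⟨q', hq', (le_sup_left.trans hle).trans hle', ?_, hd'⟩
    intro w hw
    rcases List.mem_cons.mp hw with rfl | hw
    · exact hle' (hle (Ideal.mem_sup_right (Ideal.mem_span_singleton_self _)))
    · exact hmem w hw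

/-- Unmixedness: a sequence cutting down the dimension of a module of maximal depth is regular,
and the associated primes of the quotient have the expected dimension. -/
lemma HasDepth.isWeaklyRegular [IsLocalRing A] [IsNoetherianRing A] (ys : List A) :
    ∀ (d : ℕ) {M : Type u} [AddCommGroup M] [Module A M] [Module.Finite A M], HasDepth A M d →
    (∀ y ∈ ys, y ∈ maximalIdeal A) →
    (∀ p : PrimeSpectrum A, p ∈ Module.support A M → (∀ y ∈ ys, y ∈ p.asIdeal) →
      ringKrullDim (A ⧸ p.asIdeal) + ys.length ≤ d) →
    IsWeaklyRegular M ys ∧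
    ∀ p ∈ associatedPrimes A (M ⧸ (Ideal.ofList ys • ⊤ : Submodule A M)),
      (d : WithBot ℕ∞) ≤ ringKrullDim (A ⧸ p) + ys.length := by
  induction ys with
  | nil =>
    intro d M _ _ _ hM _ _
    refine ⟨.nil A M, fun p hp => ?_⟩
    have e : (M ⧸ (Ideal.ofList ([] : List A) • ⊤ : Submodule A M)) ≃ₗ[A] M :=
      (Submodule.quotEquivOfEqBot _ (by simp))
    rw [LinearEquiv.AssociatedPrimes.eq e] at hp
    simpa using hM.le_ringKrullDim_quotient hp
  | cons y ys ih =>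
    intro d M _ _ _ hM hmem hdim
    have hreg : IsSMulRegular M y := by
      by_contra hn
      have h : y ∈ ({r : A | IsSMulRegular M r}ᶜ : Set A) := hn
      rw [← biUnion_associatedPrimes_eq_compl_regular A M] at h
      obtain ⟨p, hp, hyp⟩ := Set.mem_iUnion₂.mp h
      have hpp : p.IsPrime := hp.isPrime
      have hd := hM.le_ringKrullDim_quotient hp
      have hsupp : (⟨p, hpp⟩ : PrimeSpectrum A) ∈ Module.support A M := by
        rw [Module.mem_support_iff_of_finite]
        simpa only [Submodule.annihilator_top] using hp.annihilator_le
      have hlt : ys.length + 1 ≤ d := by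
        have h1 := hdim (closedPoint A) ?_ hmem
        · have h2 : (0 : WithBot ℕ∞) ≤ ringKrullDim (A ⧸ (closedPoint A).asIdeal) := 
            ringKrullDim_nonneg_of_nontrivial
          have h3 := (add_le_add_left h2 ((y :: ys).length : WithBot ℕ∞)).trans h1
          rw [zero_add] at h3
          simpa using Nat.cast_le.mp h3
        · exact Module.mem_support_mono (le_maximalIdeal hpp.ne_top) hsupp
      obtain ⟨q, hq, hpq, hysq, hdq⟩ := exists_prime_le_ringKrullDim_quotient ys p
        (fun z hz => hmem z (by simp [hz])) (d - ys.length)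
        (by rwa [Nat.sub_add_cancel (by omega)])
      have h1 := hdim ⟨q, hq⟩ (Module.mem_support_mono (p := ⟨p, hpp⟩) hpq hsupp) (by
        intro z hz
        rcases List.mem_cons.mp hz with rfl | hz
        · exact hpq hyp
        · exact hysq z hz)
      have h2 := (add_le_add_left hdq ((y :: ys).length : WithBot ℕ∞)).trans h1
      rw [← Nat.cast_add] at h2
      have h3 := Nat.cast_le.mp h2
      simp only [List.length_cons] at h3
      omega
    have hd' : HasDepth A (QuotSMulTop y M) (d - 1) := by
      cases d with
      | zero => intro i hi; omega
      | succ d => exact hM.quotSMulTop hreg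
    have h1 := ih (d - 1) hd' (fun z hz => hmem z (by simp [hz])) (by
      intro p hp hys
      rw [Module.support_quotSMulTop] at hp
      have h1 := hdim p hp.1 (by
        intro z hz
        rcases List.mem_cons.mp hz with rfl | hz
        · simpa using hp.2
        · exact hys z hz)
      have hd1 : 1 ≤ d := by
        have h2 : (0 : WithBot ℕ∞) ≤ ringKrullDim (A ⧸ p.asIdeal) := 
          ringKrullDim_nonneg_of_nontrivial
        have h3 := (add_le_add_left h2 ((y :: ys).length : WithBot ℕ∞)).trans h1
        rw [zero_add] at h3
        have := Nat.cast_le.mp h3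
        simp at this
        omega
      obtain ⟨d, rfl⟩ := Nat.exists_eq_add_of_le' hd1
      rw [List.length_cons, Nat.cast_add, Nat.cast_add, ← add_assoc] at h1
      exact ENat.WithBot.add_le_add_one_right_iff.mp h1)
    refine ⟨(isWeaklyRegular_cons_iff _ _ _).mpr ⟨hreg, h1.1⟩, fun p hp => ?_⟩
    rw [LinearEquiv.AssociatedPrimes.eq
      (Submodule.quotOfListConsSMulTopEquivQuotSMulTopInner M y ys)] at hp
    have h2 := h1.2 p hp
    refine le_trans ?_ ((add_le_add_left h2 1).trans ?_)
    · rw [← Nat.cast_succ]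
      exact Nat.cast_le.mpr (by omega)
    · rw [add_assoc, List.length_cons, Nat.cast_succ]

end CohenMacaulay

section CohenMacaulay

universe u

open IsLocalRing RingTheory.Sequence CategoryTheory Abelian Pointwise

variable {A : Type u} [CommRing A]

lemma height_add_ringKrullDim_quotient_le (p : Ideal A) [hp : p.IsPrime] :
    (p.height : WithBot ℕ∞) + ringKrullDim (A ⧸ p) ≤ ringKrullDim A := by
  have : Nonempty (PrimeSpectrum A) := ⟨⟨p, hp⟩⟩
  have h1 : ringKrullDim (A ⧸ p) ≤ (Order.coheight (⟨p, hp⟩ : PrimeSpectrum A) : WithBot ℕ∞) := by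
    rw [ringKrullDim_quotient, Order.krullDim]
    refine iSup_le fun l => ?_
    have : (l.length : ℕ∞) ≤ Order.coheight (⟨p, hp⟩ : PrimeSpectrum A) :=
      Order.length_le_coheight (p := ⟨l.length, fun i => (l i).1, fun i => l.step i⟩) l.head.2
    exact_mod_cast this
  rw [show p.height = Order.height (⟨p, hp⟩ : PrimeSpectrum A) from
    PrimeSpectrum.height_eq_orderHeight ⟨p, hp⟩]
  refine (add_le_add_right h1 _).trans ?_
  rw [ringKrullDim, Order.krullDim_eq_iSup_height_add_coheight_of_nonempty, ← WithBot.coe_add]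
  exact WithBot.coe_le_coe.mpr (le_iSup (fun a : PrimeSpectrum A =>
    Order.height a + Order.coheight a) _)

/-- Unmixedness in a local ring whose depth is at least its dimension. -/
theorem HasDepth.isWeaklyRegular_of_height [IsLocalRing A] [IsNoetherianRing A] {d : ℕ}
    (hA : HasDepth A A d) (hd : ringKrullDim A ≤ d) (ys : List A)
    (hmem : ∀ y ∈ ys, y ∈ maximalIdeal A)
    (hht : ∀ p : Ideal A, p.IsPrime → Ideal.ofList ys ≤ p → (ys.length : ℕ∞) ≤ p.height) :
    IsWeaklyRegular A ys ∧
    ∀ p ∈ associatedPrimes A (A ⧸ Ideal.ofList ys), p.height ≤ ys.length := by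
  obtain ⟨h1, h2⟩ := HasDepth.isWeaklyRegular ys d hA hmem (by
    intro p _ hp
    have h1 := hht p.asIdeal p.2 (by
      rw [Ideal.ofList, Ideal.span_le]; exact hp)
    have h2 := (height_add_ringKrullDim_quotient_le p.asIdeal).trans hd
    refine le_trans ?_ h2
    rw [add_comm]
    exact add_le_add_left (by exact_mod_cast h1) _)
  refine ⟨h1, fun p hp => ?_⟩
  have hpp : p.IsPrime := hp.isPrime
  have e : (A ⧸ (Ideal.ofList ys • ⊤ : Submodule A A)) ≃ₗ[A] (A ⧸ Ideal.ofList ys) :=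
    Submodule.quotEquivOfEq _ _ (by simp)
  rw [← LinearEquiv.AssociatedPrimes.eq e] at hp
  have h3 := h2 p hp
  have h4 := (height_add_ringKrullDim_quotient_le p).trans hd
  obtain ⟨b, hb⟩ : ∃ b : ℕ, ringKrullDim (A ⧸ p) = b := by
    have h0 : (0 : WithBot ℕ∞) ≤ ringKrullDim (A ⧸ p) := ringKrullDim_nonneg_of_nontrivial
    have h1 : ringKrullDim (A ⧸ p) ≤ d := (ringKrullDim_quotient_le p).trans hd
    have hbot : ringKrullDim (A ⧸ p) ≠ ⊥ := fun h => by rw [h] at h0; simp at h0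
    obtain ⟨c, hc⟩ := WithBot.ne_bot_iff_exists.mp hbot
    rw [← hc] at h1 ⊢
    have : c ≤ d := by exact_mod_cast h1
    obtain ⟨b, rfl⟩ := ENat.ne_top_iff_exists.mp (ne_top_of_le_ne_top (ENat.natCast_ne_top d) this)
    exact ⟨b, rfl⟩
  rw [hb] at h3 h4
  have h5 : (p.height + b : WithBot ℕ∞) ≤ (b + ys.length : WithBot ℕ∞) := h4.trans h3
  rw [add_comm (b : WithBot ℕ∞)] at h5
  have h6 := (ENat.WithBot.add_le_add_natCast_right_iff).mp h5
  exact_mod_cast h6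

lemma isWeaklyRegular_X {k σ : Type*} [Field k] (l : List σ) (hl : l.Nodup) :
    IsWeaklyRegular (MvPolynomial σ k) (l.map fun i => (MvPolynomial.X i : MvPolynomial σ k)) := by
  induction l using List.reverseRecOn with
  | nil => exact .nil _ _
  | append_singleton l v ih =>
    rw [List.map_append, isWeaklyRegular_append_iff]
    have hv : v ∉ l := by
      rw [List.nodup_append] at hl
      intro h
      exact hl.2.2 v h v (by simp) rfl
    refine ⟨ih (List.Nodup.of_append_left hl), ?_⟩
    rw [List.map_singleton, isWeaklyRegular_singleton_iff]
    rw [isSMulRegular_iff_right_eq_zero_of_smul]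
    intro f hf
    obtain ⟨f, rfl⟩ := Submodule.Quotient.mk_surjective _ f
    rw [← Submodule.Quotient.mk_smul, Submodule.Quotient.mk_eq_zero] at hf
    rw [Submodule.Quotient.mk_eq_zero]
    have e : (Ideal.ofList (l.map fun i => (MvPolynomial.X i : MvPolynomial σ k)) • ⊤ : Submodule _ (MvPolynomial σ k))
        = Ideal.span (MvPolynomial.X '' {i | i ∈ l}) := by
      rw [smul_eq_mul, Ideal.mul_top, Ideal.ofList]
      congr 1
      ext; simp
    rw [e, MvPolynomial.mem_ideal_span_X_image] at hf ⊢
    intro m hm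
    obtain ⟨i, hi, hi'⟩ := hf (m + Finsupp.single v 1) (by
      rw [smul_eq_mul, mul_comm, MvPolynomial.mem_support_iff, MvPolynomial.coeff_mul_X]
      exact MvPolynomial.mem_support_iff.mp hm)
    refine ⟨i, hi, ?_⟩
    have : v ≠ i := fun h => hv (h ▸ hi)
    simpa [Finsupp.single_apply, this] using hi'

lemma hasDepth_localization {σ k : Type} [Fintype σ] [Field k] (p : Ideal (MvPolynomial σ k))
    [p.IsPrime] (hp : ∀ i, MvPolynomial.X i ∈ p) :
    HasDepth (Localization.AtPrime p) (Localization.AtPrime p) (Fintype.card σ) := by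
  have h := (isWeaklyRegular_X (k := k) (Finset.univ : Finset σ).toList
    (Finset.nodup_toList _)).isRegular_of_isLocalization_of_mem (Localization.AtPrime p) p (by
      intro r hr
      obtain ⟨i, -, rfl⟩ := List.mem_map.mp hr
      exact hp i)
  have hn : IsNoetherianRing (Localization.AtPrime p) :=
    IsLocalization.isNoetherianRing p.primeCompl _ inferInstance
  have h2 := ModuleCat.subsingleton_ext_of_exists_isRegular
    (maximalIdeal (Localization.AtPrime p))
    (ModuleCat.of (Localization.AtPrime p)
      (Localization.AtPrime p ⧸ maximalIdeal (Localization.AtPrime p)))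
    (by rw [Module.support_eq_zeroLocus, Ideal.annihilator_quotient])
    (ModuleCat.of (Localization.AtPrime p) (Localization.AtPrime p))
    (by
      rw [smul_eq_mul, Ideal.mul_top]
      exact lt_top_iff_ne_top.mpr (maximalIdeal.isMaximal _).ne_top)
    _ (by
      intro r hr
      obtain ⟨s, hs, rfl⟩ := List.mem_map.mp hr
      obtain ⟨i, -, rfl⟩ := List.mem_map.mp hs
      rw [← Localization.AtPrime.map_eq_maximalIdeal]
      exact Ideal.mem_map_of_mem _ (hp i)) h
  intro i hi
  exact h2 i (by simpa using hi)

lemma ringKrullDim_localization_le {σ k : Type} [Fintype σ] [Field k]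
    (p : Ideal (MvPolynomial σ k)) [p.IsPrime] :
    ringKrullDim (Localization.AtPrime p) ≤ (Fintype.card σ : WithBot ℕ∞) := by
  rw [IsLocalization.AtPrime.ringKrullDim_eq_height p]
  refine Ideal.height_le_ringKrullDim_of_isPrime.trans ?_
  rw [MvPolynomial.ringKrullDim_of_isNoetherianRing, ringKrullDim_eq_zero_of_field, zero_add,
    Nat.card_eq_fintype_card]

end CohenMacaulay

section Triangular

open Matrix

variable {K : Type*} [Field K] {n : ℕ}

/-- Lower triangular matrices. -/
def IsLower (N : Matrix (Fin n) (Fin n) K) : Prop := ∀ i j, i < j → N i j = 0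

lemma IsLower.mul {A B : Matrix (Fin n) (Fin n) K} (hA : IsLower A) (hB : IsLower B) :
    IsLower (A * B) := by
  intro i j hij
  rw [Matrix.mul_apply]
  refine Finset.sum_eq_zero fun k _ => ?_
  rcases lt_or_ge i k with h | h
  · rw [hA i k h, zero_mul]
  · rw [hB k j (h.trans_lt hij), mul_zero]

lemma IsLower.mul_diag {A B : Matrix (Fin n) (Fin n) K} (hA : IsLower A) (hB : IsLower B)
    (i : Fin n) : (A * B) i i = A i i * B i i := by
  rw [Matrix.mul_apply]
  refine Finset.sum_eq_single i (fun k _ hk => ?_) (by simp)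
  rcases lt_or_gt_of_ne hk with h | h
  · rw [hB k i h, mul_zero]
  · rw [hA i k h, zero_mul]

/-- At most one nonzero entry in each row and each column. -/
def IsPartialMonomial (M : Matrix (Fin n) (Fin n) K) : Prop :=
  ∀ a b, M a b ≠ 0 → (∀ b', b' ≠ b → M a b' = 0) ∧ (∀ a', a' ≠ a → M a' b = 0)

private lemma exists_elimination_step {i : ℕ} (hi : i < n) (M : Matrix (Fin n) (Fin n) K)
    (hM : ∀ a b, a.1 < i → M a b ≠ 0 →
      (∀ b', b' ≠ b → M a b' = 0) ∧ (∀ a', a' ≠ a → M a' b = 0)) :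
    ∃ (r c : Matrix (Fin n) (Fin n) K) (M' : Matrix (Fin n) (Fin n) K),
      r * r = 0 ∧ c * c = 0 ∧ IsLower r ∧ IsLower cᵀ ∧ M' = (1 - r) * M * (1 - c) ∧
      ∀ a b, a.1 < i + 1 → M' a b ≠ 0 →
      (∀ b', b' ≠ b → M' a b' = 0) ∧ (∀ a', a' ≠ a → M' a' b = 0) := by
  classical
  by_cases hz : ∀ b, M ⟨i, hi⟩ b = 0
  · refine ⟨0, 0, M, by simp, by simp, fun _ _ _ => rfl, fun _ _ _ => rfl, by simp, ?_⟩
    intro a b ha hab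
    rcases Nat.lt_succ_iff_lt_or_eq.mp ha with h | h
    · exact hM a b h hab
    · have : a = ⟨i, hi⟩ := Fin.ext h
      subst this
      exact absurd (hz b) hab
  · push Not at hz
    obtain ⟨j, hj, hmin⟩ : ∃ j, M ⟨i, hi⟩ j ≠ 0 ∧ ∀ b, b < j → M ⟨i, hi⟩ b = 0 := by
      obtain ⟨j, hj, hmin⟩ := WellFounded.has_min (wellFounded_lt (α := Fin n))
        {b | M ⟨i, hi⟩ b ≠ 0} hz
      exact ⟨j, hj, fun b hb => by_contra fun h => hmin b h hb⟩
    set I : Fin n := ⟨i, hi⟩ with hI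
    let rv : Fin n → K := fun a => if I < a then M a j / M I j else 0
    let cv : Fin n → K := fun b => if j < b then M I b / M I j else 0
    have hrI : ∀ a, ¬ I < a → rv a = 0 := fun a h => if_neg h
    have hcj : ∀ b, ¬ j < b → cv b = 0 := fun b h => if_neg h
    let r : Matrix (Fin n) (Fin n) K := vecMulVec rv (Pi.single I 1)
    let c : Matrix (Fin n) (Fin n) K := vecMulVec (Pi.single j 1) cv
    have hM' : ∀ a b, ((1 - r) * M * (1 - c)) a b =
        (M a b - M a j * cv b) - rv a * (M I b - M I j * cv b) := by
      intro a b
      have h1 : ∀ b, (r * M) a b = rv a * M I b := by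
        intro b
        simp [r, Matrix.mul_apply, vecMulVec_apply, Pi.single_apply]
      have h2 : ∀ N : Matrix (Fin n) (Fin n) K, (N * c) a b = N a j * cv b := by
        intro N
        simp [c, Matrix.mul_apply, vecMulVec_apply, Pi.single_apply]
      rw [Matrix.mul_sub, Matrix.mul_one, Matrix.sub_apply, h2, Matrix.sub_mul, Matrix.one_mul,
        Matrix.sub_apply, Matrix.sub_apply, h1, h1]
      ring
    have hcol : ∀ a, a < I → M a j = 0 := by
      intro a ha
      by_contra h
      exact hj ((hM a j ha h).2 I ha.ne')
    have hup : ∀ a b, a < I → ((1 - r) * M * (1 - c)) a b = M a b := by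
      intro a b ha
      rw [hM', hcol a ha, hrI a ha.asymm]; ring
    have hrow : ∀ b, M I b - M I j * cv b = if b = j then M I j else 0 := by
      intro b
      rcases lt_trichotomy b j with h | h | h
      · rw [hmin b h, hcj b h.asymm, if_neg h.ne]; ring
      · subst h; rw [hcj b (lt_irrefl _), if_pos rfl]; ring
      · rw [if_neg h.ne']
        simp only [cv, if_pos h]
        field_simp; ring
    have hIrow : ∀ b, ((1 - r) * M * (1 - c)) I b = if b = j then M I j else 0 := by
      intro b
      rw [hM', hrI I (lt_irrefl _), hrow]; ring
    refine ⟨r, c, _, ?_, ?_, ?_, ?_, rfl, ?_⟩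
    · ext a b
      simp [r, Matrix.mul_apply, vecMulVec_apply, Pi.single_apply, hrI I (lt_irrefl _)]
    · ext a b
      simp [c, Matrix.mul_apply, vecMulVec_apply, Pi.single_apply, hcj j (lt_irrefl _)]
    · intro a b hab
      simp only [r, vecMulVec_apply, Pi.single_apply]
      split_ifs with h
      · subst h
        rw [hrI a hab.asymm, zero_mul]
      · simp
    · intro b a hab
      simp only [c, vecMulVec_apply, Pi.single_apply, Matrix.transpose_apply]
      split_ifs with h
      · subst h
        rw [hcj b hab.asymm, mul_zero]
      · simp
    · intro a b ha hab
      rcases Nat.lt_succ_iff_lt_or_eq.mp ha with h | h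
      · have haI : a < I := h
        rw [hup a b haI] at hab
        obtain ⟨h1, h2⟩ := hM a b h hab
        have hIb : M I b = 0 := h2 I haI.ne'
        have hbj : b ≠ j := by rintro rfl; exact hj hIb
        have hcb : cv b = 0 := by simp [cv, hIb]
        refine ⟨fun b' hb' => by rw [hup a b' haI, h1 b' hb'], fun a' ha' => ?_⟩
        rw [hM', h2 a' ha', hcb, hIb]; ring
      · have haI : a = I := Fin.ext h
        subst haI
        rw [hIrow] at hab
        have hbj : b = j := by by_contra h; exact hab (if_neg h)
        subst hbj
        refine ⟨fun b' hb' => by rw [hIrow, if_neg hb'], fun a' ha' => ?_⟩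
        rcases lt_or_gt_of_ne ha' with h1 | h1
        · rw [hup a' b h1, hcol a' h1]
        · rw [hM', hcj b (lt_irrefl _)]
          simp only [rv, if_pos h1]
          field_simp; ring

/-- Every square matrix is the product of an invertible lower triangular matrix, a partial
monomial matrix and an invertible upper triangular matrix. -/
theorem exists_lower_monomial_upper (X : Matrix (Fin n) (Fin n) K) :
    ∃ u w M u' w' : Matrix (Fin n) (Fin n) K, X = u * M * u' ∧ IsPartialMonomial M ∧
      IsLower u ∧ IsLower w ∧ IsLower u'ᵀ ∧ IsLower w'ᵀ ∧ u * w = 1 ∧ w * u = 1 ∧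
      u' * w' = 1 ∧ w' * u' = 1 := by
  have key : ∀ i ≤ n, ∃ u w M u' w' : Matrix (Fin n) (Fin n) K, X = u * M * u' ∧
      (∀ a b, a.1 < i → M a b ≠ 0 →
      (∀ b', b' ≠ b → M a b' = 0) ∧ (∀ a', a' ≠ a → M a' b = 0)) ∧
      IsLower u ∧ IsLower w ∧ IsLower u'ᵀ ∧ IsLower w'ᵀ ∧ u * w = 1 ∧ w * u = 1 ∧
      u' * w' = 1 ∧ w' * u' = 1 := by
    have h1 : IsLower (1 : Matrix (Fin n) (Fin n) K) := fun i j h => Matrix.one_apply_ne h.ne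
    have hadd : ∀ {A : Matrix (Fin n) (Fin n) K}, IsLower A → IsLower (1 + A) := by
      intro A hA i j h
      rw [Matrix.add_apply, h1 i j h, hA i j h, add_zero]
    have hsub : ∀ {A : Matrix (Fin n) (Fin n) K}, IsLower A → IsLower (1 - A) := by
      intro A hA i j h
      rw [Matrix.sub_apply, h1 i j h, hA i j h, sub_zero]
    intro i
    induction i with
    | zero =>
      intro _
      exact ⟨1, 1, X, 1, 1, by simp, fun a b h => absurd h (Nat.not_lt_zero _), h1, h1,
        by simpa using h1, by simpa using h1, by simp, by simp, by simp, by simp⟩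
    | succ i ih =>
      intro hi
      obtain ⟨u, w, M, u', w', hX, hM, hu, hw, hu', hw', h3, h4, h5, h6⟩ := ih (by omega)
      obtain ⟨r, c, M', hr, hc, hrl, hcl, hM', hgood⟩ := exists_elimination_step hi M hM
      have er : (1 + r) * (1 - r) = 1 := by
        rw [add_mul, one_mul, mul_sub, mul_one, hr]; abel
      have er' : (1 - r) * (1 + r) = 1 := by
        rw [sub_mul, one_mul, mul_add, mul_one, hr]; abel
      have ec : (1 + c) * (1 - c) = 1 := by
        rw [add_mul, one_mul, mul_sub, mul_one, hc]; abel
      have ec' : (1 - c) * (1 + c) = 1 := by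
        rw [sub_mul, one_mul, mul_add, mul_one, hc]; abel
      refine ⟨u * (1 + r), (1 - r) * w, M', (1 + c) * u', w' * (1 - c), ?_, hgood,
        hu.mul (hadd hrl), (hsub hrl).mul hw, ?_, ?_, ?_, ?_, ?_, ?_⟩
      · rw [hM', hX]
        calc u * M * u' = u * ((1 + r) * (1 - r)) * M * ((1 - c) * (1 + c)) * u' := by
              rw [er, ec', mul_one, mul_one]
          _ = _ := by simp only [mul_assoc]
      · rw [Matrix.transpose_mul, Matrix.transpose_add, Matrix.transpose_one]
        exact hu'.mul (hadd hcl)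
      · rw [Matrix.transpose_mul, Matrix.transpose_sub, Matrix.transpose_one]
        exact (hsub hcl).mul hw'
      · rw [mul_assoc, ← mul_assoc (1 + r), er, one_mul, h3]
      · rw [mul_assoc, ← mul_assoc w, h4, one_mul, er']
      · rw [mul_assoc, ← mul_assoc u', h5, one_mul, ec]
      · rw [mul_assoc, ← mul_assoc (1 - c), ec', one_mul, h6]
  obtain ⟨u, w, M, u', w', hX, hM, h⟩ := key n le_rfl
  exact ⟨u, w, M, u', w', hX, fun a b => hM a b a.2, h⟩

end Triangular

section Tangent

open Matrix Module

variable {K : Type*} [Field K] {n : ℕ}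

lemma Derivation.map_matrix_mul (D : Derivation ℤ K K) (A B : Matrix (Fin n) (Fin n) K) :
    (A * B).map D = A.map D * B + A * B.map D := by
  ext i j
  simp only [Matrix.map_apply, Matrix.mul_apply, Matrix.add_apply, map_sum, Derivation.leibniz,
    smul_eq_mul, Finset.sum_add_distrib]
  rw [add_comm]
  congr 1
  exact Finset.sum_congr rfl fun k _ => mul_comm _ _

/-- The space of values `(D X, D Y)` of derivations `D` on a pair of matrices. -/
def derivationValues (X Y : Matrix (Fin n) (Fin n) K) :
    Submodule K (Matrix (Fin n) (Fin n) K × Matrix (Fin n) (Fin n) K) :=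
  LinearMap.range (R := K) (R₂ := K) (τ₁₂ := RingHom.id K)
    { toFun := fun D : Derivation ℤ K K => (X.map D, Y.map D)
      map_add' := fun _ _ => rfl
      map_smul' := fun _ _ => rfl }

lemma mem_derivationValues {X Y : Matrix (Fin n) (Fin n) K}
    {v : Matrix (Fin n) (Fin n) K × Matrix (Fin n) (Fin n) K} :
    v ∈ derivationValues X Y ↔ ∃ D : Derivation ℤ K K, X.map D = v.1 ∧ Y.map D = v.2 := by
  constructor
  · rintro ⟨D, rfl⟩; exact ⟨D, rfl, rfl⟩
  · rintro ⟨D, h1, h2⟩; exact ⟨D, Prod.ext h1 h2⟩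

lemma IsLower.map_derivation {A : Matrix (Fin n) (Fin n) K} (hA : IsLower A)
    (D : Derivation ℤ K K) : IsLower (A.map D) := by
  intro i j h
  rw [Matrix.map_apply, hA i j h, map_zero]

/-- If `L` is lower triangular with distinct diagonal entries, then a strictly lower triangular
matrix commuting with `L` vanishes. -/
lemma eq_zero_of_commute_of_isLower {P L : Matrix (Fin n) (Fin n) K} (hP : IsLower P)
    (hP0 : ∀ i, P i i = 0) (hL : IsLower L) (hd : ∀ i j, i ≠ j → L i i ≠ L j j)
    (hc : P * L = L * P) : P = 0 := by
  have key : ∀ d : ℕ, ∀ i j : Fin n, i.1 = j.1 + d → P i j = 0 := by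
    intro d
    induction d using Nat.strong_induction_on with
    | _ d ih =>
      intro i j hij
      rcases Nat.eq_zero_or_pos d with rfl | hd0
      · have : i = j := Fin.ext (by simpa using hij)
        subst this; exact hP0 i
      have h1 : (P * L) i j = P i j * L j j := by
        rw [Matrix.mul_apply]
        refine Finset.sum_eq_single j (fun k _ hk => ?_) (by simp)
        rcases lt_or_gt_of_ne hk with h | h
        · rw [hL k j h, mul_zero]
        · rcases lt_or_ge i k with h' | h'
          · rw [hP i k h', zero_mul]
          · rw [ih (i.1 - k.1) (by omega) i k (by omega), zero_mul]
      have h2 : (L * P) i j = L i i * P i j := by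
        rw [Matrix.mul_apply]
        refine Finset.sum_eq_single i (fun k _ hk => ?_) (by simp)
        rcases lt_or_gt_of_ne hk with h | h
        · rcases lt_or_ge k j with h' | h'
          · rw [hP k j h', mul_zero]
          · rw [ih (k.1 - j.1) (by omega) k j (by omega), mul_zero]
        · rw [hL i k h, zero_mul]
      have hne : i ≠ j := fun h => by subst h; omega
      rw [hc, h2] at h1
      have h3 : (L i i - L j j) * P i j = 0 := by linear_combination h1
      exact (mul_eq_zero.mp h3).resolve_left (sub_ne_zero.mpr (hd i j hne))
  ext i j
  rcases lt_or_ge i j with h | h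
  · exact hP i j h
  · exact key (i.1 - j.1) i j (by omega)

/-- For a pair with `XY` lower and `YX` upper triangular, the space of values of derivations has
dimension at most `n² + n`. In case of equality, the differentials of the triangularity equations
are linearly independent. -/
theorem finrank_derivationValues_le {X Y : Matrix (Fin n) (Fin n) K} (hXY : IsLower (X * Y))
    (hYX : IsLower (Y * X)ᵀ) :
    finrank K (derivationValues X Y) ≤ n * n + n ∧
    (n * n + n ≤ finrank K (derivationValues X Y) →
      ∀ P Q : Matrix (Fin n) (Fin n) K, IsLower P → (∀ i, P i i = 0) → IsLower Qᵀ →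
        (∀ i, Q i i = 0) → P * X + X * Q = 0 → Y * P + Q * Y = 0 → P = 0 ∧ Q = 0) := by
  classical
  obtain ⟨u, w, M, u', w', hX, hM, hu, hw, hu', hw', huw, hwu, huw', hwu'⟩ :=
    exists_lower_monomial_upper X
  let U : Finset (Fin n × Fin n) := Finset.univ.filter fun p =>
    (∃ a', a' < p.1 ∧ M a' p.2 ≠ 0) ∨ (∃ b', b' < p.2 ∧ M p.1 b' ≠ 0)
  let Z : Finset (Fin n × Fin n) := Finset.univ.filter fun p => M p.1 p.2 ≠ 0
  have hU : ∀ a b, (a, b) ∈ U ↔ (∃ a', a' < a ∧ M a' b ≠ 0) ∨ (∃ b', b' < b ∧ M a b' ≠ 0) := by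
    intro a b; simp [U]
  have hZ : ∀ a b, (a, b) ∈ Z ↔ M a b ≠ 0 := by intro a b; simp [Z]
  have hZU : ∀ a b, (a, b) ∈ Z → (a, b) ∉ U := by
    intro a b h h'
    rw [hZ] at h
    rcases (hU a b).mp h' with ⟨a', h1, h2⟩ | ⟨b', h1, h2⟩
    · exact h2 ((hM a b h).2 a' h1.ne)
    · exact h2 ((hM a b h).1 b' h1.ne)
  have hwX : w * X = M * u' := by rw [hX, ← mul_assoc, ← mul_assoc, hwu, one_mul]
  have hXw : X * w' = u * M := by rw [hX, mul_assoc, huw', mul_one]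
  have hA : ∀ D : Derivation ℤ K K, ∀ a b, (a, b) ∉ U ∪ Z → (w * X.map D * w') a b = 0 := by
    intro D a b hab
    rw [Finset.mem_union, not_or, hU, hZ, not_not, not_or] at hab
    push Not at hab
    obtain ⟨⟨h1, h2⟩, h3⟩ := hab
    have e : w * X.map D * w' = (w * u.map D) * M + M.map D + M * (u'.map D * w') := by
      rw [hX, D.map_matrix_mul, D.map_matrix_mul]
      calc w * ((u.map D * M + u * M.map D) * u' + u * M * u'.map D) * w'
          = w * u.map D * M * (u' * w') + (w * u) * M.map D * (u' * w')
            + (w * u) * M * (u'.map D * w') := by noncomm_ring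
        _ = _ := by rw [huw', hwu]; simp
    have l1 : IsLower (w * u.map D) := hw.mul (hu.map_derivation D)
    have l2 : IsLower (u'.map D * w')ᵀ := by
      rw [Matrix.transpose_mul]
      exact hw'.mul (hu'.map_derivation D)
    rw [e, Matrix.add_apply, Matrix.add_apply, Matrix.map_apply, h3, map_zero, add_zero,
      Matrix.mul_apply, Matrix.mul_apply, Finset.sum_eq_zero, Finset.sum_eq_zero, add_zero]
    · intro k _
      rcases lt_trichotomy k b with h | h | h
      · rw [h2 k h, zero_mul]
      · rw [h, h3, zero_mul]
      · have : (u'.map D * w') k b = 0 := l2 b k h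
        rw [this, mul_zero]
    · intro k _
      rcases lt_trichotomy k a with h | h | h
      · rw [h1 k h, mul_zero]
      · rw [h, h3, mul_zero]
      · rw [l1 a k h, zero_mul]
  have hB : ∀ D : Derivation ℤ K K, X.map D = 0 → ∀ a b, (a, b) ∈ U →
      (u' * Y.map D * u) b a = 0 := by
    intro D hD a b hab
    have e1 : M * (u' * Y.map D * u) = w * (X * Y).map D * u := by
      rw [D.map_matrix_mul, hD, zero_mul, zero_add, ← mul_assoc, ← mul_assoc, ← mul_assoc, hwX]
    have e2 : (u' * Y.map D * u) * M = u' * (Y * X).map D * w' := by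
      rw [D.map_matrix_mul, hD, mul_zero, add_zero, mul_assoc (u' * Y.map D), ← hXw]
      simp only [mul_assoc]
    have l1 : IsLower (M * (u' * Y.map D * u)) := by
      rw [e1]; exact (hw.mul (hXY.map_derivation D)).mul hu
    have l2 : IsLower ((u' * Y.map D * u) * M)ᵀ := by
      rw [e2, Matrix.transpose_mul, Matrix.transpose_mul]
      exact hw'.mul (IsLower.mul (hYX.map_derivation D) hu')
    rcases (hU a b).mp hab with ⟨a', h1, h2⟩ | ⟨b', h1, h2⟩
    · have h := l1 a' a h1
      rw [Matrix.mul_apply, Finset.sum_eq_single b] at h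
      · exact (mul_eq_zero.mp h).resolve_left h2
      · intro k _ hk; rw [(hM a' b h2).1 k hk, zero_mul]
      · simp
    · have h : ((u' * Y.map D * u) * M) b b' = 0 := l2 b' b h1
      rw [Matrix.mul_apply, Finset.sum_eq_single a] at h
      · exact (mul_eq_zero.mp h).resolve_right h2
      · intro k _ hk; rw [(hM a b' h2).2 k hk, mul_zero]
      · simp
  let W := derivationValues X Y
  let f1 : W →ₗ[K] ({p // p ∈ U ∪ Z} → K) :=
    { toFun := fun v p => (w * v.1.1 * w') p.1.1 p.1.2
      map_add' := by intro v v'; ext p; simp [mul_add, add_mul]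
      map_smul' := by intro c v; ext p; simp }
  have hf1 : ∀ v, f1 v = 0 → v.1.1 = 0 := by
    rintro ⟨v, hv⟩ h
    obtain ⟨D, h1, h2⟩ := mem_derivationValues.mp hv
    have h3 : w * v.1 * w' = 0 := by
      ext a b
      by_cases hab : (a, b) ∈ U ∪ Z
      · exact congrFun h ⟨(a, b), hab⟩
      · rw [← h1]; exact hA D a b hab
    calc v.1 = (u * w) * v.1 * (w' * u') := by rw [huw, hwu']; simp
      _ = u * (w * v.1 * w') * u' := by simp only [mul_assoc]
      _ = 0 := by rw [h3]; simp
  let f2 : LinearMap.ker f1 →ₗ[K] ({p // p ∉ U} → K) :=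
    { toFun := fun v p => (u' * v.1.1.2 * u) p.1.2 p.1.1
      map_add' := by intro v v'; ext p; simp [mul_add, add_mul]
      map_smul' := by intro c v; ext p; simp }
  have hf2 : Function.Injective f2 := by
    rw [injective_iff_map_eq_zero]
    rintro ⟨⟨v, hv⟩, hv'⟩ h
    have hv1 : v.1 = 0 := hf1 _ hv'
    obtain ⟨D, h1, h2⟩ := mem_derivationValues.mp hv
    have h3 : u' * v.2 * u = 0 := by
      ext b a
      by_cases hab : (a, b) ∈ U
      · rw [← h2]; exact hB D (h1.trans hv1) a b hab
      · exact congrFun h ⟨(a, b), hab⟩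
    have hv2 : v.2 = 0 := by
      calc v.2 = (w' * u') * v.2 * (u * w) := by rw [huw, hwu']; simp
        _ = w' * (u' * v.2 * u) * w := by simp only [mul_assoc]
        _ = 0 := by rw [h3]; simp
    exact Subtype.ext (Subtype.ext (Prod.ext hv1 hv2))
  have hrank := LinearMap.finrank_range_add_finrank_ker f1
  have hr1 : finrank K (LinearMap.range f1) ≤ (U ∪ Z).card := by
    refine (Submodule.finrank_le _).trans ?_
    rw [Module.finrank_fintype_fun_eq_card, Fintype.card_coe]
  have hr2 : finrank K (LinearMap.ker f1) ≤ n * n - U.card := by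
    refine (LinearMap.finrank_le_finrank_of_injective hf2).trans ?_
    simp [Fintype.card_subtype_compl]
  have hUn : U.card ≤ n * n := by
    refine (Finset.card_le_univ _).trans ?_
    simp
  have hUZ := Finset.card_union_le U Z
  have hinj : Set.InjOn Prod.fst (Z : Set (Fin n × Fin n)) := by
    rintro ⟨a, b⟩ h ⟨a', b'⟩ h' (rfl : a = a')
    have h1 := (hZ _ _).mp h
    have h2 := (hZ _ _).mp h'
    by_contra hne
    exact h2 ((hM a b h1).1 b' (fun e => hne (by rw [e])))
  have hZn : Z.card ≤ n := by
    rw [← Finset.card_image_of_injOn hinj]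
    refine (Finset.card_le_univ _).trans ?_
    simp
  refine ⟨by change finrank K W ≤ _; omega, ?_⟩
  intro hge P Q hP hP0 hQ hQ0 hPX hYP
  change _ ≤ finrank K W at hge
  have hZcard : Z.card = n := by omega
  have hker : finrank K (LinearMap.ker f1) = finrank K ({p // p ∉ U} → K) := by
    have : finrank K ({p // p ∉ U} → K) = n * n - U.card := by
      simp [Fintype.card_subtype_compl]
    omega
  have hsurj : Function.Surjective f2 := by
    rw [← LinearMap.range_eq_top]
    refine Submodule.eq_top_of_finrank_eq ?_
    rw [LinearMap.finrank_range_of_inj hf2, hker]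
  have hrow : ∀ a, ∃ b, M a b ≠ 0 := by
    have : Z.image Prod.fst = Finset.univ := by
      apply Finset.eq_univ_of_card
      rw [Finset.card_image_of_injOn hinj, hZcard, Fintype.card_fin]
    intro a
    obtain ⟨⟨a', b⟩, h, rfl⟩ := Finset.mem_image.mp (this ▸ Finset.mem_univ a)
    exact ⟨b, (hZ _ _).mp h⟩
  choose s hs using hrow
  have hs_inj : Function.Injective s := by
    intro a a' h
    by_contra hne
    have := (hM a (s a) (hs a)).2 a' (Ne.symm hne)
    rw [h] at this
    exact hs a' this
  have hs_surj : Function.Surjective s := Finite.surjective_of_injective hs_inj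
  have hdist : ∀ i k, i ≠ k → (X * Y) i i ≠ (X * Y) k k := by
    intro i k hik heq
    have hi : (i, s i) ∉ U := hZU _ _ ((hZ _ _).mpr (hs i))
    obtain ⟨⟨⟨v, hv⟩, hv'⟩, hf⟩ := hsurj (Pi.single ⟨(i, s i), hi⟩ 1)
    have hv1 : v.1 = 0 := hf1 _ hv'
    obtain ⟨D, h1, h2⟩ := mem_derivationValues.mp hv
    have h3 : ∀ a b, (u' * v.2 * u) b a = if a = i ∧ b = s i then 1 else 0 := by
      intro a b
      by_cases hab : (a, b) ∈ U
      · rw [← h2, hB D (h1.trans hv1) a b hab, if_neg]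
        rintro ⟨rfl, rfl⟩; exact hi hab
      · have := congrFun hf ⟨(a, b), hab⟩
        rw [Pi.single_apply] at this
        refine Eq.trans this ?_
        simp [Prod.ext_iff]
    have e1 : M * (u' * v.2 * u) = w * (X * Y).map D * u := by
      rw [D.map_matrix_mul, h1, h2, hv1, zero_mul, zero_add, ← mul_assoc, ← mul_assoc,
        ← mul_assoc, hwX]
    have e2 : (X * Y).map D = u * (M * (u' * v.2 * u)) * w := by
      calc (X * Y).map D = (u * w) * (X * Y).map D * (u * w) := by rw [huw]; simp
        _ = u * (w * (X * Y).map D * u) * w := by simp only [mul_assoc]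
        _ = _ := by rw [e1]
    have l1 : IsLower (M * (u' * v.2 * u)) := by
      rw [e1]; exact (hw.mul (hXY.map_derivation D)).mul hu
    have hdiag : ∀ m, D ((X * Y) m m) = M m (s i) * if m = i then 1 else 0 := by
      intro m
      have h4 : D ((X * Y) m m) = (u * (M * (u' * v.2 * u)) * w) m m := by
        rw [← e2, Matrix.map_apply]
      have h5 : u m m * w m m = 1 := by
        rw [← hu.mul_diag hw, huw, Matrix.one_apply_eq]
      have h6 : (M * (u' * v.2 * u)) m m = M m (s i) * if m = i then 1 else 0 := by
        rw [Matrix.mul_apply, Finset.sum_eq_single (s i)]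
        · rw [h3]; simp
        · intro b _ hb
          rw [h3, if_neg (fun h => hb h.2), mul_zero]
        · simp
      rw [h4, (hu.mul l1).mul_diag hw, hu.mul_diag l1, h6]
      linear_combination (M m (s i) * if m = i then 1 else 0) * h5
    have h7 := hdiag i
    rw [heq, hdiag k, if_neg hik.symm, if_pos rfl, mul_zero, mul_one] at h7
    exact hs i h7.symm
  have hPz : P = 0 := by
    refine eq_zero_of_commute_of_isLower hP hP0 hXY hdist ?_
    have h1 : P * X = -(X * Q) := eq_neg_of_add_eq_zero_left hPX
    have h2 : Y * P = -(Q * Y) := eq_neg_of_add_eq_zero_left hYP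
    rw [← mul_assoc, h1, mul_assoc X, h2]
    simp [mul_assoc]
  refine ⟨hPz, ?_⟩
  rw [hPz, zero_mul, zero_add] at hPX
  have h1 : M * (u' * Q) = 0 := by
    rw [← mul_assoc, ← hwX, mul_assoc, hPX, mul_zero]
  have h2 : u' * Q = 0 := by
    ext b c
    obtain ⟨a, rfl⟩ := hs_surj b
    have h := congrFun (congrFun h1 a) c
    rw [Matrix.mul_apply, Finset.sum_eq_single (s a)] at h
    · exact (mul_eq_zero.mp h).resolve_left (hs a)
    · intro k _ hk; rw [(hM a _ (hs a)).1 k hk, zero_mul]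
    · simp
  calc Q = w' * (u' * Q) := by rw [← mul_assoc, hwu', one_mul]
    _ = 0 := by rw [h2, mul_zero]

end Tangent

section Jacobian

open Module

section

variable {S : Type*} [CommRing S] (Q : Ideal S) {K : Type*} [Field K] [Algebra S K]
  [Algebra (S ⧸ Q) K] [IsScalarTower S (S ⧸ Q) K] [IsFractionRing (S ⧸ Q) K]

omit [IsFractionRing (S ⧸ Q) K] in
lemma algebraMap_quotient_mk (a : S) :
    algebraMap (S ⧸ Q) K (Ideal.Quotient.mk Q a) = algebraMap S K a :=
  (IsScalarTower.algebraMap_apply S (S ⧸ Q) K a).symm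

lemma algebraMap_eq_zero_iff_mem {a : S} : algebraMap S K a = 0 ↔ a ∈ Q := by
  rw [← algebraMap_quotient_mk Q, IsFractionRing.to_map_eq_zero_iff,
    Ideal.Quotient.eq_zero_iff_mem]

/-- A derivation from a ring to the residue field of a prime vanishing on that prime extends to a
derivation of the residue field. -/
lemma exists_derivation_residueField (d : Derivation ℤ S K) (hd : ∀ a ∈ Q, d a = 0) :
    ∃ D : Derivation ℤ K K,
      ∀ a, D (algebraMap S K a) = d a := by
  let f : S →+* TrivSqZeroExt K K :=
    { toFun := fun a => (algebraMap S K a, d a)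
      map_one' := TrivSqZeroExt.ext (map_one _) d.map_one_eq_zero
      map_zero' := TrivSqZeroExt.ext (map_zero _) (map_zero d)
      map_add' := fun a b => TrivSqZeroExt.ext (map_add _ _ _) (map_add _ _ _)
      map_mul' := fun a b => TrivSqZeroExt.ext (map_mul _ _ _) (by
        change d (a * b) = algebraMap S K a • d b + MulOpposite.op (algebraMap S K b) • d a
        rw [d.leibniz]
        simp [Algebra.smul_def, mul_comm]) }
  have hf : ∀ a ∈ Q, f a = 0 := fun a ha =>
    TrivSqZeroExt.ext ((algebraMap_eq_zero_iff_mem Q).mpr ha) (hd a ha)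
  let g : S ⧸ Q →+* TrivSqZeroExt K K := Ideal.Quotient.lift Q f hf
  have hg : ∀ y : nonZeroDivisors (S ⧸ Q), IsUnit (g y) := by
    rintro ⟨y, hy⟩
    obtain ⟨a, rfl⟩ := Ideal.Quotient.mk_surjective y
    rw [TrivSqZeroExt.isUnit_iff_isUnit_fst, isUnit_iff_ne_zero]
    change algebraMap S K a ≠ 0
    rw [ne_eq, (algebraMap_eq_zero_iff_mem Q)]
    intro ha
    rw [Ideal.Quotient.eq_zero_iff_mem.mpr ha] at hy
    have : Nontrivial (S ⧸ Q) := (algebraMap (S ⧸ Q) K).domain_nontrivial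
    exact nonZeroDivisors.ne_zero hy rfl
  let F : K →+* TrivSqZeroExt K K := IsLocalization.lift (M := nonZeroDivisors (S ⧸ Q)) hg
  have hF : ∀ a, F (algebraMap S K a) = f a := fun a => by
    rw [← algebraMap_quotient_mk Q]
    exact (IsLocalization.lift_eq hg _).trans rfl
  have hfst : ∀ x, (F x).fst = x := by
    have : (TrivSqZeroExt.fstHom ℤ K K).toRingHom.comp F = RingHom.id K := by
      refine IsLocalization.ringHom_ext (nonZeroDivisors (S ⧸ Q)) ?_
      refine Ideal.Quotient.ringHom_ext ?_
      ext a
      change (F (algebraMap (S ⧸ Q) K (Ideal.Quotient.mk Q a))).fst =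
        algebraMap (S ⧸ Q) K (Ideal.Quotient.mk Q a)
      rw [algebraMap_quotient_mk, hF]; rfl
    exact fun x => RingHom.congr_fun this x
  refine ⟨Derivation.mk' (AddMonoidHom.toIntLinearMap
    ⟨⟨fun x => (F x).snd, by simp⟩, by simp⟩) ?_, ?_⟩
  · intro a b
    change (F (a * b)).snd = a • (F b).snd + b • (F a).snd
    rw [map_mul, TrivSqZeroExt.snd_mul, hfst, hfst, op_smul_eq_smul]
  · intro a
    change (F (algebraMap S K a)).snd = d a
    rw [hF]; rfl

end

lemma exists_generators_localization {S : Type*} [CommRing S] [IsRegularRing S] (Q : Ideal S)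
    [Q.IsPrime] {h : ℕ} (hQ : Q.height = h) :
    ∃ g : Fin h → S, (∀ i, g i ∈ Q) ∧ ∀ a ∈ Q, ∃ s ∉ Q, s * a ∈ Ideal.span (Set.range g) := by
  let A := Localization.AtPrime Q
  have hr : ((IsLocalRing.maximalIdeal A).spanFinrank : WithBot ℕ∞) = ringKrullDim A :=
    IsRegularLocalRing.spanFinrank_maximalIdeal
  rw [IsLocalization.AtPrime.ringKrullDim_eq_height Q, hQ] at hr
  have hr' : (IsLocalRing.maximalIdeal A).spanFinrank = h := by exact_mod_cast hr
  obtain ⟨t, ht, hspan⟩ := (IsNoetherian.noetherian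
    (IsLocalRing.maximalIdeal A)).exists_span_finset_card_eq_spanFinrank
  have e : Fin h ≃ t := (Fintype.equivFinOfCardEq (by simp [ht, hr'])).symm
  have hmem : ∀ i, (e i : A) ∈ Q.map (algebraMap S A) := fun i => by
    rw [Localization.AtPrime.map_eq_maximalIdeal, ← hspan]
    exact Submodule.subset_span (e i).2
  have hg : ∀ i, ∃ g ∈ Q, ∃ s ∉ Q, (e i : A) * algebraMap S A s = algebraMap S A g := fun i => by
    obtain ⟨⟨⟨g, hg⟩, s⟩, h⟩ := (IsLocalization.mem_map_algebraMap_iff Q.primeCompl A).mp (hmem i)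
    exact ⟨g, hg, s, s.2, h⟩
  choose g hg s hs hgs using hg
  refine ⟨g, hg, fun a ha => ?_⟩
  have h1 : algebraMap S A a ∈ (Ideal.span (Set.range g)).map (algebraMap S A) := by
    have h2 : algebraMap S A a ∈ IsLocalRing.maximalIdeal A := by
      rw [← Localization.AtPrime.map_eq_maximalIdeal]
      exact Ideal.mem_map_of_mem _ ha
    refine (?_ : IsLocalRing.maximalIdeal A ≤ _) h2
    rw [← hspan]
    refine Submodule.span_le.mpr fun x hx => ?_
    obtain ⟨i, hi⟩ := e.surjective ⟨x, hx⟩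
    have hu : IsUnit (algebraMap S A (s i)) := IsLocalization.map_units A (⟨s i, hs i⟩ : Q.primeCompl)
    rw [show x = e i by rw [hi], SetLike.mem_coe, ← Ideal.mul_unit_mem_iff_mem _ hu, hgs]
    exact Ideal.mem_map_of_mem _ (Ideal.subset_span ⟨i, rfl⟩)
  obtain ⟨⟨⟨b, hb⟩, r⟩, h2⟩ := (IsLocalization.mem_map_algebraMap_iff Q.primeCompl A).mp h1
  obtain ⟨c, hc⟩ := (IsLocalization.eq_iff_exists Q.primeCompl A).mp
    (show algebraMap S A (a * r) = algebraMap S A b by simpa using h2)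
  refine ⟨c * r, (c * r).2, ?_⟩
  rw [mul_assoc, mul_comm (r : S), hc]
  exact Ideal.mul_mem_left _ _ hb

variable {σ k : Type*} [Field k] (K : Type*) [Field K] [Algebra (MvPolynomial σ k) K]

/-- The gradient of a polynomial with values in a field. -/
def gradientAt (a : MvPolynomial σ k) : σ → K :=
  fun s => algebraMap _ K (MvPolynomial.pderiv s a)

lemma gradientAt_mul (a b : MvPolynomial σ k) :
    gradientAt K (a * b) = algebraMap _ K a • gradientAt K b + algebraMap _ K b • gradientAt K a := by
  ext s
  simp [gradientAt, Derivation.leibniz, Algebra.smul_def]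

lemma gradientAt_add (a b : MvPolynomial σ k) :
    gradientAt K (a + b) = gradientAt K a + gradientAt K b := by
  ext s; simp [gradientAt]

lemma gradientAt_sub (a b : MvPolynomial σ k) :
    gradientAt K (a - b) = gradientAt K a - gradientAt K b := by
  ext s; simp [gradientAt]

lemma gradientAt_sum {ι : Type*} (t : Finset ι) (f : ι → MvPolynomial σ k) :
    gradientAt K (∑ i ∈ t, f i) = ∑ i ∈ t, gradientAt K (f i) := by
  ext s; simp [gradientAt]

variable (Q : Ideal (MvPolynomial σ k)) [Algebra (MvPolynomial σ k ⧸ Q) K]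
  [IsScalarTower (MvPolynomial σ k) (MvPolynomial σ k ⧸ Q) K]
  [IsFractionRing (MvPolynomial σ k ⧸ Q) K]

lemma gradientAt_mul_of_mem {a b : MvPolynomial σ k} (hb : b ∈ Q) :
    gradientAt K (a * b) = algebraMap _ K a • gradientAt K b := by
  rw [gradientAt_mul, (algebraMap_eq_zero_iff_mem Q).mpr hb, zero_smul, add_zero]

variable [Fintype σ]

/-- The tangent space at a prime. -/
def tangentAt (Q : Ideal (MvPolynomial σ k)) : Submodule K (σ → K) where
  carrier := {v | ∀ a ∈ Q, v ⬝ᵥ gradientAt K a = 0}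
  add_mem' hv hw a ha := by rw [add_dotProduct, hv a ha, hw a ha, add_zero]
  zero_mem' a _ := zero_dotProduct _
  smul_mem' c v hv a ha := by rw [smul_dotProduct, hv a ha, smul_zero]

lemma exists_derivation_of_mem_tangentAt {v : σ → K} (hv : v ∈ tangentAt K Q) :
    ∃ D : Derivation ℤ K K, ∀ s, D (algebraMap (MvPolynomial σ k) K (MvPolynomial.X s)) = v s := by
  classical
  let d : Derivation ℤ (MvPolynomial σ k) K :=
    Derivation.mk' (AddMonoidHom.toIntLinearMap
      ⟨⟨fun a => v ⬝ᵥ gradientAt K a, by simp [gradientAt, dotProduct]⟩, fun a b => by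
        simp only [gradientAt_add, dotProduct_add]⟩) (fun a b => by
        change v ⬝ᵥ gradientAt K (a * b) = a • (v ⬝ᵥ gradientAt K b) + b • (v ⬝ᵥ gradientAt K a)
        rw [gradientAt_mul, dotProduct_add, dotProduct_smul, dotProduct_smul]
        simp [Algebra.smul_def])
  obtain ⟨D, hD⟩ := exists_derivation_residueField Q d hv
  refine ⟨D, fun s => (hD _).trans ?_⟩
  change v ⬝ᵥ gradientAt K (MvPolynomial.X s) = v s
  rw [dotProduct, Finset.sum_eq_single s]
  · simp [gradientAt]
  · intro b _ hb
    simp [gradientAt, MvPolynomial.pderiv_X_of_ne hb.symm]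
  · simp

variable [Q.IsPrime]

lemma card_le_finrank_tangentAt_add {h : ℕ} (hQ : Q.height = h) :
    Fintype.card σ ≤ finrank K (tangentAt K Q) + h := by
  obtain ⟨g, hg, hspan⟩ := exists_generators_localization Q hQ
  let f : (σ → K) →ₗ[K] (Fin h → K) :=
    { toFun := fun v i => v ⬝ᵥ gradientAt K (g i)
      map_add' := fun v w => by ext i; simp [add_dotProduct]
      map_smul' := fun c v => by ext i; simp [smul_dotProduct] }
  have hker : LinearMap.ker f ≤ tangentAt K Q := by
    intro v hv a ha
    obtain ⟨s, hs, hsa⟩ := hspan a ha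
    obtain ⟨c, hc⟩ := (Ideal.mem_span_range_iff_exists_fun).mp hsa
    have h1 : algebraMap _ K s • (v ⬝ᵥ gradientAt K a) = 0 := by
      rw [← dotProduct_smul, ← gradientAt_mul_of_mem K Q ha, ← hc, gradientAt_sum, dotProduct_sum]
      refine Finset.sum_eq_zero fun i _ => ?_
      rw [gradientAt_mul_of_mem K Q (hg i), dotProduct_smul, show v ⬝ᵥ gradientAt K (g i) = 0 from
        congrFun hv i, smul_zero]
    exact (smul_eq_zero.mp h1).resolve_left fun h => hs ((algebraMap_eq_zero_iff_mem Q).mp h)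
  have h1 := LinearMap.finrank_range_add_finrank_ker f
  have h2 := Submodule.finrank_mono hker
  have h3 := Submodule.finrank_le (LinearMap.range f)
  simp only [finrank_fintype_fun_eq_card, Fintype.card_fin] at h1 h3
  omega

/-- Jacobian criterion: at least `height Q` elements of `Q` with independent gradients generate
`Q` locally. -/
theorem exists_mul_mem_span_of_gradientAt {ι : Type*} [Fintype ι] (f : ι → MvPolynomial σ k)
    (hf : ∀ i, f i ∈ Q) (hQ : Q.height ≤ Fintype.card ι)
    (hind : LinearIndependent K fun i => gradientAt K (f i)) :
    ∀ a ∈ Q, ∃ s ∉ Q, s * a ∈ Ideal.span (Set.range f) := by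
  classical
  obtain ⟨h, hh⟩ := ENat.ne_top_iff_exists.mp (ne_top_of_le_ne_top (ENat.natCast_ne_top _) hQ)
  have hι : h ≤ Fintype.card ι := by rw [← hh] at hQ; exact_mod_cast hQ
  obtain ⟨g, hg, hspan⟩ := exists_generators_localization Q hh.symm
  choose s hs hsf using fun i => hspan (f i) (hf i)
  choose b hb using fun i => (Ideal.mem_span_range_iff_exists_fun).mp (hsf i)
  have hs0 : ∀ i, algebraMap _ K (s i) ≠ 0 := fun i h => hs i ((algebraMap_eq_zero_iff_mem Q).mp h)
  have hrow : LinearIndependent K fun i j => algebraMap _ K (b i j) := by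
    rw [Fintype.linearIndependent_iff] at hind ⊢
    intro c hc i
    have h1 := hind (fun i => c i * algebraMap _ K (s i)) (by
      have : ∀ i, (c i * algebraMap _ K (s i)) • gradientAt K (f i) =
          ∑ j, (c i * algebraMap _ K (b i j)) • gradientAt K (g j) := fun i => by
        rw [mul_smul, ← gradientAt_mul_of_mem K Q (hf i), ← hb, gradientAt_sum, Finset.smul_sum]
        refine Finset.sum_congr rfl fun j _ => ?_
        rw [gradientAt_mul_of_mem K Q (hg j), smul_smul]
      simp only [this]
      rw [Finset.sum_comm]
      refine Finset.sum_eq_zero fun j _ => ?_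
      rw [← Finset.sum_smul]
      have h2 := congrFun hc j
      simp only [Finset.sum_apply, Pi.smul_apply, smul_eq_mul, Pi.zero_apply] at h2
      rw [h2, zero_smul]) i
    exact (mul_eq_zero.mp h1).resolve_right (hs0 i)
  have hcard : Fintype.card ι = h := by
    refine le_antisymm ?_ hι
    simpa using hrow.fintype_card_le_finrank
  let e : Fin h ≃ ι := (Fintype.equivFinOfCardEq hcard).symm
  let B : Matrix (Fin h) (Fin h) (MvPolynomial σ k) := Matrix.of fun i j => b (e i) j
  have hdet : B.det ∉ Q := by
    rw [← algebraMap_eq_zero_iff_mem Q (K := K), RingHom.map_det, ← ne_eq, ← isUnit_iff_ne_zero,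
      ← Matrix.isUnit_iff_isUnit_det, ← Matrix.linearIndependent_rows_iff_isUnit]
    exact hrow.comp e e.injective
  have hgen : ∀ j, B.det * g j ∈ Ideal.span (Set.range f) := by
    intro j
    have h1 : B.mulVec g = fun i => s (e i) * f (e i) := by
      ext1 i; exact hb (e i)
    have h2 : B.adjugate.mulVec (B.mulVec g) = B.det • g := by
      rw [Matrix.mulVec_mulVec, Matrix.adjugate_mul, Matrix.smul_mulVec, Matrix.one_mulVec]
    have h3 := congrFun h2 j
    rw [Pi.smul_apply, smul_eq_mul] at h3
    rw [← h3, h1]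
    rw [Matrix.mulVec, dotProduct]
    refine Submodule.sum_mem (Ideal.span (Set.range f)) fun i _ => ?_
    exact Ideal.mul_mem_left _ (B.adjugate j i) (Ideal.mul_mem_left _ _
      (Ideal.subset_span ⟨_, rfl⟩))
  intro a ha
  obtain ⟨r, hr, hra⟩ := hspan a ha
  refine ⟨B.det * r, fun h => ((inferInstance : Q.IsPrime).mem_or_mem h).elim hdet hr, ?_⟩
  obtain ⟨c, hc⟩ := (Ideal.mem_span_range_iff_exists_fun).mp hra
  rw [mul_assoc, ← hc, Finset.mul_sum]
  refine Ideal.sum_mem _ fun i _ => ?_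
  rw [mul_left_comm]
  exact Ideal.mul_mem_left _ _ (hgen i)

end Jacobian

section LocalReducedness

universe u

open IsLocalRing RingTheory.Sequence Pointwise

/-- In a Cohen–Macaulay local ring, an ideal generated by a sequence of the expected height which
is generically reduced is radical, and so is the ideal generated by the sequence without its last
element. -/
theorem HasDepth.isRadical_ofList {A : Type u} [CommRing A] [IsLocalRing A] [IsNoetherianRing A]
    {d : ℕ} (hA : HasDepth A A d) (hd : ringKrullDim A ≤ d) (l : List A) (t : A)
    (hmem : ∀ y ∈ l ++ [t], y ∈ maximalIdeal A)
    (hht : ∀ p : Ideal A, p.IsPrime → Ideal.ofList (l ++ [t]) ≤ p →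
      (((l ++ [t]).length : ℕ) : ℕ∞) ≤ p.height)
    (hloc : ∀ p : Ideal A, p.IsPrime → Ideal.ofList (l ++ [t]) ≤ p →
      p.height ≤ ((l ++ [t]).length : ℕ) →
      ∀ a ∈ p, ∃ s ∉ p, s * a ∈ Ideal.ofList (l ++ [t])) :
    (Ideal.ofList l).IsRadical := by
  obtain ⟨hreg, hass⟩ := hA.isWeaklyRegular_of_height hd (l ++ [t]) hmem hht
  set J := Ideal.ofList (l ++ [t]) with hJ
  set I := Ideal.ofList l with hI
  have hJI : J = I ⊔ Ideal.span {t} := by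
    rw [hJ, Ideal.ofList_append, Ideal.ofList_singleton]
  have hJrad : J.IsRadical := by
    rintro b ⟨k, hk⟩
    by_contra hb
    have hx : Ideal.Quotient.mk J b ≠ 0 := by rwa [ne_eq, Ideal.Quotient.eq_zero_iff_mem]
    obtain ⟨P, hP, hle⟩ := exists_le_isAssociatedPrime_of_isNoetherianRing A _ hx
    have hPp := hP.isPrime
    have hJP : J ≤ P := by
      have := hP.annihilator_le
      rwa [Submodule.annihilator_top, Ideal.annihilator_quotient] at this
    obtain ⟨s, hs, hsb⟩ := hloc P hPp hJP (hass P hP) b (hPp.mem_of_pow_mem k (hJP hk))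
    refine hs (hle ?_)
    rw [Submodule.mem_colon_singleton, Submodule.mem_bot, Algebra.smul_def,
      Ideal.Quotient.algebraMap_eq, ← map_mul, Ideal.Quotient.eq_zero_iff_mem]
    exact hsb
  have hnzd : ∀ a, t * a ∈ I → a ∈ I := by
    rw [isWeaklyRegular_append_iff, isWeaklyRegular_singleton_iff] at hreg
    intro a ha
    have h0 : (Ideal.ofList l • ⊤ : Submodule A A) = I := by simp [hI]
    have h1 : t • (Submodule.Quotient.mk a : A ⧸ (Ideal.ofList l • ⊤ : Submodule A A)) =
        t • (0 : A ⧸ (Ideal.ofList l • ⊤ : Submodule A A)) := by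
      rw [smul_zero, ← Submodule.Quotient.mk_smul, Submodule.Quotient.mk_eq_zero, h0]
      exact ha
    have h2 := hreg.2 h1
    rwa [Submodule.Quotient.mk_eq_zero, h0] at h2
  have hnzd_pow : ∀ (k : ℕ) a, t ^ k * a ∈ I → a ∈ I := by
    intro k
    induction k with
    | zero => intro a ha; simpa using ha
    | succ k ih => intro a ha; exact ih _ (hnzd _ (by rwa [← mul_assoc, ← pow_succ']))
  have hle : I.radical ≤ I := by
    refine Submodule.le_of_le_smul_of_le_jacobson_bot (I := maximalIdeal A)
      (IsNoetherian.noetherian _) (IsLocalRing.jacobson_eq_maximalIdeal _ bot_ne_top).ge ?_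
    rintro a ⟨k, hk⟩
    have ha : a ∈ J := hJrad ⟨k, hJI ▸ Ideal.mem_sup_left hk⟩
    rw [hJI, Submodule.mem_sup] at ha
    obtain ⟨i, hi, y, hy, rfl⟩ := ha
    obtain ⟨b, rfl⟩ := Ideal.mem_span_singleton'.mp hy
    have hrad : b * t ∈ I.radical := by
      have := I.radical.sub_mem (⟨k, hk⟩ : i + b * t ∈ I.radical) (Ideal.le_radical hi)
      simpa using this
    obtain ⟨j, hj⟩ := hrad
    have hb : b ∈ I.radical := ⟨j, hnzd_pow j _ (by rwa [← mul_pow, mul_comm])⟩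
    refine Submodule.add_mem_sup hi ?_
    rw [mul_comm]
    exact Submodule.smul_mem_smul (hmem t (by simp)) hb
  exact hle

/-- At the origin of affine space, an ideal generated by a sequence of the expected height which
is generically reduced after adding one more element is radical. -/
theorem exists_mul_mem_ofList {σ k : Type} [Fintype σ] [Field k] (m : Ideal (MvPolynomial σ k))
    [m.IsPrime] (hm : ∀ i, MvPolynomial.X i ∈ m) (l : List (MvPolynomial σ k))
    (t : MvPolynomial σ k) (hmem : ∀ y ∈ l ++ [t], y ∈ m)
    (hht : ∀ p : Ideal (MvPolynomial σ k), p.IsPrime → Ideal.ofList (l ++ [t]) ≤ p →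
      (((l ++ [t]).length : ℕ) : ℕ∞) ≤ p.height)
    (hloc : ∀ p : Ideal (MvPolynomial σ k), p.IsPrime → Ideal.ofList (l ++ [t]) ≤ p →
      p.height ≤ ((l ++ [t]).length : ℕ) →
      ∀ a ∈ p, ∃ s ∉ p, s * a ∈ Ideal.ofList (l ++ [t]))
    (a : MvPolynomial σ k) (ha : a ∈ (Ideal.ofList l).radical) :
    ∃ s ∉ m, s * a ∈ Ideal.ofList l := by
  let S := MvPolynomial σ k
  let A := Localization.AtPrime m
  let f := algebraMap S A
  have hmap : l.map f ++ [f t] = (l ++ [t]).map f := by simp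
  have hrad : (Ideal.ofList (l.map f)).IsRadical := by
    refine (hasDepth_localization m hm).isRadical_ofList (ringKrullDim_localization_le m) _ (f t)
      ?_ ?_ ?_
    · rw [hmap]
      intro y hy
      obtain ⟨x, hx, rfl⟩ := List.mem_map.mp hy
      rw [← Localization.AtPrime.map_eq_maximalIdeal]
      exact Ideal.mem_map_of_mem _ (hmem x hx)
    · rw [hmap, ← Ideal.map_ofList, List.length_map]
      intro p hp hle
      rw [← IsLocalization.height_under m.primeCompl p]
      exact hht _ (hp.comap f) (Ideal.map_le_iff_le_comap.mp hle)
    · rw [hmap, ← Ideal.map_ofList, List.length_map]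
      intro p hp hle hpht b hb
      rw [← IsLocalization.height_under m.primeCompl p] at hpht
      obtain ⟨⟨c, u⟩, hcu⟩ := IsLocalization.surj m.primeCompl b
      have hu : IsUnit (f u) := IsLocalization.map_units A u
      have hc : c ∈ p.comap f := by
        rw [Ideal.mem_comap, ← hcu]
        exact Ideal.mul_mem_right _ _ hb
      obtain ⟨s, hs, hsc⟩ := hloc _ (hp.comap f) (Ideal.map_le_iff_le_comap.mp hle) hpht c hc
      refine ⟨f s, hs, ?_⟩
      rw [← Ideal.mul_unit_mem_iff_mem _ hu, mul_assoc, hcu, ← map_mul]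
      exact Ideal.mem_map_of_mem _ hsc
  obtain ⟨j, hj⟩ := ha
  have h1 : f a ∈ Ideal.ofList (l.map f) := hrad ⟨j, by
    rw [← map_pow, ← Ideal.map_ofList]; exact Ideal.mem_map_of_mem _ hj⟩
  rw [← Ideal.map_ofList] at h1
  obtain ⟨⟨⟨b, hb⟩, r⟩, h2⟩ := (IsLocalization.mem_map_algebraMap_iff m.primeCompl A).mp h1
  obtain ⟨c, hc⟩ := (IsLocalization.eq_iff_exists m.primeCompl A).mp
    (show algebraMap S A (a * r) = algebraMap S A b by rw [map_mul]; exact h2)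
  refine ⟨c * r, (c * r).2, ?_⟩
  rw [mul_assoc, mul_comm (r : S), hc]
  exact Ideal.mul_mem_left _ _ hb

end LocalReducedness

section Degeneration

open MvPolynomial Module Matrix

/-- The ring `k[x, y, t]`, with `t` the variable indexed by `none`. -/
abbrev DegRing (n : ℕ) (k : Type) [Field k] : Type :=
  MvPolynomial (Option ((Fin n × Fin n) ⊕ (Fin n × Fin n))) k

variable (n : ℕ) (k : Type) [Field k]

def degX : Matrix (Fin n) (Fin n) (DegRing n k) := Matrix.of fun i j => X (some (Sum.inl (i, j)))

def degY : Matrix (Fin n) (Fin n) (DegRing n k) := Matrix.of fun i j => X (some (Sum.inr (i, j)))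

def degT : DegRing n k := X none

/-- The degeneration of the `(i, j)` entry of the commutator to an entry of `XY` above the diagonal
and to an entry of `-YX` below the diagonal. -/
def degEq (i j : Fin n) : DegRing n k :=
  degT n k ^ (i.1 - j.1) * (degX n k * degY n k) i j
    - degT n k ^ (j.1 - i.1) * (degY n k * degX n k) i j

/-- Index type of the off-diagonal entries. -/
abbrev OffDiag (n : ℕ) : Type := {p : Fin n × Fin n // p.1 ≠ p.2}

/-- The degenerate equations together with `t`. -/
def degFamily : Option (OffDiag n) → DegRing n k
  | none => degT n k
  | some p => degEq n k p.1.1 p.1.2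

lemma card_offDiag_add : Fintype.card (OffDiag n) + n = n * n := by
  have h := Fintype.card_subtype_compl (fun p : Fin n × Fin n => p.1 = p.2)
  have h1 : Fintype.card {p : Fin n × Fin n // p.1 = p.2} = n := by
    rw [Fintype.card_congr (⟨fun p => p.1.1, fun i => ⟨(i, i), rfl⟩,
      fun ⟨⟨a, b⟩, (h : a = b)⟩ => by subst h; rfl, fun i => rfl⟩ :
        {p : Fin n × Fin n // p.1 = p.2} ≃ Fin n), Fintype.card_fin]
  rw [h1, Fintype.card_prod, Fintype.card_fin] at h
  have h2 : Fintype.card (OffDiag n) = n * n - n := h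
  have h3 : n ≤ n * n := Nat.le_mul_self n
  omega

variable {n k} (Q : Ideal (DegRing n k)) {K : Type*} [Field K] [Algebra (DegRing n k) K]
  [Algebra (DegRing n k ⧸ Q) K] [IsScalarTower (DegRing n k) (DegRing n k ⧸ Q) K]
  [IsFractionRing (DegRing n k ⧸ Q) K]

lemma degEq_of_lt {i j : Fin n} (h : i < j) : ∃ c, degEq n k i j =
    (degX n k * degY n k) i j - c * degT n k := by
  have h1 : i.1 - j.1 = 0 := by have : i.1 < j.1 := h; omega
  have h2 : j.1 - i.1 = (j.1 - i.1 - 1) + 1 := by have : i.1 < j.1 := h; omega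
  refine ⟨degT n k ^ (j.1 - i.1 - 1) * (degY n k * degX n k) i j, ?_⟩
  rw [degEq, h1, h2, Nat.add_sub_cancel, pow_zero, pow_succ]
  ring

lemma degEq_of_gt {i j : Fin n} (h : j < i) : ∃ c, degEq n k i j =
    c * degT n k - (degY n k * degX n k) i j := by
  have h1 : j.1 - i.1 = 0 := by have : j.1 < i.1 := h; omega
  have h2 : i.1 - j.1 = (i.1 - j.1 - 1) + 1 := by have : j.1 < i.1 := h; omega
  refine ⟨degT n k ^ (i.1 - j.1 - 1) * (degX n k * degY n k) i j, ?_⟩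
  rw [degEq, h1, h2, Nat.add_sub_cancel, pow_zero, pow_succ]
  ring

/-- Directional derivative of a matrix of polynomials. -/
def dirMatrix (v : Option ((Fin n × Fin n) ⊕ (Fin n × Fin n)) → K)
    (A : Matrix (Fin n) (Fin n) (DegRing n k)) : Matrix (Fin n) (Fin n) K :=
  A.map fun a => v ⬝ᵥ gradientAt K a

omit [Algebra (DegRing n k ⧸ Q) K] [IsScalarTower (DegRing n k) (DegRing n k ⧸ Q) K]
  [IsFractionRing (DegRing n k ⧸ Q) K] in
lemma dirMatrix_mul (v : Option ((Fin n × Fin n) ⊕ (Fin n × Fin n)) → K)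
    (A B : Matrix (Fin n) (Fin n) (DegRing n k)) :
    dirMatrix v (A * B) = dirMatrix v A * B.map (algebraMap _ K)
      + A.map (algebraMap _ K) * dirMatrix v B := by
  ext i j
  simp only [dirMatrix, Matrix.map_apply, Matrix.mul_apply, Matrix.add_apply, gradientAt_sum,
    gradientAt_mul, dotProduct_sum, dotProduct_add, dotProduct_smul, smul_eq_mul,
    Finset.sum_add_distrib]
  rw [add_comm]
  congr 1
  exact Finset.sum_congr rfl fun _ _ => mul_comm _ _

omit [Algebra (DegRing n k ⧸ Q) K] [IsScalarTower (DegRing n k) (DegRing n k ⧸ Q) K]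
  [IsFractionRing (DegRing n k ⧸ Q) K] in
lemma dotProduct_gradientAt_X (v : Option ((Fin n × Fin n) ⊕ (Fin n × Fin n)) → K)
    (s : Option ((Fin n × Fin n) ⊕ (Fin n × Fin n))) :
    v ⬝ᵥ gradientAt K (X s : DegRing n k) = v s := by
  classical
  rw [dotProduct, Finset.sum_eq_single s]
  · simp [gradientAt]
  · intro b _ hb
    simp [gradientAt, MvPolynomial.pderiv_X_of_ne hb.symm]
  · simp

variable (hQ : ∀ i, degFamily n k i ∈ Q)

include hQ

lemma isLower_of_degFamily_mem :
    IsLower ((degX n k).map (algebraMap _ K) * (degY n k).map (algebraMap _ K)) ∧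
    IsLower ((degY n k).map (algebraMap _ K) * (degX n k).map (algebraMap _ K))ᵀ := by
  rw [← Matrix.map_mul, ← Matrix.map_mul]
  have hT : degT n k ∈ Q := hQ none
  constructor
  · intro i j hij
    obtain ⟨c, hc⟩ := degEq_of_lt (k := k) hij
    have h1 : degEq n k i j ∈ Q := hQ (some ⟨(i, j), hij.ne⟩)
    rw [Matrix.map_apply, algebraMap_eq_zero_iff_mem Q]
    rw [hc] at h1
    simpa using Q.add_mem h1 (Q.mul_mem_left c hT)
  · intro i j hij
    obtain ⟨c, hc⟩ := degEq_of_gt (k := k) hij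
    have h1 : degEq n k j i ∈ Q := hQ (some ⟨(j, i), hij.ne'⟩)
    rw [Matrix.transpose_apply, Matrix.map_apply, algebraMap_eq_zero_iff_mem Q]
    rw [hc] at h1
    simpa using Q.sub_mem (Q.mul_mem_left c hT) h1

lemma finrank_tangentAt_le :
    finrank K (tangentAt K Q) ≤ finrank K (derivationValues ((degX n k).map (algebraMap _ K))
      ((degY n k).map (algebraMap _ K))) := by
  let f : tangentAt K Q →ₗ[K] Matrix (Fin n) (Fin n) K × Matrix (Fin n) (Fin n) K :=
    { toFun := fun v => (Matrix.of fun i j => v.1 (some (Sum.inl (i, j))),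
        Matrix.of fun i j => v.1 (some (Sum.inr (i, j))))
      map_add' := fun _ _ => rfl
      map_smul' := fun _ _ => rfl }
  have hf : Function.Injective f := by
    rw [injective_iff_map_eq_zero]
    rintro ⟨v, hv⟩ h
    ext s
    rcases s with _ | ⟨i, j⟩ | ⟨i, j⟩
    · have h1 := hv _ (hQ none)
      rwa [show degFamily n k none = X none from rfl, dotProduct_gradientAt_X] at h1
    · exact congrFun (congrFun (congrArg Prod.fst h) i) j
    · exact congrFun (congrFun (congrArg Prod.snd h) i) j
  rw [← LinearMap.finrank_range_of_inj hf]
  refine Submodule.finrank_mono ?_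
  rintro _ ⟨⟨v, hv⟩, rfl⟩
  obtain ⟨D, hD⟩ := exists_derivation_of_mem_tangentAt K Q hv
  exact mem_derivationValues.mpr ⟨D, Matrix.ext fun i j => hD _, Matrix.ext fun i j => hD _⟩

variable [Q.IsPrime]

lemma card_le_height_of_degFamily_mem :
    (Fintype.card (Option (OffDiag n)) : ℕ∞) ≤ Q.height := by
  rcases eq_or_ne Q.height ⊤ with h | h
  · rw [h]; exact le_top
  obtain ⟨d, hd⟩ := ENat.ne_top_iff_exists.mp h
  let K := Q.ResidueField
  have h1 := card_le_finrank_tangentAt_add K Q hd.symm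
  have h2 := finrank_tangentAt_le Q (K := K) hQ
  have h3 := (finrank_derivationValues_le (isLower_of_degFamily_mem Q (K := K) hQ).1
    (isLower_of_degFamily_mem Q (K := K) hQ).2).1
  have h4 := card_offDiag_add n
  simp only [Fintype.card_option, Fintype.card_sum, Fintype.card_prod, Fintype.card_fin] at h1 ⊢
  rw [← hd]
  have : Fintype.card (OffDiag n) + 1 ≤ d := by omega
  exact_mod_cast this

lemma linearIndependent_gradientAt_degFamily
    (hht : Q.height ≤ Fintype.card (Option (OffDiag n))) :
    LinearIndependent K fun i => gradientAt K (degFamily n k i) := by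
  classical
  have hlow := isLower_of_degFamily_mem Q (K := K) hQ
  set x := (degX n k).map (algebraMap _ K) with hx
  set y := (degY n k).map (algebraMap _ K) with hy
  have hfull : n * n + n ≤ finrank K (derivationValues x y) := by
    obtain ⟨d, hd⟩ := ENat.ne_top_iff_exists.mp (ne_top_of_le_ne_top (ENat.natCast_ne_top _) hht)
    have h1 := card_le_finrank_tangentAt_add K Q hd.symm
    have h2 := finrank_tangentAt_le Q (K := K) hQ
    have h4 := card_offDiag_add n
    rw [← hx, ← hy] at h2
    rw [← hd] at hht
    have h5 : d ≤ Fintype.card (Option (OffDiag n)) := by exact_mod_cast hht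
    simp only [Fintype.card_option, Fintype.card_sum, Fintype.card_prod, Fintype.card_fin] at h1 h5
    omega
  have hJ := (finrank_derivationValues_le hlow.1 hlow.2).2 hfull
  have hT : degT n k ∈ Q := hQ none
  rw [Fintype.linearIndependent_iff]
  intro c hc
  rw [Fintype.sum_option] at hc
  let c' : Fin n → Fin n → K := fun i j => if h : i ≠ j then c (some ⟨(i, j), h⟩) else 0
  have hc' : ∀ p : OffDiag n, c (some p) = c' p.1.1 p.1.2 := fun p => by
    simp only [c']; rw [dif_pos p.2]
  let P : Matrix (Fin n) (Fin n) K := Matrix.of fun a b => if b < a then c' b a else 0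
  let R : Matrix (Fin n) (Fin n) K := Matrix.of fun a b => if a < b then -c' b a else 0
  have key : ∀ v : Option ((Fin n × Fin n) ⊕ (Fin n × Fin n)) → K, v none = 0 →
      (P * dirMatrix v (degX n k * degY n k)).trace
        + (R * dirMatrix v (degY n k * degX n k)).trace = 0 := by
    intro v hv
    have hvT : v ⬝ᵥ gradientAt K (degT n k) = 0 := by
      rw [degT, dotProduct_gradientAt_X, hv]
    have h1 := congrArg (fun u => v ⬝ᵥ u) hc
    simp only [degFamily, dotProduct_add, dotProduct_smul, hvT, smul_zero, zero_add,
      dotProduct_sum, dotProduct_zero, hc'] at h1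
    have h2 : ∀ i j, P j i * dirMatrix v (degX n k * degY n k) i j
        + R j i * dirMatrix v (degY n k * degX n k) i j =
        if i ≠ j then c' i j • (v ⬝ᵥ gradientAt K (degEq n k i j)) else 0 := by
      intro i j
      rcases lt_trichotomy i j with h | rfl | h
      · obtain ⟨b, hb⟩ := degEq_of_lt (k := k) h
        rw [hb, gradientAt_sub, gradientAt_mul_of_mem K Q hT, dotProduct_sub, dotProduct_smul, hvT]
        simp [P, R, h, h.ne, h.le, dirMatrix]
      · simp [P, R]
      · obtain ⟨b, hb⟩ := degEq_of_gt (k := k) h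
        rw [hb, gradientAt_sub, gradientAt_mul_of_mem K Q hT, dotProduct_sub, dotProduct_smul, hvT]
        simp [P, R, h, h.ne', h.le, dirMatrix]
    rw [← h1, Matrix.trace, Matrix.trace, ← Finset.sum_add_distrib]
    simp only [Matrix.diag_apply, Matrix.mul_apply, ← Finset.sum_add_distrib]
    rw [Finset.sum_comm]
    simp only [h2]
    rw [← Finset.sum_product', Finset.univ_product_univ, ← Finset.sum_filter]
    exact (Finset.sum_subtype _ (by simp) fun p : Fin n × Fin n =>
      c' p.1 p.2 • (v ⬝ᵥ gradientAt K (degEq n k p.1 p.2)))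
  have hPR : y * P + R * y = 0 ∧ P * x + x * R = 0 := by
    have hXY : ∀ A B : Matrix (Fin n) (Fin n) K,
        (P * (A * y + x * B)).trace + (R * (B * x + y * A)).trace = 0 := by
      intro A B
      let v : Option ((Fin n × Fin n) ⊕ (Fin n × Fin n)) → K := fun s =>
        s.elim 0 (Sum.elim (fun p => A p.1 p.2) (fun p => B p.1 p.2))
      have h1 : dirMatrix v (degX n k) = A := by
        ext i j; exact dotProduct_gradientAt_X v _
      have h2 : dirMatrix v (degY n k) = B := by
        ext i j; exact dotProduct_gradientAt_X v _
      have h3 := key v rfl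
      rwa [dirMatrix_mul, dirMatrix_mul, h1, h2] at h3
    constructor
    · rw [Matrix.ext_iff_trace_mul_left]
      intro A
      have h := hXY A 0
      rw [mul_zero, add_zero, zero_mul, zero_add, Matrix.trace_mul_comm, mul_assoc,
        Matrix.trace_mul_comm R, mul_assoc] at h
      rw [mul_zero, Matrix.trace_zero, mul_add, Matrix.trace_add, ← h]
      congr 1
      rw [← mul_assoc A R, Matrix.trace_mul_comm (A * R)]
    · rw [Matrix.ext_iff_trace_mul_left]
      intro B
      have h := hXY 0 B
      rw [mul_zero, add_zero, zero_mul, zero_add] at h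
      rw [mul_zero, Matrix.trace_zero, mul_add, Matrix.trace_add, ← h, Matrix.trace_mul_comm B,
        mul_assoc, Matrix.trace_mul_comm R, ← mul_assoc B]
  obtain ⟨hP0, hR0⟩ := hJ P R (fun i j h => by simp [P, h.le]) (fun i => by simp [P])
    (fun i j h => by simp [R, h.le]) (fun i => by simp [R]) hPR.2 hPR.1
  have hc0 : ∀ p : OffDiag n, c (some p) = 0 := by
    rintro ⟨⟨i, j⟩, hij⟩
    rw [hc']
    rcases lt_or_gt_of_ne hij with h | h
    · simpa [P, h] using congrFun (congrFun hP0 j) i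
    · simpa [R, h] using congrFun (congrFun hR0 j) i
  rintro (_ | p)
  · simp only [hc0, zero_smul, Finset.sum_const_zero, add_zero] at hc
    have h1 := congrArg (fun u => (Pi.single none 1 : _ → K) ⬝ᵥ u) hc
    simp only [dotProduct_smul, dotProduct_zero] at h1
    rw [show degFamily n k none = X none from rfl, dotProduct_gradientAt_X] at h1
    simpa using h1
  · exact hc0 p

end Degeneration

section WeightedDescent

open MvPolynomial

variable {σ τ k : Type*} [Field k]

attribute [local instance] MvPolynomial.weightedGradedAlgebra

/-- An ideal generated by weighted homogeneous polynomials for positive weights is saturated, on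
weighted homogeneous polynomials, with respect to polynomials not vanishing at the origin. -/
lemma mem_span_of_mul_mem_of_isWeightedHomogeneous {w : σ → ℕ} (hw : ∀ i, w i ≠ 0)
    {G : Set (MvPolynomial σ k)} (hG : ∀ g ∈ G, ∃ d, IsWeightedHomogeneous w g d)
    {s b : MvPolynomial σ k} {e : ℕ} (hb : IsWeightedHomogeneous w b e)
    (hs : constantCoeff s ≠ 0) (h : s * b ∈ Ideal.span G) : b ∈ Ideal.span G := by
  have hhom : (Ideal.span G).IsHomogeneous (weightedHomogeneousSubmodule k w) :=
    Ideal.homogeneous_span _ _ fun g hg => (hG g hg).imp fun d hd => hd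
  have h1 := hhom (0 + e) h
  rw [DirectSum.coe_decompose_mul_add_of_right_mem _ hb] at h1
  have h2 : (DirectSum.decompose (weightedHomogeneousSubmodule k w) s 0 : MvPolynomial σ k) =
      C (constantCoeff s) := by
    refine (weightedDecomposition.decompose'_apply k w s 0).trans ?_
    rw [weightedHomogeneousComponent_zero _ hw]
    rfl
  rw [h2] at h1
  have h3 := Ideal.mul_mem_left _ (C (constantCoeff s)⁻¹) h1
  rwa [← mul_assoc, ← C_mul, inv_mul_cancel₀ hs, C_1, one_mul] at h3

/-- An algebra map sending all variables to weighted homogeneous polynomials of degree `m`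
multiplies degrees by `m`. -/
lemma isWeightedHomogeneous_aeval {w : σ → ℕ} {m : ℕ} {g : τ → MvPolynomial σ k}
    (hg : ∀ i, IsWeightedHomogeneous w (g i) m) {a : MvPolynomial τ k} {d : ℕ}
    (ha : IsWeightedHomogeneous (fun _ => 1) a d) :
    IsWeightedHomogeneous w (aeval g a) (d * m) := by
  rw [aeval_def, eval₂_eq]
  refine IsWeightedHomogeneous.sum _ _ _ fun c hc => ?_
  refine IsWeightedHomogeneous.C_mul ?_ _
  have h1 : d * m = ∑ i ∈ c.support, c i • m := by
    rw [← ha (mem_support_iff.mp hc), Finsupp.weight_apply, Finsupp.sum, Finset.sum_mul]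
    simp
  rw [h1]
  exact IsWeightedHomogeneous.prod _ _ _ fun i _ => (hg i).pow _

lemma isRadical_of_isWeightedHomogeneous {w : τ → ℕ} {G : Set (MvPolynomial τ k)}
    (hG : ∀ g ∈ G, ∃ d, IsWeightedHomogeneous w g d)
    (h : ∀ a ∈ (Ideal.span G).radical, ∀ d, IsWeightedHomogeneous w a d → a ∈ Ideal.span G) :
    (Ideal.span G).IsRadical := by
  have hhom : (Ideal.span G).IsHomogeneous (weightedHomogeneousSubmodule k w) :=
    Ideal.homogeneous_span _ _ fun g hg => (hG g hg).imp fun d hd => hd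
  intro a ha
  rw [mem_iff_weightedHomogeneousComponent_mem k w hhom]
  intro d
  refine h _ ?_ d (weightedHomogeneousComponent_isWeightedHomogeneous d a)
  exact weightedHomogeneousComponent_mem_of_mem k w hhom.radical ha d

end WeightedDescent

section DegenerateIdeal

open MvPolynomial

variable (n : ℕ) (k : Type) [Field k]

/-- The degenerate equations. -/
def degSet : Set (DegRing n k) := Set.range fun p : OffDiag n => degEq n k p.1.1 p.1.2

variable {n k}

lemma constantCoeff_degEq (i j : Fin n) : constantCoeff (degEq n k i j) = 0 := by
  simp [degEq, degX, degY, Matrix.mul_apply]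

lemma exists_mul_mem_span_degSet {a : DegRing n k} (ha : a ∈ (Ideal.span (degSet n k)).radical) :
    ∃ s : DegRing n k, constantCoeff s ≠ 0 ∧ s * a ∈ Ideal.span (degSet n k) := by
  classical
  let l : List (DegRing n k) :=
    (Finset.univ : Finset (OffDiag n)).toList.map fun p => degEq n k p.1.1 p.1.2
  have hl : Ideal.ofList l = Ideal.span (degSet n k) := by
    rw [Ideal.ofList]
    congr 1
    ext f
    simp [l, degSet]
  have hlt : Ideal.ofList (l ++ [degT n k]) = Ideal.span (Set.range (degFamily n k)) := by
    rw [Ideal.ofList]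
    congr 1
    ext f
    simp only [List.mem_append, List.mem_singleton, Set.mem_ofPred_eq, Set.mem_range, Option.exists,
      degFamily, l, List.mem_map, Finset.mem_toList, Finset.mem_univ, true_and]
    rw [or_comm, eq_comm (a := f)]
  have hlen : (l ++ [degT n k]).length = Fintype.card (Option (OffDiag n)) := by
    simp [l]
  have hmem (p : Ideal (DegRing n k)) (hp : Ideal.ofList (l ++ [degT n k]) ≤ p) :
      ∀ i, degFamily n k i ∈ p := fun i =>
    hp (hlt ▸ Ideal.subset_span (Set.mem_range_self i))
  have : (RingHom.ker (constantCoeff : DegRing n k →+* k)).IsPrime := RingHom.ker_isPrime _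
  obtain ⟨s, hs, h⟩ := exists_mul_mem_ofList (RingHom.ker (constantCoeff : DegRing n k →+* k))
    (fun i => constantCoeff_X (R := k) i) l (degT n k)
    (by
      intro f hf
      rcases List.mem_append.mp hf with h | h
      · obtain ⟨p, -, rfl⟩ := List.mem_map.mp h
        exact constantCoeff_degEq _ _
      · rw [List.mem_singleton.mp h]
        exact constantCoeff_X (R := k) _)
    (by
      intro p hp hle
      rw [hlen]
      exact card_le_height_of_degFamily_mem p (hmem p hle))
    (by
      intro p hp hle hht
      rw [hlen] at hht
      rw [hlt]
      exact exists_mul_mem_span_of_gradientAt p.ResidueField p (degFamily n k) (hmem p hle) hht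
        (linearIndependent_gradientAt_degFamily p (hmem p hle) hht))
    a (by rwa [hl])
  exact ⟨s, hs, hl ▸ h⟩

/-- Positive weights for which the degenerate equations are homogeneous. -/
def degWeight (n : ℕ) : Option ((Fin n × Fin n) ⊕ (Fin n × Fin n)) → ℕ
  | none => 1
  | some (Sum.inl (i, _)) => n - i
  | some (Sum.inr (_, j)) => j + 1

lemma degWeight_ne_zero (s : Option ((Fin n × Fin n) ⊕ (Fin n × Fin n))) : degWeight n s ≠ 0 := by
  rcases s with _ | ⟨i, j⟩ | ⟨i, j⟩ <;> simp only [degWeight] <;> omega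

lemma isWeightedHomogeneous_degT : IsWeightedHomogeneous (degWeight n) (degT n k) 1 :=
  isWeightedHomogeneous_X k _ _

lemma isWeightedHomogeneous_degX (i j : Fin n) :
    IsWeightedHomogeneous (degWeight n) (degX n k i j) (n - i) :=
  isWeightedHomogeneous_X k _ _

lemma isWeightedHomogeneous_degY (i j : Fin n) :
    IsWeightedHomogeneous (degWeight n) (degY n k i j) (j + 1) :=
  isWeightedHomogeneous_X k _ _

lemma isWeightedHomogeneous_degEq (i j : Fin n) :
    IsWeightedHomogeneous (degWeight n) (degEq n k i j) (n + 1 + (j.1 - i.1)) := by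
  have h1 : IsWeightedHomogeneous (degWeight n) ((degX n k * degY n k) i j) (n - i + (j + 1)) := by
    rw [Matrix.mul_apply]
    exact IsWeightedHomogeneous.sum _ _ _ fun a _ =>
      (isWeightedHomogeneous_degX i a).mul (isWeightedHomogeneous_degY a j)
  have h2 : IsWeightedHomogeneous (degWeight n) ((degY n k * degX n k) i j) (n + 1) := by
    rw [Matrix.mul_apply]
    refine IsWeightedHomogeneous.sum _ _ _ fun a _ => ?_
    have h := (isWeightedHomogeneous_degY (k := k) i a).mul (isWeightedHomogeneous_degX a j)
    rwa [show a.1 + 1 + (n - a.1) = n + 1 by omega] at h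
  have h3 := (isWeightedHomogeneous_degT.pow (i.1 - j.1)).mul h1
  have h4 := (isWeightedHomogeneous_degT.pow (j.1 - i.1)).mul h2
  rw [show (i.1 - j.1) • 1 + (n - i.1 + (j.1 + 1)) = n + 1 + (j.1 - i.1) by
    rw [smul_eq_mul]; omega] at h3
  rw [show (j.1 - i.1) • 1 + (n + 1) = n + 1 + (j.1 - i.1) by rw [smul_eq_mul]; omega] at h4
  exact (weightedHomogeneousSubmodule k (degWeight n) _).sub_mem h3 h4

lemma mem_span_degSet_of_mem_radical {a : DegRing n k} {d : ℕ}
    (ha : a ∈ (Ideal.span (degSet n k)).radical) (hd : IsWeightedHomogeneous (degWeight n) a d) :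
    a ∈ Ideal.span (degSet n k) := by
  obtain ⟨s, hs, h⟩ := exists_mul_mem_span_degSet ha
  refine mem_span_of_mul_mem_of_isWeightedHomogeneous degWeight_ne_zero ?_ hd hs h
  rintro _ ⟨p, rfl⟩
  exact ⟨_, isWeightedHomogeneous_degEq _ _⟩

end DegenerateIdeal

section CommutatorIdeal

open MvPolynomial

/-- The off-diagonal entries of the commutator. -/
def commSet (n : ℕ) : Set (PolyRing n) :=
  {f | ∃ i j : Fin n, i ≠ j ∧ f = (Xgen n * Ygen n - Ygen n * Xgen n) i j}

variable {n : ℕ}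

/-- Conjugation by the one-parameter subgroup `diag(t^i)`, up to powers of `t`. -/
def homogenization (n : ℕ) : PolyRing n →ₐ[ℂ] DegRing n ℂ :=
  aeval (Sum.elim (fun p => degT n ℂ ^ p.1.1 * degX n ℂ p.1 p.2)
    (fun p => degT n ℂ ^ (n - 1 - p.2.1) * degY n ℂ p.1 p.2))

/-- The specialization `t = 1`. -/
def specialization (n : ℕ) : DegRing n ℂ →ₐ[ℂ] PolyRing n :=
  aeval fun s => s.elim 1 X

lemma specialization_degT : specialization n (degT n ℂ) = 1 := by
  simp [specialization, degT]

lemma specialization_degX (i j : Fin n) : specialization n (degX n ℂ i j) = Xgen n i j := by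
  simp [specialization, degX, Xgen]

lemma specialization_degY (i j : Fin n) : specialization n (degY n ℂ i j) = Ygen n i j := by
  simp [specialization, degY, Ygen]

lemma specialization_degEq (i j : Fin n) :
    specialization n (degEq n ℂ i j) = (Xgen n * Ygen n - Ygen n * Xgen n) i j := by
  simp [degEq, Matrix.mul_apply, specialization_degT, specialization_degX, specialization_degY]

lemma homogenization_Xgen (i j : Fin n) :
    homogenization n (Xgen n i j) = degT n ℂ ^ i.1 * degX n ℂ i j := by
  simp [homogenization, Xgen]

lemma homogenization_Ygen (i j : Fin n) :
    homogenization n (Ygen n i j) = degT n ℂ ^ (n - 1 - j.1) * degY n ℂ i j := by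
  simp [homogenization, Ygen]

lemma specialization_homogenization (a : PolyRing n) :
    specialization n (homogenization n a) = a := by
  have h : (specialization n).comp (homogenization n) = AlgHom.id ℂ _ := by
    refine MvPolynomial.algHom_ext ?_
    rintro (⟨i, j⟩ | ⟨i, j⟩)
    · simp [homogenization, specialization_degT, specialization_degX, Xgen]
    · simp [homogenization, specialization_degT, specialization_degY, Ygen]
  exact DFunLike.congr_fun h a

lemma homogenization_comm (i j : Fin n) :
    homogenization n ((Xgen n * Ygen n - Ygen n * Xgen n) i j) =
      degT n ℂ ^ (n - 1 - (j.1 - i.1)) * degEq n ℂ i j := by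
  have h1 : homogenization n ((Xgen n * Ygen n) i j) =
      degT n ℂ ^ (n - 1 - (j.1 - i.1)) * (degT n ℂ ^ (i.1 - j.1) *
        (degX n ℂ * degY n ℂ) i j) := by
    rw [← mul_assoc, ← pow_add, Matrix.mul_apply, Matrix.mul_apply, map_sum, Finset.mul_sum]
    refine Finset.sum_congr rfl fun a _ => ?_
    rw [map_mul, homogenization_Xgen, homogenization_Ygen,
      show n - 1 - (j.1 - i.1) + (i.1 - j.1) = i.1 + (n - 1 - j.1) by omega, pow_add]
    ring
  have h2 : homogenization n ((Ygen n * Xgen n) i j) =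
      degT n ℂ ^ (n - 1 - (j.1 - i.1)) * (degT n ℂ ^ (j.1 - i.1) *
        (degY n ℂ * degX n ℂ) i j) := by
    rw [← mul_assoc, ← pow_add, Matrix.mul_apply, Matrix.mul_apply, map_sum, Finset.mul_sum]
    refine Finset.sum_congr rfl fun a _ => ?_
    rw [map_mul, homogenization_Xgen, homogenization_Ygen,
      show n - 1 - (j.1 - i.1) + (j.1 - i.1) = (n - 1 - a.1) + a.1 by omega, pow_add]
    ring
  rw [Matrix.sub_apply, map_sub, h1, h2, degEq, mul_sub]

lemma isWeightedHomogeneous_homogenization {a : PolyRing n} {d : ℕ}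
    (ha : IsWeightedHomogeneous (fun _ => 1) a d) :
    IsWeightedHomogeneous (degWeight n) (homogenization n a) (d * n) := by
  refine isWeightedHomogeneous_aeval ?_ ha
  rintro (⟨i, j⟩ | ⟨i, j⟩)
  · have h := (isWeightedHomogeneous_degT (k := ℂ).pow i.1).mul (isWeightedHomogeneous_degX i j)
    rwa [show i.1 • 1 + (n - i.1) = n by rw [smul_eq_mul]; omega] at h
  · have h := (isWeightedHomogeneous_degT (k := ℂ).pow (n - 1 - j.1)).mul
      (isWeightedHomogeneous_degY i j)
    rwa [show (n - 1 - j.1) • 1 + (j.1 + 1) = n by rw [smul_eq_mul]; omega] at h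

lemma isHomogeneous_comm (i j : Fin n) :
    IsWeightedHomogeneous (fun _ => 1) ((Xgen n * Ygen n - Ygen n * Xgen n) i j) 2 := by
  rw [Matrix.sub_apply, Matrix.mul_apply, Matrix.mul_apply]
  refine (weightedHomogeneousSubmodule ℂ _ 2).sub_mem
    (IsWeightedHomogeneous.sum _ _ _ fun a _ => ?_) (IsWeightedHomogeneous.sum _ _ _ fun a _ => ?_)
  · exact (isWeightedHomogeneous_X ℂ _ _).mul (isWeightedHomogeneous_X ℂ _ _)
  · exact (isWeightedHomogeneous_X ℂ _ _).mul (isWeightedHomogeneous_X ℂ _ _)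

lemma map_homogenization_le :
    Ideal.map (homogenization n) (Ideal.span (commSet n)) ≤ Ideal.span (degSet n ℂ) := by
  rw [Ideal.map_span, Ideal.span_le]
  rintro _ ⟨_, ⟨i, j, hij, rfl⟩, rfl⟩
  rw [homogenization_comm]
  exact Ideal.mul_mem_left _ _ (Ideal.subset_span ⟨⟨(i, j), hij⟩, rfl⟩)

lemma map_specialization_le :
    Ideal.map (specialization n) (Ideal.span (degSet n ℂ)) ≤ Ideal.span (commSet n) := by
  rw [Ideal.map_span, Ideal.span_le]
  rintro _ ⟨_, ⟨p, rfl⟩, rfl⟩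
  exact Ideal.subset_span ⟨p.1.1, p.1.2, p.2, specialization_degEq _ _⟩

lemma isRadical_span_commSet (n : ℕ) : (Ideal.span (commSet n)).IsRadical := by
  refine isRadical_of_isWeightedHomogeneous (w := fun _ => 1) ?_ ?_
  · rintro _ ⟨i, j, -, rfl⟩
    exact ⟨2, isHomogeneous_comm i j⟩
  · intro a ⟨m, ha⟩ d hd
    have h1 : homogenization n a ∈ (Ideal.span (degSet n ℂ)).radical := by
      refine ⟨m, ?_⟩
      rw [← map_pow]
      exact map_homogenization_le (Ideal.mem_map_of_mem _ ha)
    have h2 := mem_span_degSet_of_mem_radical h1 (isWeightedHomogeneous_homogenization hd)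
    rw [← specialization_homogenization a]
    exact map_specialization_le (Ideal.mem_map_of_mem _ h2)

end CommutatorIdeal

/-- The ideal `I` is a radical ideal of `R`. -/
theorem stmt0 (n : ℕ) (hn : 1 ≤ n) : (diagCommIdeal n).IsRadical := isRadical_span_commSet n
end
end

section
/- The quotient ring R/I has Krull dimension n² + n; that is, the diagonal commutator scheme D is a complete intersection, cut out by n² − n equations in the 2n²-dimensional affine space of pairs of matrices. -/
noncomputable section

open MvPolynomial in
/-- `S` is covered by finitely many images of polynomial maps from `ℂ^d`. -/
def PolynomiallyCovered {σ : Type*} (d : ℕ) (S : Set (σ → ℂ)) : Prop :=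
  ∃ F : Set (σ → MvPolynomial (Fin d) ℂ), F.Finite ∧
    ∀ s ∈ S, ∃ φ ∈ F, ∃ t : Fin d → ℂ, ∀ i, s i = eval t (φ i)

namespace PolynomiallyCovered

open MvPolynomial

variable {σ τ : Type*}

lemma iUnion {ι : Type*} [Finite ι] {d : ℕ} {T : Set (τ → ℂ)} (S : ι → Set (τ → ℂ))
    (hS : ∀ j, PolynomiallyCovered d (S j)) (hT : ∀ v ∈ T, ∃ j, v ∈ S j) :
    PolynomiallyCovered d T := by
  choose F hF hFS using hS
  refine ⟨⋃ j, F j, Set.finite_iUnion hF, fun v hv => ?_⟩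
  obtain ⟨j, hj⟩ := hT v hv
  obtain ⟨φ, hφ, t, ht⟩ := hFS j v hj
  exact ⟨φ, Set.mem_iUnion.2 ⟨j, hφ⟩, t, ht⟩

/-- The image of `S × ℂ^κ` under a polynomial map needs at most `#κ` parameters more than `S`. -/
lemma of_image {κ : Type*} [Fintype κ] {d d' : ℕ} {S : Set (σ → ℂ)} {T : Set (τ → ℂ)}
    (hS : PolynomiallyCovered d S) (g : τ → MvPolynomial (σ ⊕ κ) ℂ)
    (hd : d + Fintype.card κ ≤ d')
    (hT : ∀ v ∈ T, ∃ s ∈ S, ∃ u : κ → ℂ, ∀ i, v i = eval (Sum.elim s u) (g i)) :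
    PolynomiallyCovered d' T := by
  obtain ⟨F, hF, hFS⟩ := hS
  obtain ⟨e⟩ : Nonempty (Fin d ⊕ κ ↪ Fin d') :=
    Function.Embedding.nonempty_of_card_le (by simpa using hd)
  refine ⟨(fun φ i => aeval (Sum.elim (fun a => rename (e ∘ Sum.inl) (φ a))
    (fun k => X (e (Sum.inr k)))) (g i)) '' F, hF.image _, fun v hv => ?_⟩
  obtain ⟨s, hs, u, hu⟩ := hT v hv
  obtain ⟨φ, hφ, t, ht⟩ := hFS s hs
  refine ⟨_, ⟨φ, hφ, rfl⟩, Function.extend e (Sum.elim t u) 0, fun i => ?_⟩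
  have he : ∀ z, Function.extend e (Sum.elim t u) 0 (e z) = Sum.elim t u z :=
    fun z => e.injective.extend_apply _ _ z
  rw [hu i, ← coe_aeval_eq_eval, ← coe_aeval_eq_eval]
  change _ = aeval _ (aeval _ (g i))
  rw [← AlgHom.comp_apply, comp_aeval]
  change aeval _ (g i) = _
  congr 2
  ext z
  rcases z with a | k
  · have : Function.extend e (Sum.elim t u) 0 ∘ e ∘ Sum.inl = t := by
      ext z; simp [he]
    simp [aeval_rename, this, ht, aeval_eq_eval]
  · simp [he]

lemma mono {d d' : ℕ} {S : Set (σ → ℂ)} (hS : PolynomiallyCovered d S) (h : d ≤ d') :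
    PolynomiallyCovered d' S :=
  hS.of_image (κ := Empty) (fun i => X (Sum.inl i)) (by simpa using h)
    fun v hv => ⟨v, hv, Empty.elim, by simp⟩

end PolynomiallyCovered

/-- Pairs `(X, Y)` of an `m × n` and an `n × m` matrix with `XY` lower and `YX` upper
triangular. -/
def lowerUpperSet (m n : ℕ) : Set ((Fin m × Fin n) ⊕ (Fin n × Fin m) → ℂ) :=
  {v | (∀ i j, i < j → ∑ k, v (Sum.inl (i, k)) * v (Sum.inr (k, j)) = 0) ∧
    (∀ i j, j < i → ∑ k, v (Sum.inr (i, k)) * v (Sum.inl (k, j)) = 0)}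

lemma polynomiallyCovered_lowerUpperSet_firstRow_eq_zero {m n d : ℕ}
    (h : PolynomiallyCovered d (lowerUpperSet m n)) :
    PolynomiallyCovered (d + n)
      {v ∈ lowerUpperSet (m + 1) n | ∀ j, v (Sum.inl (0, j)) = 0} := by
  refine h.of_image (κ := Fin n) (Sum.elim
    (fun q => Fin.cases 0 (fun i => MvPolynomial.X (Sum.inl (Sum.inl (i, q.2)))) q.1)
    (fun q => Fin.cases (MvPolynomial.X (Sum.inr q.1))
      (fun j => MvPolynomial.X (Sum.inl (Sum.inr (q.1, j)))) q.2)) (by simp) ?_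
  rintro v ⟨⟨hl, hu⟩, h0⟩
  refine ⟨Sum.elim (fun q => v (Sum.inl (q.1.succ, q.2)))
    (fun q => v (Sum.inr (q.1, q.2.succ))), ⟨?_, ?_⟩, fun k => v (Sum.inr (k, 0)), ?_⟩
  · intro i j hij
    simpa using hl i.succ j.succ (Fin.succ_lt_succ_iff.2 hij)
  · intro i j hij
    simpa [Fin.sum_univ_succ, h0] using hu i j hij
  · rintro (⟨i, j⟩ | ⟨i, j⟩)
    · cases i using Fin.cases <;> simp [h0]
    · cases j using Fin.cases <;> simp

lemma polynomiallyCovered_lowerUpperSet_pivot {m n d : ℕ} (p : Fin (n + 1))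
    (h : PolynomiallyCovered d (lowerUpperSet m n)) :
    PolynomiallyCovered (d + (m + n + 2))
      {v ∈ lowerUpperSet (m + 1) (n + 1) | v (Sum.inl (0, p)) ≠ 0 ∧
        ∀ j < p, v (Sum.inl (0, j)) = 0} := by
  let A := MvPolynomial (((Fin m × Fin n) ⊕ (Fin n × Fin m)) ⊕ (Unit ⊕ Fin m ⊕ Fin (n + 1))) ℂ
  let w : A := MvPolynomial.X (Sum.inr (Sum.inl ()))
  let β : Fin m → A := fun i => MvPolynomial.X (Sum.inr (Sum.inr (Sum.inl i)))
  let u : Fin (n + 1) → A := fun i => MvPolynomial.X (Sum.inr (Sum.inr (Sum.inr i)))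
  let x : Fin m → Fin n → A := fun i j => MvPolynomial.X (Sum.inl (Sum.inl (i, j)))
  let y : Fin n → Fin m → A := fun i j => MvPolynomial.X (Sum.inl (Sum.inr (i, j)))
  let γ : Fin (n + 1) → A := fun j => if p < j then u j else if j = p then 1 else 0
  let η : Fin (n + 1) → A := fun i => if i ≤ p then u i else 0
  let y₀ : Fin n → A := fun k => η (p.succAbove k) - ∑ i, β i * y k i
  refine h.of_image (κ := Unit ⊕ Fin m ⊕ Fin (n + 1)) (Sum.elim
    (fun q => Fin.cases (w * γ q.2)
      (fun i => β i * w * γ q.2 + p.insertNth (α := fun _ => A) 0 (x i) q.2) q.1)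
    (fun q => Fin.cases
      (p.insertNth (α := fun _ => A) (η p - ∑ k, γ (p.succAbove k) * y₀ k) y₀ q.1)
      (fun j => p.insertNth (α := fun _ => A) (-∑ k, γ (p.succAbove k) * y k j)
        (fun k => y k j) q.1) q.2))
    (by simp; omega) ?_
  rintro v ⟨⟨hl, hu⟩, hp, h0⟩
  have hl0 : ∀ j : Fin m, v (Sum.inl (0, p)) * v (Sum.inr (p, j.succ)) +
      ∑ k, v (Sum.inl (0, p.succAbove k)) * v (Sum.inr (p.succAbove k, j.succ)) = 0 := by
    intro j
    rw [← hl 0 j.succ (Fin.succ_pos j), Fin.sum_univ_succAbove _ p]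
  have hls : ∀ i j : Fin m, i < j → v (Sum.inl (i.succ, p)) * v (Sum.inr (p, j.succ)) +
      ∑ k, v (Sum.inl (i.succ, p.succAbove k)) * v (Sum.inr (p.succAbove k, j.succ)) = 0 := by
    intro i j hij
    rw [← hl i.succ j.succ (Fin.succ_lt_succ_iff.2 hij), Fin.sum_univ_succAbove _ p]
  simp only [Fin.sum_univ_succ] at hu
  set W := v (Sum.inl (0, p)) with hW
  let B : Fin m → ℂ := fun i => v (Sum.inl (i.succ, p)) / W
  have hB : ∀ i, v (Sum.inl (i.succ, p)) = B i * W := fun i => by simp [B, hp]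
  have hcol : ∀ i, p < i →
      v (Sum.inr (i, 0)) + ∑ k : Fin m, B k * v (Sum.inr (i, k.succ)) = 0 := by
    intro i hi
    have := hu i p hi
    simp only [hB, ← hW] at this
    refine (mul_eq_zero.1 ?_).resolve_right hp
    rw [← this, add_mul, Finset.sum_mul]
    congr 1
    exact Finset.sum_congr rfl fun k _ => by ring
  let G : Fin (n + 1) → ℂ := fun j => v (Sum.inl (0, j)) / W
  have hG : ∀ j, v (Sum.inl (0, j)) = W * G j := fun j => by simp [G, hp, mul_div_cancel₀]
  let N : Fin n → ℂ := fun k => v (Sum.inr (p.succAbove k, 0)) +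
    ∑ i : Fin m, B i * v (Sum.inr (p.succAbove k, i.succ))
  let Np : ℂ := v (Sum.inr (p, 0)) + ∑ k, G (p.succAbove k) * v (Sum.inr (p.succAbove k, 0))
  let U : Fin (n + 1) → ℂ := fun i => if p < i then G i else
    p.insertNth (α := fun _ => ℂ) Np N i
  refine ⟨Sum.elim
      (fun q => v (Sum.inl (q.1.succ, p.succAbove q.2)) - B q.1 * v (Sum.inl (0, p.succAbove q.2)))
      (fun q => v (Sum.inr (p.succAbove q.1, q.2.succ))), ⟨?_, ?_⟩,
      Sum.elim (fun _ => W) (Sum.elim B U), ?_⟩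
  · intro i j hij
    have h1 := hl0 j
    have h2 := hls i j hij
    rw [hB] at h2
    simp only [Sum.elim_inl, Sum.elim_inr, sub_mul, Finset.sum_sub_distrib]
    simp only [mul_assoc, ← Finset.mul_sum]
    linear_combination h2 - B i * h1
  · intro k l hkl
    have hkl' : p.succAbove l < p.succAbove k := Fin.strictMono_succAbove p hkl
    simp only [Sum.elim_inl, Sum.elim_inr, mul_sub, Finset.sum_sub_distrib]
    have h1 := hu _ _ hkl'
    rcases lt_or_gt_of_ne (Fin.succAbove_ne p l) with hlp | hlp
    · simpa [h0 _ hlp] using h1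
    · have h2 := hcol _ (hlp.trans hkl')
      have h3 : ∑ i : Fin m, v (Sum.inr (p.succAbove k, i.succ)) *
          (B i * v (Sum.inl (0, p.succAbove l))) =
          v (Sum.inl (0, p.succAbove l)) * ∑ i, B i * v (Sum.inr (p.succAbove k, i.succ)) := by
        rw [Finset.mul_sum]
        exact Finset.sum_congr rfl fun i _ => by ring
      rw [h3]
      linear_combination h1 - v (Sum.inl (0, p.succAbove l)) * h2
  · set S := Sum.elim (Sum.elim
      (fun q : Fin m × Fin n =>
        v (Sum.inl (q.1.succ, p.succAbove q.2)) - B q.1 * v (Sum.inl (0, p.succAbove q.2)))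
      (fun q : Fin n × Fin m => v (Sum.inr (p.succAbove q.1, q.2.succ))))
      (Sum.elim (fun _ : Unit => W) (Sum.elim B U)) with hS
    have ew : MvPolynomial.eval S w = W := by simp [w, S]
    have eβ : ∀ i, MvPolynomial.eval S (β i) = B i := fun i => by simp [β, S]
    have ex : ∀ i j, MvPolynomial.eval S (x i j) =
        v (Sum.inl (i.succ, p.succAbove j)) - B i * v (Sum.inl (0, p.succAbove j)) :=
      fun i j => by simp [x, S]
    have ey : ∀ i j, MvPolynomial.eval S (y i j) = v (Sum.inr (p.succAbove i, j.succ)) :=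
      fun i j => by simp [y, S]
    have eγ : ∀ j, MvPolynomial.eval S (γ j) = G j := by
      intro j
      rcases lt_trichotomy j p with hj | rfl | hj
      · simp [γ, hj.not_gt, hj.ne, G, h0 _ hj]
      · simp [γ, G, hp, ← hW]
      · simp [γ, hj, u, S, U]
    have eη : ∀ k, MvPolynomial.eval S (η (p.succAbove k)) = N k := by
      intro k
      rcases lt_or_gt_of_ne (Fin.succAbove_ne p k) with hk | hk
      · simp [η, hk.le, u, S, U, hk.not_gt]
      · simp [η, hk.not_ge, N, hcol _ hk]
    have eηp : MvPolynomial.eval S (η p) = Np := by simp [η, u, S, U]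
    have ey₀ : ∀ k, MvPolynomial.eval S (y₀ k) = v (Sum.inr (p.succAbove k, 0)) := by
      intro k
      simp [y₀, eη, eβ, ey, N]
    rintro (⟨i, j⟩ | ⟨i, j⟩)
    · cases i using Fin.cases with
      | zero => simp [ew, eγ, hG j]
      | succ i =>
        cases j using Fin.succAboveCases p with
        | x =>
          have : G p = 1 := by simp [G, hp, ← hW]
          simp [ew, eβ, eγ, hB, this]
        | p j => simp [ew, eβ, eγ, ex, hG]; ring
    · cases j using Fin.cases with
      | zero =>
        cases i using Fin.succAboveCases p with
        | x => simp [eηp, eγ, ey₀, Np]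
        | p i => simp [ey₀]
      | succ j =>
        cases i using Fin.succAboveCases p with
        | x =>
          simp only [Sum.elim_inr, Fin.cases_succ, Fin.insertNth_apply_same, map_neg, map_sum,
            map_mul, eγ, ey]
          have h1 := hl0 j
          simp only [hG, mul_assoc, ← Finset.mul_sum, ← mul_add] at h1
          exact eq_neg_of_add_eq_zero_left ((mul_eq_zero.1 h1).resolve_left hp)
        | p i => simp [ey]

lemma polynomiallyCovered_lowerUpperSet (m n : ℕ) :
    PolynomiallyCovered (m * n + m) (lowerUpperSet m n) := by
  induction m generalizing n with
  | zero => exact ⟨{fun _ => 0}, Set.finite_singleton _, fun s _ => ⟨_, rfl, 0, by simp⟩⟩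
  | succ m ih =>
    rcases n with _ | n
    · exact ⟨{fun _ => 0}, Set.finite_singleton _, fun s _ => ⟨_, rfl, 0, by simp⟩⟩
    refine .iUnion (ι := Option (Fin (n + 1)))
      (fun o => o.elim {v ∈ lowerUpperSet (m + 1) (n + 1) | ∀ j, v (Sum.inl (0, j)) = 0}
        fun p => {v ∈ lowerUpperSet (m + 1) (n + 1) | v (Sum.inl (0, p)) ≠ 0 ∧
          ∀ j < p, v (Sum.inl (0, j)) = 0}) ?_ fun v hv => ?_
    · rintro (_ | p)
      · exact (polynomiallyCovered_lowerUpperSet_firstRow_eq_zero (ih _)).mono (by lia)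
      · exact (polynomiallyCovered_lowerUpperSet_pivot p (ih _)).mono (by lia)
    · by_cases h : ∀ j, v (Sum.inl (0, j)) = 0
      · exact ⟨none, hv, h⟩
      · push Not at h
        obtain ⟨p, hp, hmin⟩ := WellFounded.has_min (wellFounded_lt (α := Fin (n + 1)))
          {j | v (Sum.inl (0, j)) ≠ 0} h
        exact ⟨some p, hv, hp, fun j hj => by_contra fun hne => hmin j hne hj⟩

lemma ringKrullDim_quotient_le_iff {R : Type*} [CommRing R] {J : Ideal R} {d : ℕ} :
    ringKrullDim (R ⧸ J) ≤ d ↔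
      ∀ l : LTSeries (PrimeSpectrum R), J ≤ l.head.asIdeal → l.length ≤ d := by
  rw [ringKrullDim_quotient]
  constructor
  · intro h l hl
    have hmem : ∀ i, l i ∈ PrimeSpectrum.zeroLocus (J : Set R) := fun i =>
      (PrimeSpectrum.mem_zeroLocus _ _).2 (hl.trans (l.head_le i))
    let l' : LTSeries (PrimeSpectrum.zeroLocus (J : Set R)) :=
      LTSeries.mk l.length (fun i => ⟨l i, hmem i⟩) fun _ _ hij => l.strictMono hij
    exact_mod_cast (Order.LTSeries.length_le_krullDim l').trans h
  · intro h
    refine iSup_le fun l => ?_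
    exact_mod_cast h (l.map Subtype.val fun _ _ hab => hab) l.head.2

lemma ringKrullDim_le_of_isIntegral {R S : Type*} [CommRing R] [CommRing S] (f : R →+* S)
    (hf : f.IsIntegral) : ringKrullDim S ≤ ringKrullDim R := by
  algebraize [f]
  exact Order.krullDim_le_of_strictMono (PrimeSpectrum.comap (algebraMap R S))
    fun p q hpq => Ideal.IsIntegral.comap_lt_comap (I := p.asIdeal) (J := q.asIdeal) hpq

lemma ringKrullDim_le_of_injective {d : ℕ} {A : Type} [CommRing A] [Algebra ℂ A]
    [Algebra.FiniteType ℂ A] (f : A →ₐ[ℂ] MvPolynomial (Fin d) ℂ) (hf : Function.Injective f) :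
    ringKrullDim A ≤ d := by
  have : Nontrivial A := f.toRingHom.domain_nontrivial
  obtain ⟨s, g, hg, hgi⟩ := exists_integral_inj_algHom_of_fg ℂ A
  have hs : s ≤ d := by
    have := trdeg_le_of_injective (f.comp g) (hf.comp hg)
    simpa [MvPolynomial.trdeg_of_isDomain] using this
  refine (ringKrullDim_le_of_isIntegral g.toRingHom hgi).trans ?_
  rw [MvPolynomial.ringKrullDim_of_isNoetherianRing]
  simpa using hs

lemma ringKrullDim_quotient_le_of_polynomiallyCovered {σ : Type} [Finite σ] {d : ℕ}
    {J : Ideal (MvPolynomial σ ℂ)} {S : Set (σ → ℂ)} (hS : PolynomiallyCovered d S)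
    (hJ : MvPolynomial.zeroLocus ℂ J ⊆ S) : ringKrullDim (MvPolynomial σ ℂ ⧸ J) ≤ d := by
  obtain ⟨F, hF, hFS⟩ := hS
  rw [ringKrullDim_quotient_le_iff]
  intro l hl
  have hle : hF.toFinset.inf (fun φ => RingHom.ker (MvPolynomial.aeval (R := ℂ) φ)) ≤
      l.head.asIdeal := by
    refine le_trans ?_ (l.head.isPrime.radical_le_iff.2 hl)
    rw [← MvPolynomial.vanishingIdeal_zeroLocus_eq_radical (K := ℂ)]
    intro p hp v hv
    obtain ⟨φ, hφ, t, ht⟩ := hFS v (hJ hv)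
    have hpφ : MvPolynomial.aeval (R := ℂ) φ p = 0 := by
      have := Finset.inf_le (f := fun φ => RingHom.ker (MvPolynomial.aeval (R := ℂ) φ))
        (hF.mem_toFinset.2 hφ) hp
      exact this
    have hv' : v = fun i => MvPolynomial.aeval t (φ i) := by
      ext i; rw [ht i, MvPolynomial.aeval_eq_eval]
    rw [hv', ← MvPolynomial.comp_aeval_apply, hpφ, map_zero]
  obtain ⟨φ, -, hφ⟩ := l.head.isPrime.inf_le'.1 hle
  exact ringKrullDim_quotient_le_iff.1 (ringKrullDim_le_of_injective
    (Ideal.kerLiftAlg (MvPolynomial.aeval (R := ℂ) φ)) (Ideal.kerLiftAlg_injective _)) l hφ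

/-- The ideal generated by the linear forms with coefficient vectors `c k`. -/
def linearIdeal {σ κ : Type*} [Fintype σ] (c : κ → σ → ℂ) : Ideal (MvPolynomial σ ℂ) :=
  Ideal.span (Set.range fun k => Fintype.linearCombination ℂ (MvPolynomial.X (R := ℂ)) (c k))

section LinearSection

open MvPolynomial

variable {σ : Type}

lemma sub_C_constantCoeff_mem_idealOfVars {σ R : Type*} [CommRing R] (f : MvPolynomial σ R) :
    f - C (constantCoeff f) ∈ idealOfVars σ R := by
  rw [← pow_one (idealOfVars σ R), mem_pow_idealOfVars_iff']
  intro x hx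
  obtain rfl : x = 0 := by
    rw [← Finsupp.degree_eq_zero_iff]; lia
  simp [constantCoeff_eq]

lemma eq_idealOfVars_of_le {J : Ideal (MvPolynomial σ ℂ)} (hJ : J ≠ ⊤)
    (h : idealOfVars σ ℂ ≤ J) : J = idealOfVars σ ℂ := by
  refine le_antisymm (fun f hf => ?_) h
  have hC : C (constantCoeff f) ∈ J := by
    simpa using J.sub_mem hf (h (sub_C_constantCoeff_mem_idealOfVars f))
  have h0 : constantCoeff f = 0 := by
    by_contra h0
    exact hJ (J.eq_top_of_isUnit_mem hC ((isUnit_iff_ne_zero.2 h0).map C))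
  simpa [h0] using sub_C_constantCoeff_mem_idealOfVars f

lemma eq_zero_of_forall_smul_mem_zeroLocus {J : Ideal (MvPolynomial σ ℂ)}
    (hJ : ringKrullDim (MvPolynomial σ ℂ ⧸ J) ≤ (0 : ℕ)) {v : σ → ℂ}
    (hv : ∀ s : ℂ, s • v ∈ zeroLocus ℂ J) : v = 0 := by
  by_contra h0
  obtain ⟨i, hi⟩ := Function.ne_iff.1 h0
  let φ : MvPolynomial σ ℂ →ₐ[ℂ] Polynomial ℂ :=
    aeval fun i => Polynomial.C (v i) * Polynomial.X
  have hφ : ∀ s p, Polynomial.aeval s (φ p) = aeval (s • v) p := by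
    intro s p
    rw [comp_aeval_apply]
    refine congrArg (fun w => aeval w p) (funext fun i => ?_)
    simp only [map_mul, Polynomial.aeval_C, Polynomial.aeval_X, Pi.smul_apply, smul_eq_mul,
      Algebra.algebraMap_self, RingHom.id_apply]
    ring
  let P : PrimeSpectrum (MvPolynomial σ ℂ) := ⟨RingHom.ker φ, RingHom.ker_isPrime _⟩
  let Q : PrimeSpectrum (MvPolynomial σ ℂ) :=
    ⟨RingHom.ker ((Polynomial.aeval (0 : ℂ)).comp φ), RingHom.ker_isPrime _⟩
  have hPQ : P < Q := by
    refine lt_of_le_of_ne (fun p (hp : φ p = 0) => ?_) fun he => ?_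
    · change Polynomial.aeval (0 : ℂ) (φ p) = 0
      rw [hp, map_zero]
    · have hX : X i ∈ Q.asIdeal := by
        change Polynomial.aeval (0 : ℂ) (φ (X i)) = 0
        simp [hφ]
      rw [← he] at hX
      have : φ (X i) = 0 := hX
      simp [φ] at this
      exact hi this
  have := ringKrullDim_quotient_le_iff.1 hJ ((RelSeries.singleton _ Q).cons P hPQ)
    fun p hp => Polynomial.funext fun s => by
      simpa [Polynomial.aeval_def, Polynomial.eval₂_eq_eval_map] using
        (hφ s p).trans (hv s p hp)
  exact Nat.not_succ_le_zero _ this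

variable [Fintype σ]

lemma exists_linearCombination_notMem {T : Set (Ideal (MvPolynomial σ ℂ))} (hT : T.Finite)
    (hX : ∀ P ∈ T, ¬ idealOfVars σ ℂ ≤ P) :
    ∃ c : σ → ℂ, ∀ P ∈ T, Fintype.linearCombination ℂ (X (R := ℂ)) c ∉ P := by
  classical
  have := hT.to_subtype
  by_contra! hc
  obtain ⟨P, hP⟩ := Subspace.exists_eq_top_of_iUnion_eq_univ
    (p := fun P : T => (P.1.restrictScalars ℂ).comap
      (Fintype.linearCombination ℂ (X (R := ℂ) (σ := σ)))) <| by
      refine Set.eq_univ_of_forall fun c => ?_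
      obtain ⟨P, hPT, hP⟩ := hc c
      exact Set.mem_iUnion.2 ⟨⟨P, hPT⟩, hP⟩
  refine hX P.1 P.2 (Ideal.span_le.2 ?_)
  rintro _ ⟨i, rfl⟩
  have : Pi.single i 1 ∈ (P.1.restrictScalars ℂ).comap
      (Fintype.linearCombination ℂ (X (R := ℂ) (σ := σ))) := hP ▸ Submodule.mem_top
  simpa using this

lemma exists_ringKrullDim_quotient_sup_linearIdeal_le_zero (d : ℕ)
    (J : Ideal (MvPolynomial σ ℂ)) (hJ : ringKrullDim (MvPolynomial σ ℂ ⧸ J) ≤ d) :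
    ∃ c : Fin d → σ → ℂ, ringKrullDim (MvPolynomial σ ℂ ⧸ (J ⊔ linearIdeal c)) ≤ (0 : ℕ) := by
  induction d generalizing J with
  | zero =>
    exact ⟨Fin.elim0, by rwa [linearIdeal, Set.range_eq_empty, Ideal.span_empty, sup_bot_eq]⟩
  | succ d ih =>
    obtain ⟨c₀, hc₀⟩ := exists_linearCombination_notMem
      (T := {P ∈ J.minimalPrimes | ¬ idealOfVars σ ℂ ≤ P})
      ((J.finite_minimalPrimes_of_isNoetherianRing _).subset (Set.sep_subset _ _))
      (fun P hP => hP.2)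
    obtain ⟨c, hc⟩ := ih (J ⊔ Ideal.span {Fintype.linearCombination ℂ X c₀}) <| by
      rw [ringKrullDim_quotient_le_iff] at hJ ⊢
      intro l hl
      obtain ⟨P, hP, hPl⟩ := Ideal.exists_minimalPrimes_le (le_sup_left.trans hl)
      by_cases hX : idealOfVars σ ℂ ≤ P
      · have h : ∀ i, (l i).asIdeal = idealOfVars σ ℂ := fun i =>
          eq_idealOfVars_of_le (l i).isPrime.ne_top (hX.trans (hPl.trans (l.head_le i)))
        have : Subsingleton (Fin (l.length + 1)) :=
          ⟨fun i j => l.strictMono.injective (PrimeSpectrum.ext ((h i).trans (h j).symm))⟩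
        have := Fin.subsingleton_iff_le_one.1 this
        lia
      · have hlt : (⟨P, hP.1.1⟩ : PrimeSpectrum _) < l.head := by
          refine lt_of_le_of_ne hPl fun he => hc₀ P ⟨hP, hX⟩ ?_
          have : P = l.head.asIdeal := congrArg PrimeSpectrum.asIdeal he
          rw [this]
          exact hl (Ideal.mem_sup_right (Ideal.mem_span_singleton_self _))
        have := hJ (l.cons ⟨P, hP.1.1⟩ hlt) hP.1.2
        simp at this
        lia
    refine ⟨Fin.cons c₀ c, ?_⟩
    have h : linearIdeal (Fin.cons c₀ c : Fin (d + 1) → σ → ℂ) =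
        Ideal.span {Fintype.linearCombination ℂ X c₀} ⊔ linearIdeal c := by
      rw [linearIdeal, linearIdeal, ← Ideal.span_union, Fin.range_fin_succ]
      rfl
    rwa [h, ← sup_assoc]

lemma mem_zeroLocus_linearIdeal_iff {κ : Type*} {c : κ → σ → ℂ} {v : σ → ℂ} :
    v ∈ zeroLocus ℂ (linearIdeal c) ↔ ∀ k, ∑ i, c k i * v i = 0 := by
  rw [linearIdeal, zeroLocus_span]
  simp [Fintype.linearCombination_apply]

end LinearSection

section GradedFiniteness

open MvPolynomial

attribute [local instance] MvPolynomial.gradedAlgebra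

lemma homogeneousComponent_succ_mul_of_isHomogeneous_one {σ R : Type*} [CommRing R]
    (h : MvPolynomial σ R) {l : MvPolynomial σ R} (hl : l.IsHomogeneous 1) (e : ℕ) :
    homogeneousComponent (e + 1) (h * l) = homogeneousComponent e h * l := by
  have := DirectSum.coe_decompose_mul_of_right_mem_of_le (homogeneousSubmodule σ R) (a := h)
    ((mem_homogeneousSubmodule _ _).2 hl) (Nat.le_add_left 1 e)
  rw [Nat.add_sub_cancel] at this
  exact (decomposition.decompose'_apply _ _).symm.trans
    (this.trans (congrArg (· * l) (decomposition.decompose'_apply _ _)))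

lemma homogeneousComponent_mem_span_of_isHomogeneous {σ R : Type*} [CommRing R]
    {S : Set (MvPolynomial σ R)} (hS : ∀ g ∈ S, ∃ m, g.IsHomogeneous m) {f : MvPolynomial σ R}
    (hf : f ∈ Ideal.span S) (e : ℕ) : homogeneousComponent e f ∈ Ideal.span S :=
  homogeneousComponent_mem_of_mem (Ideal.homogeneous_span _ _ hS) hf e

lemma isHomogeneous_linearCombination_X {σ R : Type*} [CommRing R] [Fintype σ] (c : σ → R) :
    (Fintype.linearCombination R (X (R := R)) c).IsHomogeneous 1 :=
  IsHomogeneous.sum _ _ _ fun i _ => (homogeneousSubmodule σ R 1).smul_mem _ (isHomogeneous_X R i)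

lemma isIntegral_aeval_of_isHomogeneous_one {σ B : Type*} [Finite σ] [CommRing B] [Algebra ℂ B]
    {N d : ℕ} (π : MvPolynomial σ ℂ →ₐ[ℂ] B) (hπ : Function.Surjective π)
    (hker : ∀ f, π f = 0 → ∀ e, π (homogeneousComponent e f) = 0)
    (l : Fin N → MvPolynomial σ ℂ) (hl : ∀ k, (l k).IsHomogeneous 1)
    (hd : idealOfVars σ ℂ ^ d ≤ RingHom.ker π ⊔ Ideal.span (Set.range l)) :
    (aeval (R := ℂ) fun k => π (l k)).toRingHom.IsIntegral := by
  set φ := aeval (R := ℂ) fun k => π (l k) with hφ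
  algebraize [φ.toRingHom]
  have hsmul : ∀ p b, p • b = φ p * b := fun p b => Algebra.smul_def p b
  let M : Submodule (MvPolynomial (Fin N) ℂ) B :=
    Submodule.span _ ((fun x => π (monomial x 1)) '' {x | x.degree < d + 1})
  have hM : ∀ e f, f.IsHomogeneous e → π f ∈ M := by
    intro e
    induction e using Nat.strong_induction_on with
    | _ e ih =>
    intro f hf
    have hdeg : ∀ x ∈ f.support, x.degree = e := fun x hx => by
      rw [← hf (mem_support_iff.1 hx), Finsupp.degree_eq_weight_one]; rfl
    rcases lt_or_ge e (d + 1) with hed | hed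
    · rw [f.as_sum, map_sum]
      refine sum_mem fun x hx => ?_
      have := M.smul_mem (C (coeff x f))
        (Submodule.subset_span ⟨x, (hdeg x hx).trans_lt hed, rfl⟩)
      rw [hsmul, hφ, aeval_C, ← Algebra.smul_def, ← map_smul, smul_monomial, smul_eq_mul,
        mul_one] at this
      exact this
    · obtain ⟨e, rfl⟩ : ∃ e', e = e' + 1 := ⟨e - 1, by lia⟩
      have hfd := hd <| (mem_pow_idealOfVars_iff _ _).2 fun x hx => by
        rw [hdeg x hx]; lia
      obtain ⟨a, ha, b, hb, rfl⟩ := Submodule.mem_sup.1 hfd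
      obtain ⟨g, rfl⟩ := Ideal.mem_span_range_iff_exists_fun.1 hb
      rw [← homogeneousComponent_eq_self hf, map_add, map_add, hker a ha, zero_add, map_sum,
        map_sum]
      refine sum_mem fun k _ => ?_
      have := M.smul_mem (X k)
        (ih e e.lt_succ_self _ (homogeneousComponent_isHomogeneous e (g k)))
      rw [hsmul, hφ, aeval_X] at this
      rwa [homogeneousComponent_succ_mul_of_isHomogeneous_one _ (hl k), mul_comm, map_mul]
  have hMtop : M = ⊤ := by
    refine eq_top_iff.2 fun y _ => ?_
    obtain ⟨f, rfl⟩ := hπ y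
    rw [← sum_homogeneousComponent f, map_sum]
    exact sum_mem fun e _ => hM e _ (homogeneousComponent_isHomogeneous e f)
  have : Module.Finite (MvPolynomial (Fin N) ℂ) B :=
    ⟨hMtop ▸ Submodule.fg_span ((Finsupp.finite_of_degree_lt (d + 1)).image _)⟩
  exact Algebra.IsIntegral.isIntegral (R := MvPolynomial (Fin N) ℂ)

/-- A homogeneous ideal whose cone meets the zero set of `N` linear forms only in the origin has
dimension at most `N`. -/
lemma ringKrullDim_quotient_le_of_linear_section {σ : Type} [Fintype σ] {N : ℕ}
    {I : Ideal (MvPolynomial σ ℂ)} (hI : ∀ f ∈ I, ∀ e, homogeneousComponent e f ∈ I)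
    (c : Fin N → σ → ℂ)
    (h : ∀ v ∈ zeroLocus ℂ I, (∀ k, ∑ i, c k i * v i = 0) → v = 0) :
    ringKrullDim (MvPolynomial σ ℂ ⧸ I) ≤ N := by
  have hrad : idealOfVars σ ℂ ≤ (I ⊔ linearIdeal c).radical := by
    rw [← vanishingIdeal_zeroLocus_eq_radical (K := ℂ), idealOfVars, Ideal.span_le]
    rintro _ ⟨i, rfl⟩ v hv
    have := h v (zeroLocus_anti_mono le_sup_left hv)
      (mem_zeroLocus_linearIdeal_iff.1 (zeroLocus_anti_mono le_sup_right hv))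
    simp [this]
  obtain ⟨d, hd⟩ := Ideal.exists_pow_le_of_le_radical_of_fg hrad (idealOfVars_fg σ ℂ)
  refine (ringKrullDim_le_of_isIntegral _ (isIntegral_aeval_of_isHomogeneous_one
    (Ideal.Quotient.mkₐ ℂ I) (Ideal.Quotient.mkₐ_surjective ℂ I) ?_ _
    (fun k => isHomogeneous_linearCombination_X (c k)) (d := d) ?_)).trans ?_
  · intro f hf e
    rw [Ideal.Quotient.mkₐ_eq_mk, Ideal.Quotient.eq_zero_iff_mem] at hf ⊢
    exact hI f hf e
  · have hker : RingHom.ker (Ideal.Quotient.mkₐ ℂ I) = I := Ideal.mk_ker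
    rwa [hker]
  · simp [MvPolynomial.ringKrullDim_of_isNoetherianRing]

end GradedFiniteness

section LowerBound

open MvPolynomial

variable {σ : Type*}

lemma height_vanishingIdeal_singleton (x : σ → ℂ) :
    (vanishingIdeal ℂ {x}).height = (vanishingIdeal ℂ {(0 : σ → ℂ)}).height := by
  have hinv : ∀ y z : σ → ℂ, y + z = 0 →
      (aeval (R := ℂ) fun i => (X i + C (y i) : MvPolynomial σ ℂ)).comp
        (aeval fun i => X i + C (z i)) = AlgHom.id ℂ (MvPolynomial σ ℂ) := by
    intro y z hyz
    ext1 i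
    have : y i + z i = 0 := congrFun hyz i
    simp [add_assoc, ← C_add, this, algebraMap_eq]
  let e : MvPolynomial σ ℂ ≃ₐ[ℂ] MvPolynomial σ ℂ :=
    AlgEquiv.ofAlgHom (aeval fun i => X i + C (x i)) (aeval fun i => X i + C ((-x) i))
      (hinv _ _ (add_neg_cancel x)) (hinv _ _ (neg_add_cancel x))
  rw [← e.toRingEquiv.height_comap (vanishingIdeal ℂ {0})]
  congr 1
  ext p
  have h : aeval (0 : σ → ℂ) (e p) = aeval x p := by
    change aeval (0 : σ → ℂ) (aeval _ p) = _
    rw [comp_aeval_apply]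
    simp
  simpa using Eq.congr_left h.symm

variable [Finite σ]

lemma natCard_le_height_vanishingIdeal_zero :
    (Nat.card σ : WithBot ℕ∞) ≤ (vanishingIdeal ℂ {(0 : σ → ℂ)}).height := by
  have h : ringKrullDim (MvPolynomial σ ℂ) ≤ (vanishingIdeal ℂ {(0 : σ → ℂ)}).height := by
    rw [ringKrullDim_le_iff_isMaximal_height_le]
    intro m hm
    obtain ⟨x, rfl⟩ := eq_vanishingIdeal_singleton_of_isMaximal ℂ hm
    rw [height_vanishingIdeal_singleton]
  simpa [MvPolynomial.ringKrullDim_of_isNoetherianRing] using h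

lemma natCard_le_ringKrullDim_quotient_span_add_encard {s : Set (MvPolynomial σ ℂ)}
    (hs : ∀ f ∈ s, aeval (0 : σ → ℂ) f = 0) :
    (Nat.card σ : WithBot ℕ∞) ≤ ringKrullDim (MvPolynomial σ ℂ ⧸ Ideal.span s) + s.encard :=
  natCard_le_height_vanishingIdeal_zero.trans
    (Ideal.height_le_ringKrullDim_quotient_add_encard (p := vanishingIdeal ℂ {(0 : σ → ℂ)}) s
      fun f hf => by simpa using hs f hf)

end LowerBound

/-- A closed family of cones whose fibre over `0` is trivial has a trivial fibre over some
`t ≠ 0`. -/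
lemma exists_ne_zero_fiber_trivial {E : Type*} [NormedAddCommGroup E] [NormedSpace ℂ E]
    [ProperSpace E] {Z : Set (ℂ × E)} (hZ : IsClosed Z)
    (hcone : ∀ (s t : ℂ) (v : E), (t, v) ∈ Z → (t, s • v) ∈ Z)
    (h0 : ∀ v, (0, v) ∈ Z → v = 0) : ∃ t : ℂ, t ≠ 0 ∧ ∀ v, (t, v) ∈ Z → v = 0 := by
  by_contra! h
  have hunit : ∀ k : ℕ, ∃ v ∈ Metric.sphere (0 : E) 1, ((1 / ((k : ℂ) + 1), v) : ℂ × E) ∈ Z := by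
    intro k
    obtain ⟨v, hv, hv0⟩ := h (1 / ((k : ℂ) + 1)) (one_div_ne_zero (Nat.cast_add_one_ne_zero k))
    refine ⟨(‖v‖⁻¹ : ℂ) • v, ?_, hcone _ _ _ hv⟩
    simpa using norm_smul_inv_norm (𝕜 := ℂ) hv0
  choose v hv hvZ using hunit
  obtain ⟨w, hw, g, hg, hlim⟩ := (isCompact_sphere (0 : E) 1).tendsto_subseq hv
  have ht : Filter.Tendsto (fun k : ℕ => 1 / ((k : ℂ) + 1)) Filter.atTop (nhds 0) :=
    tendsto_one_div_add_atTop_nhds_zero_nat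
  have hw0 : w = 0 := h0 w <| hZ.mem_of_tendsto
    ((ht.comp hg.tendsto_atTop).prodMk_nhds hlim) (Filter.Eventually.of_forall fun k => hvZ (g k))
  simp [hw0] at hw

section DiagonalCommutator

open MvPolynomial

lemma zeroLocus_span_triangular_products (n : ℕ) :
    zeroLocus ℂ (Ideal.span {f | ∃ i j : Fin n, (i < j ∧ f = (Xgen n * Ygen n) i j) ∨
      (j < i ∧ f = (Ygen n * Xgen n) i j)}) = lowerUpperSet n n := by
  rw [zeroLocus_span]
  ext v
  constructor
  · intro h
    refine ⟨fun i j hij => ?_, fun i j hij => ?_⟩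
    · simpa [Matrix.mul_apply, Xgen, Ygen] using h _ ⟨i, j, .inl ⟨hij, rfl⟩⟩
    · simpa [Matrix.mul_apply, Xgen, Ygen] using h _ ⟨i, j, .inr ⟨hij, rfl⟩⟩
  · rintro ⟨hl, hu⟩ _ ⟨i, j, ⟨hij, rfl⟩ | ⟨hij, rfl⟩⟩
    · simpa [Matrix.mul_apply, Xgen, Ygen] using hl i j hij
    · simpa [Matrix.mul_apply, Xgen, Ygen] using hu i j hij

lemma smul_mem_lowerUpperSet {m n : ℕ} (s : ℂ) {v : (Fin m × Fin n) ⊕ (Fin n × Fin m) → ℂ}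
    (hv : v ∈ lowerUpperSet m n) : s • v ∈ lowerUpperSet m n := by
  refine ⟨fun i j hij => ?_, fun i j hij => ?_⟩
  · simp [mul_mul_mul_comm s, ← Finset.mul_sum, hv.1 i j hij]
  · simp [mul_mul_mul_comm s, ← Finset.mul_sum, hv.2 i j hij]

lemma exists_linear_section_lowerUpperSet (n : ℕ) :
    ∃ c : Fin (n * n + n) → (Fin n × Fin n) ⊕ (Fin n × Fin n) → ℂ,
      ∀ v ∈ lowerUpperSet n n, (∀ k, ∑ i, c k i * v i = 0) → v = 0 := by
  obtain ⟨c, hc⟩ := exists_ringKrullDim_quotient_sup_linearIdeal_le_zero (n * n + n) _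
    (ringKrullDim_quotient_le_of_polynomiallyCovered
      (polynomiallyCovered_lowerUpperSet n n) (zeroLocus_span_triangular_products n).le)
  refine ⟨c, fun v hv hcv => eq_zero_of_forall_smul_mem_zeroLocus hc fun s p hp => ?_⟩
  obtain ⟨a, ha, b, hb, rfl⟩ := Submodule.mem_sup.1 hp
  have hs := (zeroLocus_span_triangular_products n).ge (smul_mem_lowerUpperSet s hv)
  have hcs : s • v ∈ zeroLocus ℂ (linearIdeal c) := mem_zeroLocus_linearIdeal_iff.2 fun k => by
    simp [mul_left_comm _ s, ← Finset.mul_sum, hcv k]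
  rw [map_add, hs a ha, hcs b hb, add_zero]

/-- Degenerating along the one-parameter family of equations
`(XY)_{ij} = t^{2(j-i)} (YX)_{ij}` for `i < j` and `(YX)_{ij} = t^{2(i-j)} (XY)_{ij}` for
`j < i`, whose fibre at `t = 0` is `lowerUpperSet n n`. -/
lemma exists_linear_section_deformed (n : ℕ) :
    ∃ (c : Fin (n * n + n) → (Fin n × Fin n) ⊕ (Fin n × Fin n) → ℂ) (t : ℂ), t ≠ 0 ∧
      ∀ v : (Fin n × Fin n) ⊕ (Fin n × Fin n) → ℂ,
        (∀ i j, i < j → ∑ k, v (Sum.inl (i, k)) * v (Sum.inr (k, j)) =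
          t ^ (2 * (j - i : ℕ)) * ∑ k, v (Sum.inr (i, k)) * v (Sum.inl (k, j))) →
        (∀ i j, j < i → ∑ k, v (Sum.inr (i, k)) * v (Sum.inl (k, j)) =
          t ^ (2 * (i - j : ℕ)) * ∑ k, v (Sum.inl (i, k)) * v (Sum.inr (k, j))) →
        (∀ k, ∑ i, c k i * v i = 0) → v = 0 := by
  obtain ⟨c, hc⟩ := exists_linear_section_lowerUpperSet n
  let Z : Set (ℂ × ((Fin n × Fin n) ⊕ (Fin n × Fin n) → ℂ)) :=
    {z | (∀ i j, i < j → ∑ k, z.2 (Sum.inl (i, k)) * z.2 (Sum.inr (k, j)) =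
          z.1 ^ (2 * (j - i : ℕ)) * ∑ k, z.2 (Sum.inr (i, k)) * z.2 (Sum.inl (k, j))) ∧
        (∀ i j, j < i → ∑ k, z.2 (Sum.inr (i, k)) * z.2 (Sum.inl (k, j)) =
          z.1 ^ (2 * (i - j : ℕ)) * ∑ k, z.2 (Sum.inl (i, k)) * z.2 (Sum.inr (k, j))) ∧
        (∀ k, ∑ i, c k i * z.2 i = 0)}
  suffices h : ∃ t : ℂ, t ≠ 0 ∧ ∀ v, (t, v) ∈ Z → v = 0 by
    obtain ⟨t, ht, h⟩ := h
    exact ⟨c, t, ht, fun v h1 h2 h3 => h v ⟨h1, h2, h3⟩⟩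
  refine exists_ne_zero_fiber_trivial ?_ ?_ ?_
  · simp only [Z, Set.ofPred_and, Set.ofPred_forall]
    refine .inter (isClosed_iInter fun i => isClosed_iInter fun j => isClosed_iInter fun _ => ?_)
      (.inter (isClosed_iInter fun i => isClosed_iInter fun j => isClosed_iInter fun _ => ?_)
        (isClosed_iInter fun k => ?_)) <;>
    exact isClosed_eq (by fun_prop) (by fun_prop)
  · rintro s t v ⟨h1, h2, h3⟩
    refine ⟨fun i j hij => ?_, fun i j hij => ?_, fun k => ?_⟩
    · simp [mul_mul_mul_comm s, ← Finset.mul_sum, mul_left_comm _ (s * s), h1 i j hij]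
    · simp [mul_mul_mul_comm s, ← Finset.mul_sum, mul_left_comm _ (s * s), h2 i j hij]
    · simp [mul_left_comm _ s, ← Finset.mul_sum, h3 k]
  · rintro v ⟨h1, h2, h3⟩
    refine hc v ⟨fun i j hij => ?_, fun i j hij => ?_⟩ h3
    · rw [h1 i j hij, zero_pow (by lia), zero_mul]
    · rw [h2 i j hij, zero_pow (by lia), zero_mul]

lemma exists_linear_section_diagCommIdeal (n : ℕ) :
    ∃ c : Fin (n * n + n) → (Fin n × Fin n) ⊕ (Fin n × Fin n) → ℂ,
      ∀ v ∈ zeroLocus ℂ (diagCommIdeal n), (∀ k, ∑ i, c k i * v i = 0) → v = 0 := by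
  obtain ⟨c, t, ht, h⟩ := exists_linear_section_deformed n
  let w : (Fin n × Fin n) ⊕ (Fin n × Fin n) → ℂ :=
    Sum.elim (fun p => (t ^ (p.1 + p.2 : ℕ))⁻¹) (fun p => t ^ (p.1 + p.2 : ℕ))
  have hw : ∀ i, w i ≠ 0 := by
    rintro (p | p)
    · exact inv_ne_zero (pow_ne_zero _ ht)
    · exact pow_ne_zero _ ht
  refine ⟨fun k i => c k i * w i, fun v hv hcv => ?_⟩
  have hcomm : ∀ i j, i ≠ j → ∑ k, v (Sum.inl (i, k)) * v (Sum.inr (k, j)) =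
      ∑ k, v (Sum.inr (i, k)) * v (Sum.inl (k, j)) := fun i j hij => by
    have := hv _ (Ideal.subset_span ⟨i, j, hij, rfl⟩)
    simpa [Matrix.mul_apply, Xgen, Ygen, sub_eq_zero] using this
  have hXY : ∀ i j, ∑ k, (w * v) (Sum.inl (i, k)) * (w * v) (Sum.inr (k, j)) =
      (t ^ (i : ℕ))⁻¹ * t ^ (j : ℕ) * ∑ k, v (Sum.inl (i, k)) * v (Sum.inr (k, j)) := by
    intro i j
    rw [Finset.mul_sum]
    refine Finset.sum_congr rfl fun k _ => ?_
    simp only [Pi.mul_apply, w, Sum.elim_inl, Sum.elim_inr, pow_add]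
    field_simp
  have hYX : ∀ i j, ∑ k, (w * v) (Sum.inr (i, k)) * (w * v) (Sum.inl (k, j)) =
      t ^ (i : ℕ) * (t ^ (j : ℕ))⁻¹ * ∑ k, v (Sum.inr (i, k)) * v (Sum.inl (k, j)) := by
    intro i j
    rw [Finset.mul_sum]
    refine Finset.sum_congr rfl fun k _ => ?_
    simp only [Pi.mul_apply, w, Sum.elim_inl, Sum.elim_inr, pow_add]
    field_simp
  have hpow : ∀ i j : Fin n, i < j →
      (t ^ (i : ℕ))⁻¹ * t ^ (j : ℕ) =
        t ^ (2 * (j - i : ℕ)) * (t ^ (i : ℕ) * (t ^ (j : ℕ))⁻¹) := by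
    intro i j hij
    obtain ⟨d, hd⟩ : ∃ d, (j : ℕ) = i + d := ⟨j - i, by lia⟩
    rw [hd, Nat.add_sub_cancel_left, pow_add, two_mul, pow_add]
    field_simp
  have h0 : w * v = 0 := by
    refine h (w * v) (fun i j hij => ?_) (fun i j hij => ?_) fun k => ?_
    · rw [hXY, hYX, hcomm i j hij.ne, hpow i j hij, mul_assoc]
    · rw [hXY, hYX, hcomm i j hij.ne', mul_comm (t ^ (i : ℕ)), hpow j i hij,
        mul_comm (t ^ (j : ℕ)), mul_assoc]
    · simpa [mul_assoc] using hcv k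
  ext i
  simpa [hw i] using congrFun h0 i

lemma isHomogeneous_commutator_entry (n : ℕ) (i j : Fin n) :
    ((Xgen n * Ygen n - Ygen n * Xgen n) i j).IsHomogeneous 2 := by
  rw [Matrix.sub_apply, Matrix.mul_apply, Matrix.mul_apply]
  exact (IsHomogeneous.sum _ _ _ fun k _ => (isHomogeneous_X ℂ _).mul (isHomogeneous_X ℂ _)).sub
    (IsHomogeneous.sum _ _ _ fun k _ => (isHomogeneous_X ℂ _).mul (isHomogeneous_X ℂ _))

lemma ringKrullDim_quotient_diagCommIdeal_le (n : ℕ) :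
    ringKrullDim (PolyRing n ⧸ diagCommIdeal n) ≤ (n * n + n : ℕ) := by
  obtain ⟨c, hc⟩ := exists_linear_section_diagCommIdeal n
  refine ringKrullDim_quotient_le_of_linear_section (fun f hf e => ?_) c hc
  refine homogeneousComponent_mem_span_of_isHomogeneous ?_ hf e
  rintro _ ⟨i, j, -, rfl⟩
  exact ⟨2, isHomogeneous_commutator_entry n i j⟩

lemma encard_commutator_offDiag_le (n : ℕ) :
    {f | ∃ i j : Fin n, i ≠ j ∧ f = (Xgen n * Ygen n - Ygen n * Xgen n) i j}.encard ≤
      (n * n - n : ℕ) := by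
  have h : {f | ∃ i j : Fin n, i ≠ j ∧ f = (Xgen n * Ygen n - Ygen n * Xgen n) i j} ⊆
      (fun p : Fin n × Fin n => (Xgen n * Ygen n - Ygen n * Xgen n) p.1 p.2) ''
        (Finset.univ.offDiag : Finset (Fin n × Fin n)) := by
    rintro _ ⟨i, j, hij, rfl⟩
    exact ⟨(i, j), by simpa using hij, rfl⟩
  refine (Set.encard_le_encard h).trans ((Set.encard_image_le _ _).trans ?_)
  rw [Set.encard_coe_eq_coe_finsetCard, Finset.offDiag_card]
  simp

lemma le_ringKrullDim_quotient_diagCommIdeal (n : ℕ) :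
    (n * n + n : ℕ) ≤ ringKrullDim (PolyRing n ⧸ diagCommIdeal n) := by
  have h := natCard_le_ringKrullDim_quotient_span_add_encard
    (s := {f | ∃ i j : Fin n, i ≠ j ∧ f = (Xgen n * Ygen n - Ygen n * Xgen n) i j}) <| by
      rintro _ ⟨i, j, -, rfl⟩
      simp [Matrix.mul_apply, Xgen, Ygen]
  have h' : ((2 * (n * n) : ℕ) : WithBot ℕ∞) ≤
      ringKrullDim (PolyRing n ⧸ diagCommIdeal n) + (n * n - n : ℕ) := by
    refine le_trans (by simp [two_mul]) (h.trans (add_le_add le_rfl ?_))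
    exact WithBot.coe_le_coe.2 (encard_commutator_offDiag_le n)
  have hsum : 2 * (n * n) = (n * n + n) + (n * n - n) := by
    have := Nat.le_mul_self n
    lia
  rw [hsum, Nat.cast_add] at h'
  exact (ENat.WithBot.add_le_add_natCast_right_iff).1 h'

end DiagonalCommutator


/-- `R/I` has Krull dimension `n² + n`: the diagonal commutator scheme is a
complete intersection cut out by `n² - n` equations in `ℂ^{2n²}`. -/
theorem stmt1 (n : ℕ) (hn : 1 ≤ n) :
    ringKrullDim (PolyRing n ⧸ diagCommIdeal n) = (n ^ 2 + n : ℕ) := by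
  rw [sq]
  exact le_antisymm (ringKrullDim_quotient_diagCommIdeal_le n)
    (le_ringKrullDim_quotient_diagCommIdeal n)
end
end

section
/- The vanishing ideal 𝕀(C) of the commuting variety C = {(X,Y) ∈ Mₙ(ℂ)² : XY = YX} is a minimal prime over the ideal I; that is, the commuting variety is an irreducible component of the diagonal commutator scheme D. -/
noncomputable section

/-- Evaluation of a polynomial at a point `(X, Y)` of `ℂ^{2n²}`. -/
def evalPt (n : ℕ) (p : MatC n × MatC n) : PolyRing n →+* ℂ :=
  MvPolynomial.eval (Sum.elim (fun q => p.1 q.1 q.2) (fun q => p.2 q.1 q.2))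

/-- The vanishing ideal `𝕀(S)` of a subset `S ⊆ ℂ^{2n²}`. -/
def vanishingIdeal (n : ℕ) (S : Set (MatC n × MatC n)) : Ideal (PolyRing n) :=
  ⨅ p ∈ S, RingHom.ker (evalPt n p)

section CyclicCentralizer

open Polynomial

/-- In a finite product of algebras `ℂ[X] ⧸ (pᵢ ^ eᵢ)` with `pᵢ` irreducible, some single element
generates the whole product as a `ℂ`-algebra. -/
theorem exists_aeval_surjective_pi_quotient {ι : Type*} [Fintype ι] (p : ι → ℂ[X])
    (hp : ∀ i, Irreducible (p i)) (e : ι → ℕ) :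
    ∃ z : ∀ i, ℂ[X] ⧸ Ideal.span {p i ^ e i}, ∀ w, ∃ g : ℂ[X], aeval z g = w := by
  have hroot : ∀ i, ∃ r : ℂ, Associated (X - C r) (p i) := fun i => by
    obtain ⟨r, hr⟩ := IsAlgClosed.exists_root (p i)
      (by rw [IsAlgClosed.degree_eq_one_of_irreducible ℂ (hp i)]; exact one_ne_zero)
    exact ⟨r, (irreducible_X_sub_C r).associated_of_dvd (hp i) (dvd_iff_isRoot.mpr hr)⟩
  choose r hr using hroot
  obtain ⟨b, hb⟩ : ∃ b : ι → ℂ, Function.Injective b :=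
    ⟨fun i => ((Fintype.equivFin ι i : ℕ) : ℂ), fun i j h =>
      (Fintype.equivFin ι).injective (Fin.ext (Nat.cast_injective h))⟩
  refine ⟨fun i => Ideal.Quotient.mk _ (X + C (b i - r i)), fun w => ?_⟩
  choose h hh using fun i => Ideal.Quotient.mk_surjective (w i)
  have hcop : Pairwise
      (Function.onFun IsCoprime fun i => Ideal.span {(X - C (b i)) ^ e i}) := fun i j hij => by
    rw [Function.onFun, Ideal.isCoprime_span_singleton_iff]
    exact (isCoprime_X_sub_C_of_isUnit_sub
      (sub_ne_zero.mpr (hb.ne hij)).isUnit).pow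
  obtain ⟨g, hg⟩ := Ideal.exists_forall_sub_mem_ideal hcop
    fun i => (h i).comp (X - C (b i - r i))
  refine ⟨g, funext fun i => ?_⟩
  have h1 : aeval (fun i => Ideal.Quotient.mk (Ideal.span {p i ^ e i}) (X + C (b i - r i))) g i
      = Ideal.Quotient.mk _ (g.comp (X + C (b i - r i))) := by
    have h2 := aeval_algHom_apply
      (Pi.evalAlgHom ℂ (fun i => ℂ[X] ⧸ Ideal.span {p i ^ e i}) i)
      (fun i => Ideal.Quotient.mk (Ideal.span {p i ^ e i}) (X + C (b i - r i))) g
    have h3 := aeval_algHom_apply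
      (Ideal.Quotient.mkₐ ℂ (Ideal.span {p i ^ e i})) (X + C (b i - r i)) g
    rw [Ideal.Quotient.mkₐ_eq_mk, ← comp_eq_aeval] at h3
    exact h2.symm.trans h3
  rw [h1, ← hh i, Ideal.Quotient.mk_eq_mk_iff_sub_mem, Ideal.mem_span_singleton]
  refine ((hr i).pow_pow.symm.dvd).trans ?_
  have h4 := (Ideal.mem_span_singleton.mp (hg i))
  obtain ⟨q, hq⟩ := h4
  refine ⟨q.comp (X + C (b i - r i)), ?_⟩
  have h5 := congrArg (fun f : ℂ[X] => f.comp (X + C (b i - r i))) hq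
  simp only [sub_comp, mul_comp, pow_comp, comp_assoc, X_comp, C_comp] at h5
  rw [show X + C (b i - r i) - C (b i - r i) = (X : ℂ[X]) by ring, comp_X,
    show X + C (b i - r i) - C (b i) = (X : ℂ[X]) - C (r i) by rw [C_sub]; ring] at h5
  exact h5

/-- Every endomorphism of a finite-dimensional complex vector space commutes with an endomorphism
that has a cyclic vector. -/
theorem exists_commute_cyclic {V : Type*} [AddCommGroup V] [Module ℂ V] [FiniteDimensional ℂ V]
    (φ : Module.End ℂ V) :
    ∃ (ζ : Module.End ℂ V) (v : V), Commute ζ φ ∧ ∀ w, ∃ g : ℂ[X], aeval ζ g v = w := by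
  classical
  obtain ⟨ι, _, p, hp, e, ⟨E⟩⟩ := Module.equiv_directSum_of_isTorsion
    (Module.AEval.isTorsion_of_finiteDimensional ℂ V φ)
  obtain ⟨z, hz⟩ := exists_aeval_surjective_pi_quotient p hp e
  let E₁ := E.trans (DirectSum.linearEquivFunOnFintype ℂ[X] ι _)
  let E₂ : V ≃ₗ[ℂ] (∀ i, ℂ[X] ⧸ Ideal.span {p i ^ e i}) :=
    (Module.AEval'.of φ).trans (E₁.restrictScalars ℂ)
  have hX : ∀ v, E₂ (φ v) = (X : ℂ[X]) • E₂ v := fun v => by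
    change E₁ (Module.AEval'.of φ (φ v)) = (X : ℂ[X]) • E₁ (Module.AEval'.of φ v)
    rw [← Module.AEval'.X_smul_of, map_smul]
  let F := E₂.symm.conjAlgEquiv ℂ
  let ζ : Module.End ℂ V := F (Algebra.lmul ℂ _ z)
  have hζ : ∀ g : ℂ[X], ∀ v, aeval ζ g v = E₂.symm (aeval z g * E₂ v) := fun g v => by
    have h1 : aeval ζ g = F (Algebra.lmul ℂ _ (aeval z g)) := by
      rw [← aeval_algHom_apply (Algebra.lmul ℂ _) z g]
      exact aeval_algHom_apply F.toAlgHom _ g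
    rw [h1]
    rfl
  refine ⟨ζ, E₂.symm 1, LinearMap.ext fun v => ?_, fun w => ?_⟩
  · apply E₂.injective
    have h2 : ∀ u, E₂ (ζ u) = z * E₂ u := fun u => by
      have := hζ X u
      rw [aeval_X, aeval_X] at this
      rw [this, LinearEquiv.apply_symm_apply]
    rw [Module.End.mul_apply, Module.End.mul_apply, h2, hX, hX, h2, mul_smul_comm]
  · obtain ⟨g, hg⟩ := hz (E₂ w)
    exact ⟨g, by rw [hζ, hg, LinearEquiv.apply_symm_apply, mul_one, LinearEquiv.symm_apply_apply]⟩

end CyclicCentralizer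

/-- The matrix with columns `v, A v, …, A ^ (n - 1) v`. -/
def krylovMatrix {n : ℕ} {K : Type*} [CommRing K] (A : Matrix (Fin n) (Fin n) K)
    (v : Fin n → K) : Matrix (Fin n) (Fin n) K :=
  Matrix.of fun i k => (A ^ (k : ℕ)).mulVec v i

theorem krylovMatrix_mulVec {n : ℕ} {K : Type*} [CommRing K] (A : Matrix (Fin n) (Fin n) K)
    (v c : Fin n → K) :
    (krylovMatrix A v).mulVec c = (∑ k : Fin n, c k • A ^ (k : ℕ)).mulVec v := by
  ext i
  rw [Matrix.sum_mulVec, Finset.sum_apply]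
  simp only [Matrix.smul_mulVec, Pi.smul_apply, smul_eq_mul]
  rw [Matrix.mulVec, dotProduct]
  exact Finset.sum_congr rfl fun k _ => mul_comm (krylovMatrix A v i k) (c k)

theorem krylovMatrix_map {n : ℕ} {K L : Type*} [CommRing K] [CommRing L] (h : K →+* L)
    (A : Matrix (Fin n) (Fin n) K) (v : Fin n → K) :
    krylovMatrix (A.map h) (h ∘ v) = (krylovMatrix A v).map h := by
  ext i k
  simp only [krylovMatrix, Matrix.of_apply, Matrix.map_apply]
  rw [RingHom.map_mulVec, Matrix.map_pow]

/-- A matrix commuting with a matrix `A` that has a cyclic vector is a polynomial in `A`. -/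
theorem exists_eq_sum_smul_pow {n : ℕ} {K : Type*} [Field K] {A B : Matrix (Fin n) (Fin n) K}
    (hAB : Commute A B) {v : Fin n → K} (hv : (krylovMatrix A v).det ≠ 0) :
    ∃ c : Fin n → K, B = ∑ k : Fin n, c k • A ^ (k : ℕ) := by
  have hu : IsUnit (krylovMatrix A v) := (Matrix.isUnit_iff_isUnit_det _).mpr hv.isUnit
  obtain ⟨c, hc⟩ := Matrix.mulVec_surjective_iff_isUnit.mpr hu (B.mulVec v)
  rw [krylovMatrix_mulVec] at hc
  refine ⟨c, ?_⟩
  have hq : Commute A (∑ k : Fin n, c k • A ^ (k : ℕ)) :=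
    Commute.sum_right _ _ _ fun k _ => ((Commute.refl A).pow_right _).smul_right _
  apply hu.mul_right_cancel
  have key : ∀ D : Matrix (Fin n) (Fin n) K, Commute A D → ∀ i k,
      (D * krylovMatrix A v) i k = (A ^ (k : ℕ)).mulVec (D.mulVec v) i := fun D hD i k => by
    rw [Matrix.mulVec_mulVec, (hD.pow_left _).eq, ← Matrix.mulVec_mulVec]
    rfl
  ext i k
  rw [key _ hAB, key _ hq, hc]

/-- Every complex matrix commutes with a matrix that has a cyclic vector. -/
theorem exists_commute_krylovMatrix_det_ne_zero {n : ℕ} (Y : MatC n) :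
    ∃ (Z : MatC n) (v : Fin n → ℂ), Commute Z Y ∧ (krylovMatrix Z v).det ≠ 0 := by
  obtain ⟨ζ, v, hc, hs⟩ := exists_commute_cyclic (Matrix.toLinAlgEquiv' Y)
  refine ⟨Matrix.toLinAlgEquiv'.symm ζ, v, ?_, ?_⟩
  · simpa using hc.map Matrix.toLinAlgEquiv'.symm
  · set Z := Matrix.toLinAlgEquiv'.symm ζ with hZ
    rw [← isUnit_iff_ne_zero, ← Matrix.isUnit_iff_isUnit_det, ← Matrix.mulVec_surjective_iff_isUnit]
    intro w
    obtain ⟨g, hg⟩ := hs w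
    refine ⟨fun k => (g %ₘ Z.charpoly).coeff k, ?_⟩
    rw [krylovMatrix_mulVec, ← hg]
    have h1 : Polynomial.aeval Z g = ∑ k : Fin n, (g %ₘ Z.charpoly).coeff k • Z ^ (k : ℕ) := by
      rcases Nat.eq_zero_or_pos n with rfl | hn
      · exact Subsingleton.elim _ _
      · have hdeg : Z.charpoly.natDegree = n := by
          rw [Matrix.charpoly_natDegree_eq_dim, Fintype.card_fin]
        have hlt := Polynomial.natDegree_modByMonic_lt g Z.charpoly_monic fun h => by
          rw [h, Polynomial.natDegree_one] at hdeg
          exact hn.ne hdeg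
        rw [hdeg] at hlt
        rw [Matrix.aeval_eq_aeval_mod_charpoly, Polynomial.aeval_eq_sum_range' hlt,
          Finset.sum_range]
    rw [← h1]
    have h2 : ζ = Matrix.toLinAlgEquiv' Z := by rw [hZ, AlgEquiv.apply_symm_apply]
    have h3 := Polynomial.aeval_algHom_apply
      (Matrix.toLinAlgEquiv' (R := ℂ) (n := Fin n)).toAlgHom Z g
    rw [h2]
    exact (LinearMap.congr_fun h3 v).symm

/-- Evaluation of a polynomial at a pair of matrices over a `ℂ`-algebra. -/
def matEval {n : ℕ} {K : Type*} [CommRing K] [Algebra ℂ K] (A B : Matrix (Fin n) (Fin n) K) :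
    PolyRing n →ₐ[ℂ] K :=
  MvPolynomial.aeval (Sum.elim (fun q => A q.1 q.2) (fun q => B q.1 q.2))

theorem algHom_comp_matEval {n : ℕ} {K L : Type*} [CommRing K] [Algebra ℂ K] [CommRing L]
    [Algebra ℂ L] (h : K →ₐ[ℂ] L) (A B : Matrix (Fin n) (Fin n) K) :
    h.comp (matEval A B) = matEval (A.map h) (B.map h) := by
  apply MvPolynomial.algHom_ext
  rintro (q | q) <;> simp [matEval]

theorem map_matEval {n : ℕ} {K L : Type*} [CommRing K] [Algebra ℂ K] [CommRing L]
    [Algebra ℂ L] (h : K →ₐ[ℂ] L) (A B : Matrix (Fin n) (Fin n) K) (f : PolyRing n) :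
    h (matEval A B f) = matEval (A.map h) (B.map h) f :=
  DFunLike.congr_fun (algHom_comp_matEval h A B) f

theorem evalPt_eq_matEval {n : ℕ} (p : MatC n × MatC n) (f : PolyRing n) :
    evalPt n p f = matEval p.1 p.2 f := rfl

theorem matEval_generic {n : ℕ} : matEval (Xgen n) (Ygen n) = AlgHom.id ℂ (PolyRing n) := by
  apply MvPolynomial.algHom_ext
  rintro (q | q) <;> simp [matEval, Xgen, Ygen]

theorem mem_vanishingIdeal_iff {n : ℕ} {S : Set (MatC n × MatC n)} {f : PolyRing n} :
    f ∈ vanishingIdeal n S ↔ ∀ p ∈ S, matEval p.1 p.2 f = 0 := by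
  simp [vanishingIdeal, Submodule.mem_iInf, RingHom.mem_ker, evalPt_eq_matEval]

/-- The ring of coordinates `(x_{ij}, c_k)` parametrizing pairs `(X, ∑ c_k X ^ k)`. -/
abbrev ParamRing (n : ℕ) := MvPolynomial ((Fin n × Fin n) ⊕ Fin n) ℂ

/-- The generic matrix over `ParamRing n`. -/
def paramX (n : ℕ) : Matrix (Fin n) (Fin n) (ParamRing n) :=
  Matrix.of fun i j => MvPolynomial.X (Sum.inl (i, j))

/-- The generic polynomial of degree less than `n` in `paramX n`. -/
def paramY (n : ℕ) : Matrix (Fin n) (Fin n) (ParamRing n) :=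
  ∑ k : Fin n, (MvPolynomial.X (Sum.inr k) : ParamRing n) • paramX n ^ (k : ℕ)

/-- Specialization of `ParamRing n` at a matrix `A` and coefficients `c`. -/
def paramEval {n : ℕ} {K : Type*} [CommRing K] [Algebra ℂ K] (A : Matrix (Fin n) (Fin n) K)
    (c : Fin n → K) : ParamRing n →ₐ[ℂ] K :=
  MvPolynomial.aeval (Sum.elim (fun q => A q.1 q.2) c)

theorem paramX_map {n : ℕ} {K : Type*} [CommRing K] [Algebra ℂ K]
    (A : Matrix (Fin n) (Fin n) K) (c : Fin n → K) : (paramX n).map (paramEval A c) = A := by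
  ext i j
  simp [paramX, paramEval]

theorem paramY_map {n : ℕ} {K : Type*} [CommRing K] [Algebra ℂ K]
    (A : Matrix (Fin n) (Fin n) K) (c : Fin n → K) :
    (paramY n).map (paramEval A c) = ∑ k : Fin n, c k • A ^ (k : ℕ) := by
  have hpow : ∀ k : ℕ, (paramX n ^ k).map (paramEval A c) = A ^ k := fun k => by
    have := Matrix.map_pow (paramX n) (paramEval A c).toRingHom k
    exact this.trans (congrArg (· ^ k) (paramX_map A c))
  ext i j
  simp only [paramY, Matrix.map_apply, Matrix.sum_apply, map_sum, Matrix.smul_apply, smul_eq_mul,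
    map_mul]
  refine Finset.sum_congr rfl fun k _ => ?_
  rw [← hpow k, Matrix.map_apply]
  simp [paramEval]

/-- Polynomials vanishing on all pairs `(X, q(X))` vanish on every commuting pair `(A, B)` over a
domain such that `A` has a cyclic vector. -/
theorem matEval_eq_zero_of_commute {n : ℕ} {K : Type*} [CommRing K] [IsDomain K] [Algebra ℂ K]
    {A B : Matrix (Fin n) (Fin n) K} (hAB : Commute A B) {v : Fin n → K}
    (hv : (krylovMatrix A v).det ≠ 0) {f : PolyRing n}
    (hf : matEval (paramX n) (paramY n) f = 0) : matEval A B f = 0 := by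
  let L := FractionRing K
  let h : K →ₐ[ℂ] L := IsScalarTower.toAlgHom ℂ K L
  have hinj : Function.Injective h := IsFractionRing.injective K L
  apply hinj
  rw [map_zero, map_matEval]
  have hAB' : Commute (A.map h) (B.map h) := hAB.map (h.toRingHom.mapMatrix)
  have hv' : (krylovMatrix (A.map h) (h ∘ v)).det ≠ 0 := by
    have h1 := krylovMatrix_map h.toRingHom A v
    have h2 := RingHom.map_det h.toRingHom (krylovMatrix A v)
    change krylovMatrix (A.map h) (h ∘ v) = _ at h1
    rw [h1]
    change _ = Matrix.det ((krylovMatrix A v).map _) at h2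
    rw [← h2]
    exact fun h0 => hv (hinj (h0.trans (map_zero h).symm))
  obtain ⟨c, hc⟩ := exists_eq_sum_smul_pow hAB' hv'
  have h0 := congrArg (paramEval (A.map h) c) hf
  rwa [map_matEval, paramX_map, paramY_map, ← hc, map_zero] at h0

/-- Irreducibility of the commuting variety (Motzkin–Taussky): its vanishing ideal is the kernel of
a map to a polynomial ring. -/
theorem mem_vanishingIdeal_commuting_iff {n : ℕ} {f : PolyRing n} :
    f ∈ vanishingIdeal n {p : MatC n × MatC n | p.1 * p.2 = p.2 * p.1} ↔
      matEval (paramX n) (paramY n) f = 0 := by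
  rw [mem_vanishingIdeal_iff]
  refine ⟨fun h => MvPolynomial.funext fun s => ?_, fun hf => ?_⟩
  · rw [map_zero]
    obtain ⟨A, c, hs⟩ : ∃ (A : MatC n) (c : Fin n → ℂ), s = Sum.elim (fun q => A q.1 q.2) c :=
      ⟨Matrix.of fun i j => s (Sum.inl (i, j)), s ∘ Sum.inr, by ext (q | q) <;> rfl⟩
    rw [hs]
    change paramEval A c (matEval (paramX n) (paramY n) f) = 0
    rw [map_matEval, paramX_map, paramY_map]
    have hcomm : Commute A (∑ k : Fin n, c k • A ^ (k : ℕ)) :=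
      Commute.sum_right _ _ _ fun k _ => ((Commute.refl A).pow_right _).smul_right _
    exact h (A, _) hcomm
  · rintro ⟨X, Y⟩ (hXY : Commute X Y)
    obtain ⟨Z, v, hZY, hv⟩ := exists_commute_krylovMatrix_det_ne_zero Y
    let ι : ℂ →+* Polynomial ℂ := Polynomial.C
    let A : Matrix (Fin n) (Fin n) (Polynomial ℂ) :=
      (Polynomial.X : Polynomial ℂ) • X.map ι + (1 - Polynomial.X : Polynomial ℂ) • Z.map ι
    have hA : ∀ t : ℂ, A.map (Polynomial.aeval t) = t • X + (1 - t) • Z := fun t => by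
      ext i j
      simp only [A, ι, Matrix.map_apply, Matrix.add_apply, Matrix.smul_apply, smul_eq_mul, map_add,
        map_mul, map_sub, map_one, Polynomial.aeval_X, Polynomial.aeval_C, Algebra.algebraMap_self_apply]
    have hB : ∀ t : ℂ, (Y.map ι).map (Polynomial.aeval t) = Y := fun t => by
      ext i j
      simp [ι]
    have hcomm : Commute A (Y.map ι) :=
      ((hXY.map ι.mapMatrix).smul_left _).add_left ((hZY.map ι.mapMatrix).smul_left _)
    have hdet : (krylovMatrix A (ι ∘ v)).det ≠ 0 := fun h0 => hv <| by
      have h1 := congrArg (Polynomial.aeval (0 : ℂ)).toRingHom h0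
      rw [RingHom.map_det, map_zero, RingHom.mapMatrix_apply, ← krylovMatrix_map] at h1
      have h2 : A.map (Polynomial.aeval (0 : ℂ)).toRingHom = Z := by
        have := hA 0
        rw [zero_smul, sub_zero, one_smul, zero_add] at this
        exact this
      have h3 : (Polynomial.aeval (0 : ℂ)).toRingHom ∘ ι ∘ v = v := by
        ext i
        simp [ι]
      rwa [h2, h3] at h1
    have h0 := congrArg (Polynomial.aeval (1 : ℂ)) (matEval_eq_zero_of_commute hcomm hdet hf)
    rw [map_matEval, hA, hB, map_zero, one_smul, sub_self, zero_smul, add_zero] at h0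
    exact h0

theorem vanishingIdeal_commuting_isPrime (n : ℕ) :
    (vanishingIdeal n {p : MatC n × MatC n | p.1 * p.2 = p.2 * p.1}).IsPrime := by
  have h : vanishingIdeal n {p : MatC n × MatC n | p.1 * p.2 = p.2 * p.1} =
      RingHom.ker (matEval (paramX n) (paramY n)) :=
    Ideal.ext fun f => mem_vanishingIdeal_commuting_iff.trans RingHom.mem_ker.symm
  rw [h]
  exact RingHom.ker_isPrime _

theorem diagCommIdeal_le_vanishingIdeal_commuting (n : ℕ) :
    diagCommIdeal n ≤ vanishingIdeal n {p : MatC n × MatC n | p.1 * p.2 = p.2 * p.1} := by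
  refine Ideal.span_le.mpr ?_
  rintro _ ⟨i, j, -, rfl⟩
  refine mem_vanishingIdeal_iff.mpr ?_
  rintro ⟨X, Y⟩ (h : X * Y = Y * X)
  have h1 := congrFun (congrFun h i) j
  simp only [Matrix.mul_apply] at h1
  simp [matEval, Matrix.mul_apply, Xgen, Ygen, h1]

/-- The matrix with entries `(A ^ k)_{ii}` in row `k` and column `i`. -/
def powDiagMatrix {n : ℕ} {K : Type*} [CommRing K] (A : Matrix (Fin n) (Fin n) K) :
    Matrix (Fin n) (Fin n) K :=
  Matrix.of fun k i => (A ^ (k : ℕ)) i i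

theorem powDiagMatrix_map {n : ℕ} {K L : Type*} [CommRing K] [CommRing L] (h : K →+* L)
    (A : Matrix (Fin n) (Fin n) K) : powDiagMatrix (A.map h) = (powDiagMatrix A).map h := by
  ext k i
  simp only [powDiagMatrix, Matrix.of_apply, Matrix.map_apply]
  rw [← Matrix.map_pow, Matrix.map_apply]

/-- If `AB - BA` is diagonal and the diagonals of `1, A, …, A ^ (n - 1)` are linearly independent,
then `A` and `B` commute, since `AB - BA` is trace-orthogonal to the powers of `A`. -/
theorem commute_of_diagonal_commutator {n : ℕ} {K : Type*} [CommRing K] [IsDomain K]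
    {A B : Matrix (Fin n) (Fin n) K} (hd : (powDiagMatrix A).det ≠ 0)
    (h : ∀ i j, i ≠ j → (A * B - B * A) i j = 0) : Commute A B := by
  have hv : (powDiagMatrix A).mulVec (fun i => (A * B - B * A) i i) = 0 := by
    ext k
    have ht : (A ^ (k : ℕ) * (A * B - B * A)).trace = 0 := by
      rw [mul_sub, Matrix.trace_sub, ← mul_assoc, ← mul_assoc, mul_assoc _ B A,
        Matrix.trace_mul_comm _ (B * A), Matrix.trace_mul_comm _ B, mul_assoc B A, ← pow_succ,
        ← pow_succ', sub_self]
    rw [Pi.zero_apply, ← ht, Matrix.trace, Matrix.mulVec, dotProduct]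
    refine Finset.sum_congr rfl fun i _ => ?_
    rw [Matrix.diag_apply, Matrix.mul_apply, Finset.sum_eq_single i]
    · rfl
    · intro j _ hj
      rw [h j i hj, mul_zero]
    · simp
  have h0 := Matrix.eq_zero_of_mulVec_eq_zero hd hv
  refine sub_eq_zero.mp (Matrix.ext fun i j => ?_)
  by_cases hij : i = j
  · subst hij
    exact congrFun h0 i
  · exact h i j hij

theorem krylovMatrix_diagonal {n : ℕ} {K : Type*} [CommRing K] (d : Fin n → K) :
    krylovMatrix (Matrix.diagonal d) 1 = Matrix.vandermonde d := by
  ext i k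
  simp [krylovMatrix, Matrix.diagonal_pow, Matrix.mulVec_diagonal, Matrix.vandermonde_apply]

theorem powDiagMatrix_diagonal {n : ℕ} {K : Type*} [CommRing K] (d : Fin n → K) :
    powDiagMatrix (Matrix.diagonal d) = (Matrix.vandermonde d).transpose := by
  ext i k
  simp [powDiagMatrix, Matrix.diagonal_pow, Matrix.vandermonde_apply]

theorem notMem_vanishingIdeal_commuting {n : ℕ} {f : PolyRing n}
    (h : matEval (Matrix.diagonal fun i : Fin n => ((i : ℕ) : ℂ)) 0 f ≠ 0) :
    f ∉ vanishingIdeal n {p : MatC n × MatC n | p.1 * p.2 = p.2 * p.1} := fun hf =>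
  h (mem_vanishingIdeal_iff.mp hf (_, 0) (Commute.zero_right _))

theorem Xgen_map {n : ℕ} {K : Type*} [CommRing K] [Algebra ℂ K]
    (A B : Matrix (Fin n) (Fin n) K) : (Xgen n).map (matEval A B) = A := by
  ext i j
  simp [Xgen, matEval]

theorem det_vandermonde_natCast_ne_zero (n : ℕ) :
    (Matrix.vandermonde fun i : Fin n => ((i : ℕ) : ℂ)).det ≠ 0 :=
  Matrix.det_vandermonde_ne_zero_iff.mpr fun _ _ h => Fin.ext (Nat.cast_injective h)

theorem det_krylovMatrix_notMem (n : ℕ) : (krylovMatrix (Xgen n) 1).det ∉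
    vanishingIdeal n {p : MatC n × MatC n | p.1 * p.2 = p.2 * p.1} := by
  refine notMem_vanishingIdeal_commuting ?_
  set ψ := matEval (Matrix.diagonal fun i : Fin n => ((i : ℕ) : ℂ)) 0 with hψ
  have h1 : ψ (krylovMatrix (Xgen n) 1).det = ((krylovMatrix (Xgen n) 1).map ψ.toRingHom).det :=
    RingHom.map_det ψ.toRingHom _
  have h2 : (ψ.toRingHom ∘ 1 : Fin n → ℂ) = 1 := funext fun _ => map_one ψ
  have h3 : (Xgen n).map ψ.toRingHom = _ := Xgen_map _ _
  rw [h1, ← krylovMatrix_map, h2, h3, krylovMatrix_diagonal]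
  exact det_vandermonde_natCast_ne_zero n

theorem det_powDiagMatrix_notMem (n : ℕ) : (powDiagMatrix (Xgen n)).det ∉
    vanishingIdeal n {p : MatC n × MatC n | p.1 * p.2 = p.2 * p.1} := by
  refine notMem_vanishingIdeal_commuting ?_
  set ψ := matEval (Matrix.diagonal fun i : Fin n => ((i : ℕ) : ℂ)) 0 with hψ
  have h1 : ψ (powDiagMatrix (Xgen n)).det = ((powDiagMatrix (Xgen n)).map ψ.toRingHom).det :=
    RingHom.map_det ψ.toRingHom _
  have h3 : (Xgen n).map ψ.toRingHom = _ := Xgen_map _ _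
  rw [h1, ← powDiagMatrix_map, h3, powDiagMatrix_diagonal, Matrix.det_transpose]
  exact det_vandermonde_natCast_ne_zero n

/-- The vanishing ideal of the commuting variety `C = {(X,Y) : XY = YX}` is a
minimal prime over `I`: the commuting variety is an irreducible component of
the diagonal commutator scheme. -/
theorem stmt2 (n : ℕ) (hn : 1 ≤ n) :
    vanishingIdeal n {p : MatC n × MatC n | p.1 * p.2 = p.2 * p.1} ∈
      (diagCommIdeal n).minimalPrimes := by
  refine ⟨⟨vanishingIdeal_commuting_isPrime n, diagCommIdeal_le_vanishingIdeal_commuting n⟩, ?_⟩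
  rintro Q ⟨hQ, hIQ⟩ hQP f hf
  let π : PolyRing n →ₐ[ℂ] PolyRing n ⧸ Q := Ideal.Quotient.mkₐ ℂ Q
  have hπ : ∀ {g}, g ∉ vanishingIdeal n {p : MatC n × MatC n | p.1 * p.2 = p.2 * p.1} →
      π g ≠ 0 := fun hg h0 => hg (hQP (Ideal.Quotient.eq_zero_iff_mem.mp h0))
  have hcomm : Commute ((Xgen n).map π) ((Ygen n).map π) := by
    refine commute_of_diagonal_commutator ?_ fun i j hij => ?_
    · have h1 : π (powDiagMatrix (Xgen n)).det = ((powDiagMatrix (Xgen n)).map π.toRingHom).det :=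
        RingHom.map_det π.toRingHom _
      rw [← powDiagMatrix_map] at h1
      exact fun h0 => hπ (det_powDiagMatrix_notMem n) (h1.trans h0)
    · have h1 : π ((Xgen n * Ygen n - Ygen n * Xgen n) i j) = 0 :=
        Ideal.Quotient.eq_zero_iff_mem.mpr (hIQ (Ideal.subset_span ⟨i, j, hij, rfl⟩))
      rw [← h1]
      simp [Matrix.mul_apply]
  have hdet : (krylovMatrix ((Xgen n).map π) (π ∘ 1)).det ≠ 0 := by
    have h1 : π (krylovMatrix (Xgen n) 1).det = ((krylovMatrix (Xgen n) 1).map π.toRingHom).det :=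
      RingHom.map_det π.toRingHom _
    rw [← krylovMatrix_map] at h1
    exact fun h0 => hπ (det_krylovMatrix_notMem n) (h1.trans h0)
  have h0 := matEval_eq_zero_of_commute hcomm hdet (mem_vanishingIdeal_commuting_iff.mp hf)
  rw [← map_matEval, matEval_generic] at h0
  exact Ideal.Quotient.eq_zero_iff_mem.mp h0
end
end
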